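/- There exists a family of positive real numbers (q_{n,m})_{n≥1, m≥1} with ∑_{n,m≥1} q_{n,m} = 1 such that for every pair of positive integers (n,m), lim_{T→∞} ℙ_T({γ ∈ Γ_T : |Tr(γ)| > 2, u_γ = n and f_γ = m}) = q_{n,m}. -/

import Mathlib

noncomputable section

open Matrix Filter Topology

/-- `Γ = SL(2,ℤ)`. -/
abbrev SL2Z := Matrix.SpecialLinearGroup (Fin 2) ℤ

/-- Frobenius norm of a matrix in `SL(2,ℤ)`. -/
noncomputable def frobNorm (γ : SL2Z) : ℝ :=
  Real.sqrt ((γ 0 0 ^ 2 + γ 0 1 ^ 2 + γ 1 0 ^ 2 + γ 1 1 ^ 2 : ℤ) : ℝ)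

/-- Trace of a matrix in `SL(2,ℤ)`. -/
def trZ (γ : SL2Z) : ℤ := γ 0 0 + γ 1 1

/-- `u_γ = gcd(c, d-a, b)` for `γ = (a b; c d)`. -/
def uGamma (γ : SL2Z) : ℕ :=
  Int.gcd (γ 1 0) (Int.gcd (γ 1 1 - γ 0 0) (γ 0 1))

/-- `u_γ = n` and `f_γ = m`, where `f_γ` is defined from the unique decomposition
`Tr(γ)² - 4 = m_γ² D_γ` with `m_γ ≥ 1` and `D_γ > 1` squarefree:
`m_γ = u_γ f_γ` if `D_γ ≡ 1 (mod 4)` and `m_γ = 2 u_γ f_γ` otherwise. -/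
def HasUF (γ : SL2Z) (n m : ℕ) : Prop :=
  uGamma γ = n ∧
    ∃ mm D : ℤ, 1 ≤ mm ∧ 1 < D ∧ Squarefree D ∧
      (trZ γ) ^ 2 - 4 = mm ^ 2 * D ∧
      (if D % 4 = 1 then mm = (n : ℤ) * (m : ℤ) else mm = 2 * (n : ℤ) * (m : ℤ))

theorem card_divisors_le_rpow {ε : ℝ} (hε : 0 < ε) :
    ∃ C : ℝ, 1 ≤ C ∧ ∀ n : ℕ, n ≠ 0 → (n.divisors.card : ℝ) ≤ C * (n : ℝ) ^ ε := by
  obtain ⟨P, hP⟩ := exists_nat_ge ((2 : ℝ) ^ (1 / ε))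
  set B : ℝ := max 1 (1 / (ε * Real.log 2)) with hB
  have hB1 : 1 ≤ B := le_max_left _ _
  have hl2 : 0 < Real.log 2 := Real.log_pos (by norm_num)
  have hsmall : ∀ p a : ℕ, 2 ≤ p → ((a + 1 : ℕ) : ℝ) ≤ B * ((p : ℝ) ^ a) ^ ε := by
    intro p a hp
    have hp' : (2 : ℝ) ≤ p := by exact_mod_cast hp
    have h1 : (2 : ℝ) ^ (a * ε) ≤ ((p : ℝ) ^ a) ^ ε := by
      rw [← Real.rpow_natCast, ← Real.rpow_mul (by positivity)]
      exact Real.rpow_le_rpow (by norm_num) hp' (by positivity)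
    have h2 : a * ε * Real.log 2 + 1 ≤ (2 : ℝ) ^ (a * ε) := by
      rw [Real.rpow_def_of_pos (by norm_num)]
      have := Real.add_one_le_exp (Real.log 2 * (a * ε))
      linarith
    have h3 : (a : ℝ) ≤ B * (a * ε * Real.log 2) := by
      have : 1 / (ε * Real.log 2) * (a * ε * Real.log 2) = a := by field_simp
      calc (a : ℝ) = 1 / (ε * Real.log 2) * (a * ε * Real.log 2) := this.symm
        _ ≤ _ := by gcongr; exact le_max_right _ _
    push_cast
    nlinarith
  have hlarge : ∀ p a : ℕ, P ≤ p → ((a + 1 : ℕ) : ℝ) ≤ ((p : ℝ) ^ a) ^ ε := by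
    intro p a hp
    have hp' : (2 : ℝ) ^ (1 / ε) ≤ p := hP.trans (by exact_mod_cast hp)
    have h0 : (0 : ℝ) < p := lt_of_lt_of_le (by positivity) hp'
    have h1 : (2 : ℝ) ≤ (p : ℝ) ^ ε := by
      calc (2 : ℝ) = ((2 : ℝ) ^ (1 / ε)) ^ ε := by
            rw [← Real.rpow_mul (by norm_num)]; field_simp; simp
        _ ≤ _ := Real.rpow_le_rpow (by positivity) hp' hε.le
    have h2 : ((p : ℝ) ^ a) ^ ε = ((p : ℝ) ^ ε) ^ a := by
      rw [← Real.rpow_natCast, ← Real.rpow_mul h0.le, mul_comm, Real.rpow_mul h0.le,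
        Real.rpow_natCast]
    rw [h2]
    calc ((a + 1 : ℕ) : ℝ) ≤ (2 : ℝ) ^ a := by exact_mod_cast Nat.lt_two_pow_self (n := a)
      _ ≤ _ := by gcongr
  refine ⟨B ^ P, one_le_pow₀ hB1, fun n hn => ?_⟩
  rw [Nat.card_divisors hn]
  have hn' : (n : ℝ) ^ ε = ∏ p ∈ n.primeFactors, ((p : ℝ) ^ (n.factorization p)) ^ ε := by
    rw [Real.finsetProd_rpow _ _ (fun i _ => by positivity)]
    congr 1
    conv_lhs => rw [← Nat.prod_factorization_pow_eq_self hn]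
    rw [Finsupp.prod]; push_cast; rfl
  rw [hn']
  push_cast
  calc ∏ p ∈ n.primeFactors, ((n.factorization p : ℝ) + 1)
      ≤ ∏ p ∈ n.primeFactors, ((if p < P then B else 1) * ((p : ℝ) ^ (n.factorization p)) ^ ε) := by
        apply Finset.prod_le_prod
        · intros; positivity
        · intro p hp
          split_ifs with h
          · exact_mod_cast hsmall p _ (Nat.prime_of_mem_primeFactors hp).two_le
          · simpa using hlarge p (n.factorization p) (by omega)
    _ = (∏ p ∈ n.primeFactors, (if p < P then B else 1)) * ∏ p ∈ n.primeFactors, ((p : ℝ) ^ (n.factorization p)) ^ ε :=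
        Finset.prod_mul_distrib
    _ ≤ _ := by
        gcongr
        rw [Finset.prod_ite]
        simp only [Finset.prod_const, one_pow, mul_one]
        apply pow_le_pow_right₀ hB1
        calc _ ≤ (Finset.range P).card := Finset.card_le_card (by
              intro p; simp)
          _ = P := by simp

theorem le_card_divisors_mul_totient (n : ℕ) : n ≤ n.divisors.card * n.totient := by
  rcases Nat.eq_zero_or_pos n with rfl | hn
  · simp
  conv_lhs => rw [← Nat.sum_totient n]
  rw [← smul_eq_mul]
  apply Finset.sum_le_card_nsmul
  intro d hd
  exact Nat.le_of_dvd (Nat.totient_pos.2 hn) (Nat.totient_dvd_of_dvd (Nat.dvd_of_mem_divisors hd))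

theorem norm_sq_charSum {n : ℕ} [NeZero n] {ι : Type*} [Fintype ι] (f g : ι → ZMod n) :
    ∑ h : ZMod n, ∑ k : ZMod n, ‖∑ i, ZMod.stdAddChar (h * f i + k * g i)‖ ^ 2
      = (n : ℝ) ^ 2 * (Finset.univ.filter (fun p : ι × ι => f p.1 = f p.2 ∧ g p.1 = g p.2)).card := by
  classical
  have key : ∀ a : ZMod n, ∑ h : ZMod n, ZMod.stdAddChar (h * a) = if a = 0 then (n : ℂ) else 0 := by
    intro a
    have := AddChar.sum_mulShift a (ZMod.isPrimitive_stdAddChar n)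
    simpa [ZMod.card] using this
  have hsq : ∀ z : ℂ, ((‖z‖ ^ 2 : ℝ) : ℂ) = z * (starRingEnd ℂ) z := by
    intro z; rw [Complex.mul_conj, Complex.normSq_eq_norm_sq]
  have : (((∑ h : ZMod n, ∑ k : ZMod n, ‖∑ i, ZMod.stdAddChar (h * f i + k * g i)‖ ^ 2 : ℝ)) : ℂ)
      = (((n : ℝ) ^ 2 * (Finset.univ.filter (fun p : ι × ι => f p.1 = f p.2 ∧ g p.1 = g p.2)).card : ℝ) : ℂ) := by
    rw [Complex.ofReal_sum]
    calc _ = ∑ h : ZMod n, ∑ k : ZMod n, ∑ p : ι × ι,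
          ZMod.stdAddChar (h * (f p.1 - f p.2)) * ZMod.stdAddChar (k * (g p.1 - g p.2)) := by
          refine Finset.sum_congr rfl fun h _ => ?_
          rw [Complex.ofReal_sum]
          refine Finset.sum_congr rfl fun k _ => ?_
          rw [hsq, map_sum, Finset.sum_mul_sum, ← Finset.univ_product_univ, Finset.sum_product]
          refine Finset.sum_congr rfl fun i _ => Finset.sum_congr rfl fun j _ => ?_
          rw [← AddChar.map_neg_eq_conj, ← AddChar.map_add_eq_mul, ← AddChar.map_add_eq_mul]
          congr 1; ring
      _ = ∑ p : ι × ι, (∑ h : ZMod n, ZMod.stdAddChar (h * (f p.1 - f p.2))) *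
            ∑ k : ZMod n, ZMod.stdAddChar (k * (g p.1 - g p.2)) := by
          simp_rw [Finset.sum_mul_sum]
          rw [Finset.sum_comm (s := (Finset.univ : Finset (ι × ι)))]
          exact Finset.sum_congr rfl fun h _ => Finset.sum_comm
      _ = _ := by
          simp_rw [key, sub_eq_zero]
          rw [Finset.card_filter]
          push_cast
          rw [Finset.mul_sum]
          refine Finset.sum_congr rfl fun p _ => ?_
          by_cases h1 : f p.1 = f p.2 <;> by_cases h2 : g p.1 = g p.2 <;> simp [h1, h2, sq]
  exact_mod_cast this

/-- Kloosterman sums modulo `n`. -/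
def kloos (n : ℕ) [NeZero n] (h k : ZMod n) : ℂ :=
  ∑ u : (ZMod n)ˣ, ZMod.stdAddChar (h * (u : ZMod n) + k * ((u⁻¹ : (ZMod n)ˣ) : ZMod n))

theorem kloos_mul_unit {n : ℕ} [NeZero n] (h k : ZMod n) (t : (ZMod n)ˣ) :
    kloos n (h * t) (k * (t⁻¹ : (ZMod n)ˣ)) = kloos n h k := by
  unfold kloos
  refine Fintype.sum_equiv (Equiv.mulLeft t) _ _ fun u => ?_
  simp only [Equiv.coe_mulLeft, mul_inv, Units.val_mul]
  congr 1; ring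

theorem card_dvd_val {n : ℕ} [NeZero n] {e : ℕ} (he : e ∣ n) :
    (Finset.univ.filter (fun x : ZMod n => e ∣ x.val)).card * e = n := by
  have hn : 0 < n := NeZero.pos n
  have : (Finset.univ.filter (fun x : ZMod n => e ∣ x.val)).card
      = ((Finset.range n).filter (fun x => e ∣ x)).card := by
    refine Finset.card_bij (fun x _ => x.val) ?_ ?_ ?_
    · intro x hx; simpa [ZMod.val_lt] using hx
    · intro x _ y _ h; exact ZMod.val_injective n h
    · intro b hb
      simp only [Finset.mem_filter, Finset.mem_range] at hb
      exact ⟨(b : ZMod n), by simp [ZMod.val_natCast, Nat.mod_eq_of_lt hb.1, hb.2],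
        by simp [ZMod.val_natCast, Nat.mod_eq_of_lt hb.1]⟩
  rw [this]
  obtain ⟨d, rfl⟩ := he
  have he0 : 0 < e := Nat.pos_of_mul_pos_right hn
  have : ((Finset.range (e * d)).filter (fun x => e ∣ x)) = (Finset.range d).image (fun i => e * i) := by
    ext x
    simp only [Finset.mem_filter, Finset.mem_range, Finset.mem_image]
    constructor
    · rintro ⟨h, i, rfl⟩
      exact ⟨i, lt_of_mul_lt_mul_left h (Nat.zero_le _), rfl⟩
    · rintro ⟨i, h, rfl⟩
      exact ⟨Nat.mul_lt_mul_of_pos_left h he0, dvd_mul_right _ _⟩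
  rw [this, Finset.card_image_of_injective _ (fun a b h => Nat.eq_of_mul_eq_mul_left he0 h)]
  simp [mul_comm]

theorem card_le_of_injective_triple {n : ℕ} [NeZero n] {e₁ e₂ : ℕ} (h₁ : e₁ ∣ n) (h₂ : e₂ ∣ n)
    (A : Finset (ZMod n × ZMod n × ZMod n)) (φ : ZMod n × ZMod n × ZMod n → ZMod n × ZMod n × ZMod n)
    (hφ : Function.Injective φ) (h : ∀ x ∈ A, e₁ ∣ (φ x).2.1.val ∧ e₂ ∣ (φ x).2.2.val) :
    A.card * (e₁ * e₂) ≤ n ^ 3 := by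
  have : A.card ≤ ((Finset.univ : Finset (ZMod n)) ×ˢ
      (Finset.univ.filter (fun x : ZMod n => e₁ ∣ x.val)) ×ˢ
      (Finset.univ.filter (fun x : ZMod n => e₂ ∣ x.val))).card :=
    Finset.card_le_card_of_injOn φ (fun x hx => by
      have := h x hx
      simp only [Finset.coe_product, Set.mem_prod]
      simpa using this) hφ.injOn
  rw [Finset.card_product, Finset.card_product, Finset.card_univ, ZMod.card] at this
  have a1 := card_dvd_val h₁
  have a2 := card_dvd_val h₂
  calc _ ≤ _ := Nat.mul_le_mul_right _ this
    _ = n * ((Finset.univ.filter (fun x : ZMod n => e₁ ∣ x.val)).card * e₁) *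
      ((Finset.univ.filter (fun x : ZMod n => e₂ ∣ x.val)).card * e₂) := by ring
    _ = _ := by rw [a1, a2]; ring

theorem dvd_gcd_mul_of_mul_eq_zero {n : ℕ} [NeZero n] {x y z : ZMod n} (h : x * y * z = 0) :
    n ∣ n.gcd x.val * n.gcd y.val * n.gcd z.val := by
  have h1 : n ∣ x.val * y.val * z.val := by
    rw [← ZMod.natCast_eq_zero_iff]; simpa using h
  calc n = n.gcd (x.val * y.val * z.val) := (Nat.gcd_eq_left h1).symm
    _ ∣ n.gcd (x.val * y.val) * n.gcd z.val := Nat.gcd_mul_right_dvd_mul_gcd _ _ _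
    _ ∣ _ := mul_dvd_mul (Nat.gcd_mul_right_dvd_mul_gcd _ _ _) dvd_rfl

theorem card_cubic_le (n : ℕ) [NeZero n] :
    ((Finset.univ.filter (fun x : ZMod n × ZMod n × ZMod n =>
      (x.1 + x.2.1) * (x.2.2 - x.1) * (x.2.2 - x.2.1) = 0)).card : ℝ)
      ≤ (n.divisors.card : ℝ) ^ 3 * (n : ℝ) ^ (7 / 3 : ℝ) := by
  classical
  have hn : n ≠ 0 := NeZero.ne n
  set Z := Finset.univ.filter (fun x : ZMod n × ZMod n × ZMod n =>
      (x.1 + x.2.1) * (x.2.2 - x.1) * (x.2.2 - x.2.1) = 0)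
  set G : ZMod n × ZMod n × ZMod n → ℕ × ℕ × ℕ := fun x =>
    (n.gcd (x.1 + x.2.1).val, n.gcd (x.2.2 - x.1).val, n.gcd (x.2.2 - x.2.1).val)
  have hmaps : ∀ x ∈ Z, G x ∈ n.divisors ×ˢ n.divisors ×ˢ n.divisors := by
    intro x _
    simp [G, hn, Nat.gcd_dvd_left]
  have hfib : ∀ e ∈ n.divisors ×ˢ n.divisors ×ˢ n.divisors,
      ((Z.filter (fun x => G x = e)).card : ℝ) ≤ (n : ℝ) ^ (7 / 3 : ℝ) := by
    rintro ⟨e₁, e₂, e₃⟩ he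
    simp only [Finset.mem_product, Nat.mem_divisors] at he
    set A := Z.filter (fun x => G x = (e₁, e₂, e₃))
    have hA : ∀ x ∈ A, e₁ ∣ (x.1 + x.2.1).val ∧ e₂ ∣ (x.2.2 - x.1).val ∧ e₃ ∣ (x.2.2 - x.2.1).val ∧
        n ∣ e₁ * e₂ * e₃ := by
      intro x hx
      simp only [A, Z, G, Finset.mem_filter, Finset.mem_univ, true_and, Prod.mk.injEq] at hx
      obtain ⟨h0, rfl, rfl, rfl⟩ := hx
      exact ⟨Nat.gcd_dvd_right _ _, Nat.gcd_dvd_right _ _, Nat.gcd_dvd_right _ _,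
        dvd_gcd_mul_of_mul_eq_zero h0⟩
    rcases A.eq_empty_or_nonempty with hAe | ⟨x0, hx0⟩
    · rw [hAe]; simp; positivity
    have hne : n ≤ e₁ * e₂ * e₃ := by
      refine Nat.le_of_dvd ?_ (hA x0 hx0).2.2.2
      have h1 := Nat.pos_of_dvd_of_pos he.1.1 (Nat.pos_of_ne_zero hn)
      have h2 := Nat.pos_of_dvd_of_pos he.2.1.1 (Nat.pos_of_ne_zero hn)
      have h3 := Nat.pos_of_dvd_of_pos he.2.2.1 (Nat.pos_of_ne_zero hn)
      positivity
    have b12 : A.card * (e₁ * e₂) ≤ n ^ 3 :=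
      card_le_of_injective_triple he.1.1 he.2.1.1 A (fun x => (x.1, x.1 + x.2.1, x.2.2 - x.1))
        (by rintro ⟨a, b, c⟩ ⟨a', b', c'⟩ h
            simp only [Prod.mk.injEq] at h ⊢
            obtain ⟨rfl, h2, h3⟩ := h
            exact ⟨rfl, by simpa using h2, by simpa using h3⟩)
        (fun x hx => ⟨(hA x hx).1, (hA x hx).2.1⟩)
    have b13 : A.card * (e₁ * e₃) ≤ n ^ 3 :=
      card_le_of_injective_triple he.1.1 he.2.2.1 A (fun x => (x.2.1, x.1 + x.2.1, x.2.2 - x.2.1))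
        (by rintro ⟨a, b, c⟩ ⟨a', b', c'⟩ h
            simp only [Prod.mk.injEq] at h ⊢
            obtain ⟨rfl, h2, h3⟩ := h
            exact ⟨by simpa using h2, rfl, by simpa using h3⟩)
        (fun x hx => ⟨(hA x hx).1, (hA x hx).2.2.1⟩)
    have b23 : A.card * (e₂ * e₃) ≤ n ^ 3 :=
      card_le_of_injective_triple he.2.1.1 he.2.2.1 A (fun x => (x.2.2, x.2.2 - x.1, x.2.2 - x.2.1))
        (by rintro ⟨a, b, c⟩ ⟨a', b', c'⟩ h
            simp only [Prod.mk.injEq] at h ⊢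
            obtain ⟨rfl, h2, h3⟩ := h
            exact ⟨by simpa using h2, by simpa using h3, rfl⟩)
        (fun x hx => ⟨(hA x hx).2.1, (hA x hx).2.2.1⟩)
    have hc : A.card ^ 3 ≤ n ^ 7 := by
      have h9 : A.card ^ 3 * (e₁ * e₂ * e₃) ^ 2 ≤ n ^ 9 := by
        calc A.card ^ 3 * (e₁ * e₂ * e₃) ^ 2
            = (A.card * (e₁ * e₂)) * (A.card * (e₁ * e₃)) * (A.card * (e₂ * e₃)) := by ring
          _ ≤ n ^ 3 * n ^ 3 * n ^ 3 := by gcongr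
          _ = n ^ 9 := by ring
      have : A.card ^ 3 * n ^ 2 ≤ n ^ 7 * n ^ 2 := by
        calc _ ≤ A.card ^ 3 * (e₁ * e₂ * e₃) ^ 2 := by gcongr
          _ ≤ n ^ 9 := h9
          _ = _ := by ring
      exact Nat.le_of_mul_le_mul_right this (by positivity)
    have hc' : (A.card : ℝ) ^ 3 ≤ ((n : ℝ) ^ (7 / 3 : ℝ)) ^ 3 := by
      rw [← Real.rpow_natCast ((n : ℝ) ^ (7 / 3 : ℝ)), ← Real.rpow_mul (by positivity)]
      norm_num
      exact_mod_cast hc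
    exact le_of_pow_le_pow_left₀ (by norm_num) (by positivity) hc'
  rw [Finset.card_eq_sum_card_fiberwise hmaps]
  push_cast
  calc _ ≤ ∑ e ∈ n.divisors ×ˢ n.divisors ×ˢ n.divisors, (n : ℝ) ^ (7 / 3 : ℝ) :=
        Finset.sum_le_sum hfib
    _ = _ := by
      rw [Finset.sum_const, Finset.card_product, Finset.card_product, nsmul_eq_mul]
      push_cast; ring

theorem card_annihilated_le {n : ℕ} [NeZero n] (h k : ZMod n) :
    (Finset.univ.filter (fun x : ZMod n => h * x = 0 ∧ k * x = 0)).card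
      ≤ n.gcd (h.val.gcd k.val) := by
  set e := n.gcd (h.val.gcd k.val) with he
  have hen : e ∣ n := Nat.gcd_dvd_left _ _
  have hn : 0 < n := NeZero.pos n
  have he0 : 0 < e := Nat.pos_of_dvd_of_pos hen hn
  have hd : n / e ∣ n := Nat.div_dvd_of_dvd hen
  have h1 := card_dvd_val hd
  have hpos : 0 < n / e := Nat.div_pos (Nat.le_of_dvd hn hen) he0
  have h2 : (Finset.univ.filter (fun x : ZMod n => n / e ∣ x.val)).card = e := by
    have : e * (n / e) = n := Nat.mul_div_cancel' hen
    exact Nat.eq_of_mul_eq_mul_right hpos (by rw [h1, this])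
  rw [← h2]
  apply Finset.card_le_card
  intro x
  simp only [Finset.mem_filter, Finset.mem_univ, true_and]
  rintro ⟨hx, kx⟩
  have d1 : n ∣ h.val * x.val := by rw [← ZMod.natCast_eq_zero_iff]; simpa using hx
  have d2 : n ∣ k.val * x.val := by rw [← ZMod.natCast_eq_zero_iff]; simpa using kx
  have d3 : n ∣ e * x.val := by
    rw [he, ← Nat.gcd_mul_right, ← Nat.gcd_mul_right]
    exact Nat.dvd_gcd (dvd_mul_right _ _) (Nat.dvd_gcd d1 d2)
  have d4 : e * (n / e) ∣ e * x.val := by rwa [Nat.mul_div_cancel' hen]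
  exact Nat.dvd_of_mul_dvd_mul_left he0 d4

theorem kloos_fourth_moment (n : ℕ) [NeZero n] :
    ∑ h : ZMod n, ∑ k : ZMod n, ‖kloos n h k‖ ^ 4
      ≤ (n : ℝ) ^ 2 * ((n.divisors.card : ℝ) ^ 3 * (n : ℝ) ^ (7 / 3 : ℝ)) := by
  classical
  have h1 : ∀ h k : ZMod n, ‖kloos n h k‖ ^ 4 =
      ‖∑ p : (ZMod n)ˣ × (ZMod n)ˣ, ZMod.stdAddChar (h * ((p.1 : ZMod n) + (p.2 : ZMod n)) +
        k * (((p.1⁻¹ : (ZMod n)ˣ) : ZMod n) + ((p.2⁻¹ : (ZMod n)ˣ) : ZMod n)))‖ ^ 2 := by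
    intro h k
    have : kloos n h k ^ 2 = ∑ p : (ZMod n)ˣ × (ZMod n)ˣ, ZMod.stdAddChar (h * ((p.1 : ZMod n) + (p.2 : ZMod n)) +
        k * (((p.1⁻¹ : (ZMod n)ˣ) : ZMod n) + ((p.2⁻¹ : (ZMod n)ˣ) : ZMod n))) := by
      rw [kloos, sq, Finset.sum_mul_sum, ← Finset.univ_product_univ, Finset.sum_product]
      refine Finset.sum_congr rfl fun i _ => Finset.sum_congr rfl fun j _ => ?_
      rw [← AddChar.map_add_eq_mul]; congr 1; ring
    rw [← this, norm_pow]; ring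
  simp_rw [h1]
  rw [norm_sq_charSum]
  gcongr
  refine le_trans ?_ (card_cubic_le n)
  norm_cast
  refine Finset.card_le_card_of_injOn
    (fun p => ((p.1.1 : ZMod n), (p.1.2 : ZMod n), (p.2.1 : ZMod n))) ?_ ?_
  · rintro ⟨⟨u1, u2⟩, u3, u4⟩ hp
    simp only [Finset.coe_filter, Finset.mem_univ, true_and, Set.mem_ofPred_eq] at hp ⊢
    obtain ⟨ha, hb⟩ := hp
    have i1 : (u1 : ZMod n) * (u1⁻¹ : (ZMod n)ˣ) = 1 := by simp
    have i2 : (u2 : ZMod n) * (u2⁻¹ : (ZMod n)ˣ) = 1 := by simp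
    have i3 : (u3 : ZMod n) * (u3⁻¹ : (ZMod n)ˣ) = 1 := by simp
    have i4 : (u4 : ZMod n) * (u4⁻¹ : (ZMod n)ˣ) = 1 := by simp
    have hc : ((u1 : ZMod n) + u2) * (u3 * u4) = (u3 + u4) * (u1 * u2) := by
      have := congrArg (fun z => z * ((u1 : ZMod n) * u2 * u3 * u4)) hb
      linear_combination this - (u2 * u3 * u4 : ZMod n) * i1 - (u1 * u3 * u4 : ZMod n) * i2
        + (u1 * u2 * u4 : ZMod n) * i3 + (u1 * u2 * u3 : ZMod n) * i4
    have h4 : (u4 : ZMod n) = u1 + u2 - u3 := by linear_combination -ha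
    rw [h4] at hc
    linear_combination -hc
  · rintro ⟨⟨u1, u2⟩, u3, u4⟩ hp ⟨⟨v1, v2⟩, v3, v4⟩ hq h
    simp only [Finset.coe_filter, Finset.mem_univ, true_and, Set.mem_ofPred_eq] at hp hq
    simp only [Prod.mk.injEq, Units.val_inj] at h
    obtain ⟨rfl, rfl, rfl⟩ := h
    have : (u4 : ZMod n) = v4 := by linear_combination hq.1 - hp.1
    simp [Units.ext_iff, this]

theorem norm_kloos_le {n : ℕ} [NeZero n] (h k : ZMod n) :
    ‖kloos n h k‖ ≤ (n.divisors.card : ℝ) * (n.gcd (h.val.gcd k.val) : ℝ) * (n : ℝ) ^ (5 / 6 : ℝ) := by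
  classical
  set e := n.gcd (h.val.gcd k.val) with he
  have hn : 0 < n := NeZero.pos n
  have hn' : (0 : ℝ) < n := by exact_mod_cast hn
  have he1 : 1 ≤ e := Nat.pos_of_dvd_of_pos (Nat.gcd_dvd_left _ _) hn
  have h1 : (n.totient : ℝ) * ‖kloos n h k‖ ^ 4 ≤
      e * ∑ p : ZMod n × ZMod n, ‖kloos n p.1 p.2‖ ^ 4 := by
    set F : (ZMod n)ˣ → ZMod n × ZMod n := fun t => (h * t, k * (t⁻¹ : (ZMod n)ˣ))
    calc (n.totient : ℝ) * ‖kloos n h k‖ ^ 4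
        = ∑ t : (ZMod n)ˣ, ‖kloos n (F t).1 (F t).2‖ ^ 4 := by
          simp [F, kloos_mul_unit, ZMod.card_units_eq_totient]
      _ = ∑ p : ZMod n × ZMod n, ∑ t ∈ Finset.univ.filter (fun t => F t = p), ‖kloos n (F t).1 (F t).2‖ ^ 4 :=
          (Finset.sum_fiberwise _ _ _).symm
      _ ≤ ∑ p : ZMod n × ZMod n, e * ‖kloos n p.1 p.2‖ ^ 4 := by
          refine Finset.sum_le_sum fun p _ => ?_
          rw [Finset.sum_congr rfl (g := fun _ => ‖kloos n p.1 p.2‖ ^ 4)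
            (by intro t ht; rw [(Finset.mem_filter.1 ht).2]), Finset.sum_const, nsmul_eq_mul]
          gcongr
          rcases (Finset.univ.filter (fun t => F t = p)).eq_empty_or_nonempty with h0 | ⟨t0, ht0⟩
          · rw [h0]; simp
          refine le_trans ?_ (card_annihilated_le h k)
          refine Finset.card_le_card_of_injOn (fun t => (t : ZMod n) - t0) ?_ ?_
          · intro t ht
            have ht' : F t = F t0 := by
              rw [(Finset.mem_filter.1 ht0).2]; simpa using ht
            simp only [F, Prod.mk.injEq] at ht'
            simp only [Finset.coe_filter, Finset.mem_univ, true_and, Set.mem_ofPred_eq]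
            have i1 : (t : ZMod n) * (t⁻¹ : (ZMod n)ˣ) = 1 := by simp
            have i2 : (t0 : ZMod n) * (t0⁻¹ : (ZMod n)ˣ) = 1 := by simp
            refine ⟨by linear_combination ht'.1, ?_⟩
            linear_combination -(t * t0 : ZMod n) * ht'.2 + k * t0 * i1 - k * t * i2
          · intro t _ t' _ htt
            exact Units.ext (by simpa using htt)
      _ = _ := by rw [Finset.mul_sum]
  have h2 := kloos_fourth_moment n
  rw [← Finset.sum_product', Finset.univ_product_univ] at h2
  have h3 : (n : ℝ) ≤ n.divisors.card * n.totient := by exact_mod_cast le_card_divisors_mul_totient n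
  set τ : ℝ := (n.divisors.card : ℝ)
  set S := ‖kloos n h k‖
  have h4 : (n : ℝ) * S ^ 4 ≤ n * (τ * e * (n : ℝ) ^ (5 / 6 : ℝ)) ^ 4 := by
    have e1 : ((n : ℝ) ^ (5 / 6 : ℝ)) ^ 4 = n * (n : ℝ) ^ (7 / 3 : ℝ) := by
      rw [← Real.rpow_natCast, ← Real.rpow_mul hn'.le, ← Real.rpow_one_add' hn'.le (by norm_num)]
      norm_num
    have e2 : (e : ℝ) ≤ (e : ℝ) ^ 4 := le_self_pow₀ (by exact_mod_cast he1) (by norm_num)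
    calc (n : ℝ) * S ^ 4 ≤ τ * n.totient * S ^ 4 := by gcongr
      _ = τ * (n.totient * S ^ 4) := by ring
      _ ≤ τ * (e * ((n : ℝ) ^ 2 * (τ ^ 3 * (n : ℝ) ^ (7 / 3 : ℝ)))) := by
        exact mul_le_mul_of_nonneg_left (h1.trans (mul_le_mul_of_nonneg_left h2 (Nat.cast_nonneg e)))
          (Nat.cast_nonneg _)
      _ = (e : ℝ) * (τ ^ 4 * n ^ 2 * (n : ℝ) ^ (7 / 3 : ℝ)) := by ring
      _ ≤ (e : ℝ) ^ 4 * (τ ^ 4 * n ^ 2 * (n : ℝ) ^ (7 / 3 : ℝ)) := by gcongr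
      _ = _ := by rw [mul_pow, mul_pow, e1]; ring
  have h5 := le_of_mul_le_mul_left h4 hn'
  exact le_of_pow_le_pow_left₀ (by norm_num) (by positivity) h5

/-- Fourier transform of the interval `{s, …, s + L - 1}` modulo `n`. -/
def intervalHat (n : ℕ) [NeZero n] (s : ℤ) (L : ℕ) (h : ZMod n) : ℂ :=
  ∑ i ∈ Finset.range L, ZMod.stdAddChar (-(h * ((i + s : ℤ) : ZMod n)))

/-- Majorant of the Fourier transform of an interval modulo `n`. -/
def hatBound (n : ℕ) [NeZero n] (h : ZMod n) : ℝ :=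
  if h = 0 then (n : ℝ) else (n : ℝ) / 2 * (1 / (h.val : ℝ) + 1 / ((n : ℝ) - h.val))

theorem hatBound_nonneg (n : ℕ) [NeZero n] (h : ZMod n) : 0 ≤ hatBound n h := by
  have : (h.val : ℝ) ≤ n := by exact_mod_cast (ZMod.val_lt h).le
  have : 0 ≤ (n : ℝ) - h.val := by linarith
  unfold hatBound
  split_ifs <;> positivity

theorem norm_stdAddChar_sub_one (n : ℕ) [NeZero n] (h : ZMod n) :
    ‖ZMod.stdAddChar h - 1‖ = 2 * Real.sin (Real.pi * (h.val / n)) := by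
  have hn : (0 : ℝ) < n := by exact_mod_cast NeZero.pos n
  have hv : (h.val : ℝ) ≤ n := by exact_mod_cast (ZMod.val_lt h).le
  have e : (ZMod.stdAddChar h : ℂ) = Complex.exp (Complex.I * ((2 * (Real.pi * (h.val / n)) : ℝ) : ℂ)) := by
    have : h = ((h.val : ℤ) : ZMod n) := by simp
    conv_lhs => rw [this]
    rw [ZMod.stdAddChar_coe]
    congr 1; push_cast; ring
  have hx : (h.val : ℝ) / n ≤ 1 := by rw [div_le_one hn]; exact hv
  have hpos : 0 ≤ Real.sin (Real.pi * (h.val / n)) := by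
    apply Real.sin_nonneg_of_nonneg_of_le_pi
    · positivity
    · nlinarith [Real.pi_pos]
  rw [e, Complex.norm_exp_I_mul_ofReal_sub_one, mul_div_cancel_left₀ _ (by norm_num : (2 : ℝ) ≠ 0),
    Real.norm_eq_abs, abs_of_nonneg (by positivity)]

theorem norm_intervalHat_le (n : ℕ) [NeZero n] (s : ℤ) {L : ℕ} (hL : L ≤ n) (h : ZMod n) :
    ‖intervalHat n s L h‖ ≤ hatBound n h := by
  have hn : (0 : ℝ) < n := by exact_mod_cast NeZero.pos n
  unfold intervalHat hatBound
  split_ifs with h0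
  · calc _ ≤ ∑ i ∈ Finset.range L, (1 : ℝ) := by
          refine norm_sum_le_of_le _ fun i _ => ?_
          simp
      _ ≤ n := by simpa using hL
  · have hv0 : (0 : ℝ) < h.val := by
      have : h.val ≠ 0 := by rwa [Ne, ZMod.val_eq_zero]
      exact_mod_cast Nat.pos_of_ne_zero this
    have hv1 : (h.val : ℝ) < n := by exact_mod_cast ZMod.val_lt h
    set z : ℂ := ZMod.stdAddChar (-h) with hz
    have hsum : ∑ i ∈ Finset.range L, (ZMod.stdAddChar (-(h * ((i + s : ℤ) : ZMod n))) : ℂ)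
        = ZMod.stdAddChar (-(h * (s : ZMod n))) * ∑ i ∈ Finset.range L, z ^ i := by
      rw [Finset.mul_sum]
      refine Finset.sum_congr rfl fun i _ => ?_
      rw [hz, ← AddChar.map_nsmul_eq_pow, ← AddChar.map_add_eq_mul]
      congr 1; push_cast; rw [nsmul_eq_mul]; ring
    have hz1 : ‖z - 1‖ = 2 * Real.sin (Real.pi * (h.val / n)) := by
      rw [← norm_stdAddChar_sub_one, hz, AddChar.map_neg_eq_conj,
        ← RCLike.norm_conj, map_sub, map_one, Complex.conj_conj]
    have hsin : 2 / ((n : ℝ) / 2 * (1 / (h.val : ℝ) + 1 / ((n : ℝ) - h.val))) ≤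
        2 * Real.sin (Real.pi * (h.val / n)) := by
      have e1 : 2 / ((n : ℝ) / 2 * (1 / (h.val : ℝ) + 1 / ((n : ℝ) - h.val)))
          = 4 * (h.val / n) * (1 - h.val / n) := by
        have : (n : ℝ) - h.val ≠ 0 := by linarith
        have h0' := hn.ne'
        have h1' := hv0.ne'
        field_simp
        ring_nf
        field_simp
      rw [e1]
      set x : ℝ := h.val / n with hx
      have hx0 : 0 < x := by positivity
      have hx1 : x < 1 := by rw [hx, div_lt_one hn]; exact hv1
      have pp := Real.pi_pos
      rcases le_total x (1 / 2) with hh | hh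
      · have := Real.mul_le_sin (x := Real.pi * x) (by positivity) (by nlinarith)
        have e2 : 2 / Real.pi * (Real.pi * x) = 2 * x := by field_simp
        nlinarith
      · have := Real.mul_le_sin (x := Real.pi * (1 - x)) (by nlinarith) (by nlinarith)
        have e2 : 2 / Real.pi * (Real.pi * (1 - x)) = 2 * (1 - x) := by field_simp
        have e3 : Real.sin (Real.pi * (1 - x)) = Real.sin (Real.pi * x) := by
          rw [mul_sub, mul_one, Real.sin_pi_sub]
        nlinarith
    have hw : 0 < (n : ℝ) / 2 * (1 / (h.val : ℝ) + 1 / ((n : ℝ) - h.val)) := by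
      have : 0 < (n : ℝ) - h.val := by linarith
      positivity
    have hz0 : 0 < ‖z - 1‖ := by rw [hz1]; exact lt_of_lt_of_le (by positivity) hsin
    rw [hsum, norm_mul, AddChar.norm_apply, one_mul]
    have hg : ‖∑ i ∈ Finset.range L, z ^ i‖ * ‖z - 1‖ ≤ 2 := by
      rw [← norm_mul, geom_sum_mul]
      calc _ ≤ ‖z ^ L‖ + ‖(1 : ℂ)‖ := norm_sub_le _ _
        _ ≤ 2 := by rw [norm_pow, hz, AddChar.norm_apply]; norm_num
    have h2 : 2 / ((n : ℝ) / 2 * (1 / (h.val : ℝ) + 1 / ((n : ℝ) - h.val))) ≤ ‖z - 1‖ := by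
      rw [hz1]; exact hsin
    rw [div_le_iff₀ hw] at h2
    set W := (n : ℝ) / 2 * (1 / (h.val : ℝ) + 1 / ((n : ℝ) - h.val))
    have : ‖∑ i ∈ Finset.range L, z ^ i‖ * ‖z - 1‖ ≤ W * ‖z - 1‖ := by linarith
    exact le_of_mul_le_mul_right this hz0

theorem sum_intervalHat (n : ℕ) [NeZero n] (s : ℤ) (L : ℕ) (x : ZMod n) :
    ∑ h : ZMod n, intervalHat n s L h * ZMod.stdAddChar (h * x)
      = n * ((Finset.range L).filter (fun i : ℕ => ((i + s : ℤ) : ZMod n) = x)).card := by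
  have key : ∀ a : ZMod n, ∑ h : ZMod n, ZMod.stdAddChar (h * a) = if a = 0 then (n : ℂ) else 0 := by
    intro a
    have := AddChar.sum_mulShift a (ZMod.isPrimitive_stdAddChar n)
    simpa [ZMod.card] using this
  unfold intervalHat
  simp_rw [Finset.sum_mul]
  rw [Finset.sum_comm, Finset.card_filter]
  push_cast
  rw [Finset.mul_sum]
  refine Finset.sum_congr rfl fun i _ => ?_
  rw [Finset.sum_congr rfl (g := fun h => ZMod.stdAddChar (h * (x - ((i + s : ℤ) : ZMod n))))
    (fun h _ => by rw [← AddChar.map_add_eq_mul]; congr 1; push_cast; ring), key]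
  simp only [sub_eq_zero, eq_comm (a := x)]
  push_cast
  split_ifs <;> simp

/-- Number of points on the modular hyperbola `xy = κ` in a box. -/
def hypCount (n : ℕ) (κ : ZMod n) (s r : ℤ) (L L' : ℕ) : ℕ :=
  ((Finset.range L ×ˢ Finset.range L').filter (fun p : ℕ × ℕ =>
    ((p.1 + s : ℤ) : ZMod n) * ((p.2 + r : ℤ) : ZMod n) = κ)).card

theorem hypCount_eq (n : ℕ) [NeZero n] (κ : (ZMod n)ˣ) (s r : ℤ) (L L' : ℕ) :
    (n : ℂ) ^ 2 * hypCount n κ s r L L' =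
      ∑ h : ZMod n, ∑ k : ZMod n, intervalHat n s L h * intervalHat n r L' k * kloos n h (k * κ) := by
  classical
  have h1 : hypCount n κ s r L L' = ∑ u : (ZMod n)ˣ,
      ((Finset.range L).filter (fun i : ℕ => ((i + s : ℤ) : ZMod n) = u)).card *
      ((Finset.range L').filter (fun i : ℕ => ((i + r : ℤ) : ZMod n) = κ * (u⁻¹ : (ZMod n)ˣ))).card := by
    unfold hypCount
    have hU : ∀ p ∈ ((Finset.range L ×ˢ Finset.range L').filter (fun p : ℕ × ℕ =>
        ((p.1 + s : ℤ) : ZMod n) * ((p.2 + r : ℤ) : ZMod n) = κ)), IsUnit ((p.1 + s : ℤ) : ZMod n) := by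
      intro p hp
      have := (Finset.mem_filter.1 hp).2
      exact isUnit_of_mul_isUnit_left (this ▸ κ.isUnit)
    rw [Finset.card_eq_sum_card_fiberwise (t := Finset.univ) (f := fun p : ℕ × ℕ =>
      if h : IsUnit ((p.1 + s : ℤ) : ZMod n) then h.unit else 1) (fun _ _ => Finset.mem_univ _)]
    refine Finset.sum_congr rfl fun u _ => ?_
    rw [← Finset.card_product]
    congr 1
    ext ⟨i, j⟩
    simp only [Finset.mem_filter, Finset.mem_product]
    constructor
    · rintro ⟨⟨hij, hk⟩, hu⟩
      have hunit := hU (i, j) (by simp only [Finset.mem_filter, Finset.mem_product]; exact ⟨hij, hk⟩)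
      rw [dif_pos hunit] at hu
      have hu' : ((i + s : ℤ) : ZMod n) = u := by rw [← hu]; rfl
      refine ⟨⟨hij.1, hu'⟩, hij.2, ?_⟩
      rw [← hk, hu', mul_comm (u : ZMod n), mul_assoc, Units.mul_inv, mul_one]
    · rintro ⟨⟨hi, hu'⟩, hj, hk⟩
      refine ⟨⟨⟨hi, hj⟩, ?_⟩, ?_⟩
      · rw [hu', hk, mul_left_comm, Units.mul_inv, mul_one]
      · have hunit : IsUnit ((i + s : ℤ) : ZMod n) := hu' ▸ u.isUnit
        rw [dif_pos hunit]
        exact Units.ext hu'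
  rw [h1]
  push_cast
  rw [Finset.mul_sum]
  calc _ = ∑ u : (ZMod n)ˣ, (∑ h : ZMod n, intervalHat n s L h * ZMod.stdAddChar (h * (u : ZMod n))) *
      (∑ k : ZMod n, intervalHat n r L' k * ZMod.stdAddChar (k * ((κ : ZMod n) * ((u⁻¹ : (ZMod n)ˣ) : ZMod n)))) := by
        refine Finset.sum_congr rfl fun u _ => ?_
        rw [sum_intervalHat, sum_intervalHat]
        push_cast
        ring
    _ = _ := by
        simp_rw [Finset.sum_mul_sum, kloos, Finset.mul_sum]
        rw [Finset.sum_comm]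
        refine Finset.sum_congr rfl fun h _ => ?_
        rw [Finset.sum_comm]
        refine Finset.sum_congr rfl fun k _ => Finset.sum_congr rfl fun u _ => ?_
        rw [AddChar.map_add_eq_mul, mul_assoc k]
        ring

theorem sum_hatBound_le (n : ℕ) [NeZero n] {e : ℕ} (he : e ∣ n) :
    ∑ h ∈ Finset.univ.filter (fun h : ZMod n => e ∣ h.val), hatBound n h
      ≤ n + n / e * (1 + Real.log n) := by
  classical
  have hn : 0 < n := NeZero.pos n
  have hn' : (0 : ℝ) < n := by exact_mod_cast hn
  obtain ⟨d, hd⟩ := he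
  have he0 : 0 < e := Nat.pos_of_mul_pos_right (hd ▸ hn)
  have hd0 : 0 < d := Nat.pos_of_mul_pos_left (hd ▸ hn)
  have he0' : (0 : ℝ) < e := by exact_mod_cast he0
  have hnd : (n : ℝ) = e * d := by exact_mod_cast hd
  have h0 : (0 : ZMod n) ∈ Finset.univ.filter (fun h : ZMod n => e ∣ h.val) := by simp
  rw [← Finset.add_sum_erase _ _ h0]
  have hz : hatBound n 0 = n := by simp [hatBound]
  rw [hz]
  gcongr
  have hharm : ∑ i ∈ Finset.Icc 1 (d - 1), (1 : ℝ) / i ≤ 1 + Real.log n := by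
    have h1 := harmonic_le_one_add_log (d - 1)
    rw [harmonic_eq_sum_Icc] at h1
    push_cast at h1
    simp only [one_div]
    refine h1.trans ?_
    have : Real.log ((d - 1 : ℕ) : ℝ) ≤ Real.log n := by
      rcases Nat.eq_zero_or_pos (d - 1) with h | h
      · rw [h]; simpa using Real.log_natCast_nonneg n
      · apply Real.log_le_log (by exact_mod_cast h)
        have : d ≤ n := Nat.le_of_dvd hn (hd ▸ dvd_mul_left _ _)
        exact_mod_cast (by omega : d - 1 ≤ n)
    linarith
  have hrefl : ∑ i ∈ Finset.Icc 1 (d - 1), (1 : ℝ) / ((d : ℝ) - i) = ∑ i ∈ Finset.Icc 1 (d - 1), (1 : ℝ) / i := by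
    refine Finset.sum_bij' (fun i _ => d - i) (fun i _ => d - i) ?_ ?_ ?_ ?_ ?_
    all_goals intro i hi
    all_goals rw [Finset.mem_Icc] at hi
    · rw [Finset.mem_Icc]; omega
    · rw [Finset.mem_Icc]; omega
    · omega
    · omega
    · rw [Nat.cast_sub (by omega)]
  calc ∑ h ∈ (Finset.univ.filter (fun h : ZMod n => e ∣ h.val)).erase 0, hatBound n h
      ≤ ∑ i ∈ Finset.Icc 1 (d - 1), (n : ℝ) / (2 * e) * (1 / i + 1 / ((d : ℝ) - i)) := by
        apply le_of_eq
        refine Finset.sum_bij (fun h _ => h.val / e) ?_ ?_ ?_ ?_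
        · intro h hh
          simp only [Finset.mem_erase, Finset.mem_filter, Finset.mem_univ, true_and] at hh
          obtain ⟨i, hi⟩ := hh.2
          have hlt := ZMod.val_lt h
          have : h.val ≠ 0 := by rw [Ne, ZMod.val_eq_zero]; exact hh.1
          rw [hi, Nat.mul_div_cancel_left _ he0, Finset.mem_Icc]
          have hlt' : e * i < e * d := by rw [← hi, ← hd]; exact hlt
          have := lt_of_mul_lt_mul_left hlt' (Nat.zero_le _)
          have : i ≠ 0 := by rintro rfl; simp at hi; exact hh.1 hi
          omega
        · intro h hh h' hh' heq
          simp only [Finset.mem_erase, Finset.mem_filter, Finset.mem_univ, true_and] at hh hh'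
          apply ZMod.val_injective
          rw [← Nat.mul_div_cancel' hh.2, ← Nat.mul_div_cancel' hh'.2, heq]
        · intro i hi
          rw [Finset.mem_Icc] at hi
          have hlt : e * i < n := by rw [hd]; exact Nat.mul_lt_mul_of_pos_left (by omega) he0
          have hval : ((e * i : ℕ) : ZMod n).val = e * i := by
            rw [ZMod.val_natCast, Nat.mod_eq_of_lt hlt]
          refine ⟨((e * i : ℕ) : ZMod n), ?_, ?_⟩
          · simp only [Finset.mem_erase, Finset.mem_filter, Finset.mem_univ, true_and]
            refine ⟨?_, by rw [hval]; exact dvd_mul_right _ _⟩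
            rw [Ne, ← ZMod.val_eq_zero, hval]
            have : 0 < e * i := Nat.mul_pos he0 (by omega)
            omega
          · rw [hval, Nat.mul_div_cancel_left _ he0]
        · intro h hh
          simp only [Finset.mem_erase, Finset.mem_filter, Finset.mem_univ, true_and] at hh
          obtain ⟨i, hi⟩ := hh.2
          have hlt := ZMod.val_lt h
          have hlt' : e * i < e * d := by rw [← hi, ← hd]; exact hlt
          have hid := lt_of_mul_lt_mul_left hlt' (Nat.zero_le _)
          have hi0 : i ≠ 0 := by rintro rfl; simp at hi; exact hh.1 hi
          rw [hatBound, if_neg hh.1, hi, Nat.mul_div_cancel_left _ he0, hnd]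
          push_cast
          have : (0 : ℝ) < i := by exact_mod_cast Nat.pos_of_ne_zero hi0
          have : (0 : ℝ) < d - i := by
            have : (i : ℝ) < d := by exact_mod_cast hid
            linarith
          have e1 : (e : ℝ) * d - e * i = e * (d - i) := by ring
          rw [e1]
          field_simp
    _ = n / e * ∑ i ∈ Finset.Icc 1 (d - 1), (1 : ℝ) / i := by
        rw [← Finset.mul_sum, Finset.sum_add_distrib, hrefl]
        field_simp; ring
    _ ≤ _ := by gcongr

theorem dvd_val_mul {n : ℕ} [NeZero n] {e : ℕ} (he : e ∣ n) {x : ZMod n} (hx : e ∣ x.val) (y : ZMod n) :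
    e ∣ (x * y).val := by
  rw [ZMod.val_mul, Nat.dvd_mod_iff he]
  exact hx.mul_right _

theorem gcd_le_sum_divisors {n : ℕ} [NeZero n] (h k : ZMod n) (κ : (ZMod n)ˣ) :
    (n.gcd (h.val.gcd (k * κ).val) : ℝ) ≤
      ∑ e ∈ n.divisors, if e ∣ h.val ∧ e ∣ k.val then (e : ℝ) else 0 := by
  set e := n.gcd (h.val.gcd (k * κ).val)
  have hen : e ∣ n := Nat.gcd_dvd_left _ _
  have h1 : e ∣ h.val := (Nat.gcd_dvd_right _ _).trans (Nat.gcd_dvd_left _ _)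
  have h2 : e ∣ (k * κ).val := (Nat.gcd_dvd_right _ _).trans (Nat.gcd_dvd_right _ _)
  have h3 : e ∣ k.val := by
    have := dvd_val_mul hen h2 (κ⁻¹ : (ZMod n)ˣ)
    rwa [mul_assoc, Units.mul_inv, mul_one] at this
  have := Finset.single_le_sum (f := fun e : ℕ => if e ∣ h.val ∧ e ∣ k.val then (e : ℝ) else 0)
    (s := n.divisors) (fun i _ => by split_ifs <;> positivity)
    (Nat.mem_divisors.2 ⟨hen, NeZero.ne n⟩)
  simpa [h1, h3] using this

theorem abs_hypCount_sub_le (n : ℕ) [NeZero n] (κ : (ZMod n)ˣ) (s r : ℤ) {L L' : ℕ}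
    (hL : L ≤ n) (hL' : L' ≤ n) :
    |(hypCount n κ s r L L' : ℝ) - n.totient * L * L' / n ^ 2| ≤
      3 * (n.divisors.card : ℝ) ^ 2 * (1 + Real.log n) ^ 2 * (n : ℝ) ^ (5 / 6 : ℝ) := by
  classical
  have hn : 0 < n := NeZero.pos n
  have hn' : (0 : ℝ) < n := by exact_mod_cast hn
  set Λ := 1 + Real.log n with hΛ
  have hΛ1 : 1 ≤ Λ := by have := Real.log_natCast_nonneg n; linarith
  set τ : ℝ := (n.divisors.card : ℝ)
  set f : ZMod n × ZMod n → ℂ := fun p => intervalHat n s L p.1 * intervalHat n r L' p.2 * kloos n p.1 (p.2 * κ)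
  have h1 : (n : ℂ) ^ 2 * hypCount n κ s r L L' = ∑ p : ZMod n × ZMod n, f p := by
    rw [hypCount_eq, ← Finset.univ_product_univ, Finset.sum_product]
  have h00 : f (0, 0) = n.totient * L * L' := by
    simp only [f, intervalHat, kloos]
    simp [ZMod.card_units_eq_totient]; ring
  rw [← Finset.add_sum_erase _ _ (Finset.mem_univ ((0, 0) : ZMod n × ZMod n)), h00] at h1
  have h2 : ‖∑ p ∈ Finset.univ.erase ((0, 0) : ZMod n × ZMod n), f p‖ ≤
      n ^ 2 * (3 * τ ^ 2 * Λ ^ 2 * (n : ℝ) ^ (5 / 6 : ℝ)) := by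
    set W := hatBound n
    have hW0 := hatBound_nonneg n
    have hWz : W 0 = n := by simp [W, hatBound]
    calc _ ≤ ∑ p ∈ Finset.univ.erase ((0, 0) : ZMod n × ZMod n), W p.1 * W p.2 *
          (τ * (∑ e ∈ n.divisors, if e ∣ p.1.val ∧ e ∣ p.2.val then (e : ℝ) else 0) * (n : ℝ) ^ (5 / 6 : ℝ)) := by
          refine norm_sum_le_of_le _ fun p _ => ?_
          simp only [f, norm_mul]
          have b1 := norm_intervalHat_le n s hL p.1
          have b2 := norm_intervalHat_le n r hL' p.2
          have b3 := norm_kloos_le p.1 (p.2 * κ)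
          have b4 := gcd_le_sum_divisors p.1 p.2 κ
          have := hW0 p.1
          have := hW0 p.2
          gcongr
          exact b3.trans (by gcongr)
      _ = τ * (n : ℝ) ^ (5 / 6 : ℝ) * ∑ e ∈ n.divisors, (e : ℝ) *
          ((∑ h ∈ Finset.univ.filter (fun h : ZMod n => e ∣ h.val), W h) ^ 2 - n ^ 2) := by
          have : ∀ e ∈ n.divisors, (e : ℝ) *
              ((∑ h ∈ Finset.univ.filter (fun h : ZMod n => e ∣ h.val), W h) ^ 2 - n ^ 2)
              = ∑ p ∈ Finset.univ.erase ((0, 0) : ZMod n × ZMod n), W p.1 * W p.2 *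
                (if e ∣ p.1.val ∧ e ∣ p.2.val then (e : ℝ) else 0) := by
            intro e _
            have e1 : ∑ p : ZMod n × ZMod n, W p.1 * W p.2 * (if e ∣ p.1.val ∧ e ∣ p.2.val then (e : ℝ) else 0)
                = (e : ℝ) * (∑ h ∈ Finset.univ.filter (fun h : ZMod n => e ∣ h.val), W h) ^ 2 := by
              rw [sq, Finset.sum_filter, Finset.sum_mul_sum, ← Finset.univ_product_univ, Finset.sum_product,
                Finset.mul_sum]
              refine Finset.sum_congr rfl fun x _ => ?_
              rw [Finset.mul_sum]
              refine Finset.sum_congr rfl fun y _ => ?_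
              by_cases hx : e ∣ x.val <;> by_cases hy : e ∣ y.val <;> simp [hx, hy]; ring
            rw [← Finset.add_sum_erase _ _ (Finset.mem_univ ((0, 0) : ZMod n × ZMod n))] at e1
            simp only [ZMod.val_zero, dvd_zero, and_self, if_true, hWz] at e1
            linarith
          rw [Finset.sum_congr rfl this, Finset.sum_comm, Finset.mul_sum]
          refine Finset.sum_congr rfl fun p _ => ?_
          rw [← Finset.mul_sum]; ring
      _ ≤ τ * (n : ℝ) ^ (5 / 6 : ℝ) * ∑ e ∈ n.divisors, 3 * (n : ℝ) ^ 2 * Λ ^ 2 := by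
          refine mul_le_mul_of_nonneg_left (Finset.sum_le_sum fun e he => ?_) (by positivity)
          have hen := Nat.dvd_of_mem_divisors he
          have he1 : (1 : ℝ) ≤ e := by exact_mod_cast Nat.pos_of_mem_divisors he
          have hb := sum_hatBound_le n hen
          have hb0 : 0 ≤ ∑ h ∈ Finset.univ.filter (fun h : ZMod n => e ∣ h.val), W h :=
            Finset.sum_nonneg fun h _ => hW0 h
          calc (e : ℝ) * ((∑ h ∈ Finset.univ.filter (fun h : ZMod n => e ∣ h.val), W h) ^ 2 - n ^ 2)
              ≤ (e : ℝ) * ((n + n / e * Λ) ^ 2 - n ^ 2) := by gcongr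
            _ = n ^ 2 * (2 * Λ + Λ ^ 2 / e) := by field_simp; ring
            _ ≤ n ^ 2 * (2 * Λ ^ 2 + Λ ^ 2 / 1) := by
                gcongr
                nlinarith
            _ = _ := by ring
      _ = _ := by rw [Finset.sum_const, nsmul_eq_mul]; ring
  have h3 : (((hypCount n κ s r L L' : ℝ) - n.totient * L * L' / n ^ 2 : ℝ) : ℂ) * n ^ 2 =
      ∑ p ∈ Finset.univ.erase ((0, 0) : ZMod n × ZMod n), f p := by
    have : (n : ℂ) ≠ 0 := by exact_mod_cast hn.ne'
    push_cast
    field_simp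
    linear_combination h1
  rw [← h3, norm_mul, Complex.norm_real, Real.norm_eq_abs, norm_pow, Complex.norm_natCast, mul_comm] at h2
  exact le_of_mul_le_mul_left h2 (by positivity)

theorem exists_hypCount_bound :
    ∃ C : ℝ, 1 ≤ C ∧ ∀ (n : ℕ) [NeZero n] (κ : (ZMod n)ˣ) (s r : ℤ) (L L' : ℕ), L ≤ n → L' ≤ n →
      |(hypCount n κ s r L L' : ℝ) - n.totient * L * L' / n ^ 2| ≤ C * (n : ℝ) ^ (11 / 12 : ℝ) := by
  obtain ⟨C, hC1, hC⟩ := card_divisors_le_rpow (ε := 1 / 48) (by norm_num)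
  refine ⟨3 * C ^ 2 * 49 ^ 2, by nlinarith, fun n _ κ s r L L' hL hL' => ?_⟩
  refine (abs_hypCount_sub_le n κ s r hL hL').trans ?_
  have hn1 : (1 : ℝ) ≤ n := by exact_mod_cast NeZero.pos n
  have hlog : 1 + Real.log n ≤ 49 * (n : ℝ) ^ (1 / 48 : ℝ) := by
    have h1 := Real.log_le_rpow_div (x := n) (by positivity) (ε := 1 / 48) (by norm_num)
    have h2 := Real.one_le_rpow hn1 (z := 1 / 48) (by norm_num)
    have : (n : ℝ) ^ (1 / 48 : ℝ) / (1 / 48) = 48 * (n : ℝ) ^ (1 / 48 : ℝ) := by ring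
    linarith
  have hlog0 : 0 ≤ 1 + Real.log n := by have := Real.log_natCast_nonneg n; linarith
  have e : (n : ℝ) ^ (11 / 12 : ℝ) = ((n : ℝ) ^ (1 / 48 : ℝ)) ^ 2 * ((n : ℝ) ^ (1 / 48 : ℝ)) ^ 2 * (n : ℝ) ^ (5 / 6 : ℝ) := by
    rw [← Real.rpow_natCast, ← Real.rpow_mul (by positivity), ← Real.rpow_add (by positivity),
      ← Real.rpow_add (by positivity)]
    norm_num
  calc _ ≤ 3 * (C * (n : ℝ) ^ (1 / 48 : ℝ)) ^ 2 * (49 * (n : ℝ) ^ (1 / 48 : ℝ)) ^ 2 * (n : ℝ) ^ (5 / 6 : ℝ) := by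
        gcongr
        exact hC n (NeZero.ne n)
    _ = _ := by rw [e]; ring

/-- Number of `(x, y)` in a square box with `xy ≡ 1 (mod n)` and prescribed residues mod `w`. -/
def boxCount (n w : ℕ) (V : Finset (ZMod w × ZMod w)) (x₀ y₀ : ℤ) (L : ℕ) : ℕ :=
  ((Finset.Ico x₀ (x₀ + L) ×ˢ Finset.Ico y₀ (y₀ + L)).filter (fun p : ℤ × ℤ =>
    ((p.1 : ZMod w), (p.2 : ZMod w)) ∈ V ∧ (n : ℤ) ∣ p.1 * p.2 - 1)).card

/-- Number of elements of a residue class mod `w` among `L` consecutive integers, the first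
element being at distance `v` from the left end. -/
def progLen (w v L : ℕ) : ℕ := (L - v + (w - 1)) / w

theorem lt_progLen_iff {w v L : ℕ} (hw : 0 < w) (i : ℕ) : i < progLen w v L ↔ v + w * i < L := by
  unfold progLen
  rw [Nat.lt_div_iff_mul_lt hw, mul_comm]
  omega

theorem progLen_le {w v L n : ℕ} (hw : 0 < w) (h : L ≤ w * n) : progLen w v L ≤ n := by
  by_contra hc
  push Not at hc
  have := (lt_progLen_iff hw n).1 hc
  omega

theorem abs_progLen_sub_le {w v L : ℕ} (hw : 0 < w) (hv : v < w) :
    |(progLen w v L : ℝ) - L / w| ≤ 1 := by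
  have hw' : (0 : ℝ) < w := by exact_mod_cast hw
  have h1 : w * progLen w v L < L + w := by
    rcases Nat.eq_zero_or_pos (progLen w v L) with h | h
    · rw [h]; omega
    · have := (lt_progLen_iff (v := v) (L := L) hw (progLen w v L - 1)).1 (by omega)
      have e : w * progLen w v L = w * (progLen w v L - 1) + w := by
        conv_lhs => rw [show progLen w v L = progLen w v L - 1 + 1 by omega]
        ring
      omega
  have h2 : L ≤ v + w * progLen w v L := by
    by_contra h
    exact lt_irrefl _ ((lt_progLen_iff hw _).2 (not_le.1 h))
  have h1' : (w : ℝ) * progLen w v L < L + w := by exact_mod_cast h1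
  have h2' : (L : ℝ) ≤ w + w * progLen w v L := by
    have : (L : ℝ) ≤ v + w * progLen w v L := by exact_mod_cast h2
    have : (v : ℝ) ≤ w := by exact_mod_cast hv.le
    linarith
  have e : (L : ℝ) = w * (L / w) := by field_simp
  rw [abs_le]
  constructor
  · have : (w : ℝ) * (L / w) ≤ w * (1 + progLen w v L) := by rw [← e]; linarith
    have := le_of_mul_le_mul_left this hw'
    linarith
  · have : (w : ℝ) * progLen w v L ≤ w * (L / w + 1) := by rw [mul_add, ← e]; linarith
    have := le_of_mul_le_mul_left this hw'
    linarith

theorem exists_single_class_bound :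
    ∃ C : ℝ, 1 ≤ C ∧ ∀ (n w : ℕ) [NeZero n] [NeZero w] (α β : ZMod w) (x₀ y₀ : ℤ) (L : ℕ),
      n.Coprime w → L ≤ w * n →
      |(((Finset.Ico x₀ (x₀ + L) ×ˢ Finset.Ico y₀ (y₀ + L)).filter (fun p : ℤ × ℤ =>
        (((p.1 : ZMod w), (p.2 : ZMod w)) = (α, β)) ∧ (n : ℤ) ∣ p.1 * p.2 - 1)).card : ℝ)
        - n.totient * L ^ 2 / (n ^ 2 * w ^ 2)| ≤ C * (n : ℝ) ^ (11 / 12 : ℝ) := by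
  obtain ⟨C, hC1, hC⟩ := exists_hypCount_bound
  refine ⟨C + 2, by linarith, fun n w _ _ α β x₀ y₀ L hnw hL => ?_⟩
  have hw : 0 < w := NeZero.pos w
  have hn : 0 < n := NeZero.pos n
  have hw' : (0 : ℝ) < w := by exact_mod_cast hw
  have hn' : (0 : ℝ) < n := by exact_mod_cast hn
  set v := (α - x₀ : ZMod w).val with hv
  set v' := (β - y₀ : ZMod w).val with hv'
  have hvw : v < w := ZMod.val_lt _
  have hvw' : v' < w := ZMod.val_lt _
  set ℓ := progLen w v L
  set ℓ' := progLen w v' L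
  set ω : (ZMod n)ˣ := (ZMod.unitOfCoprime w hnw.symm)⁻¹ with hω
  have hωw : (w : ZMod n) * ω = 1 := by
    have : (w : ZMod n) = (ZMod.unitOfCoprime w hnw.symm : (ZMod n)ˣ) := by simp
    rw [this, hω, Units.mul_inv]
  set s : ℤ := (((ω : ZMod n) * ((x₀ + v : ℤ) : ZMod n)).val : ℤ) with hs
  set r : ℤ := (((ω : ZMod n) * ((y₀ + v' : ℤ) : ZMod n)).val : ℤ) with hr
  have hs' : (s : ZMod n) = ω * ((x₀ + v : ℤ) : ZMod n) := by rw [hs]; simp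
  have hr' : (r : ZMod n) = ω * ((y₀ + v' : ℤ) : ZMod n) := by rw [hr]; simp
  have hcount : (((Finset.Ico x₀ (x₀ + L) ×ˢ Finset.Ico y₀ (y₀ + L)).filter (fun p : ℤ × ℤ =>
        (((p.1 : ZMod w), (p.2 : ZMod w)) = (α, β)) ∧ (n : ℤ) ∣ p.1 * p.2 - 1)).card)
      = hypCount n ((ω * ω : (ZMod n)ˣ) : ZMod n) s r ℓ ℓ' := by
    have hcond : ∀ i j : ℕ, ((n : ℤ) ∣ (x₀ + v + w * i) * (y₀ + v' + w * j) - 1) ↔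
        ((i + s : ℤ) : ZMod n) * ((j + r : ℤ) : ZMod n) = ((ω * ω : (ZMod n)ˣ) : ZMod n) := by
      intro i j
      have e1 : ((x₀ + v + w * i : ℤ) : ZMod n) = w * ((i + s : ℤ) : ZMod n) := by
        push_cast at hs' ⊢
        rw [hs']
        linear_combination -((x₀ : ZMod n) + v) * hωw
      have e2 : ((y₀ + v' + w * j : ℤ) : ZMod n) = w * ((j + r : ℤ) : ZMod n) := by
        push_cast at hr' ⊢
        rw [hr']
        linear_combination -((y₀ : ZMod n) + v') * hωw
      rw [← ZMod.intCast_zmod_eq_zero_iff_dvd, Int.cast_sub, Int.cast_mul, e1, e2, Int.cast_one, sub_eq_zero,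
        Units.val_mul]
      set X := ((i + s : ℤ) : ZMod n)
      set Y := ((j + r : ℤ) : ZMod n)
      constructor
      · intro h
        linear_combination ((ω : ZMod n) * ω) * h - X * Y * (1 + w * ω) * hωw
      · intro h
        rw [show (w : ZMod n) * X * (w * Y) = w ^ 2 * (X * Y) by ring, h]
        linear_combination (1 + w * ω : ZMod n) * hωw
    symm
    refine Finset.card_bij (fun p _ => (x₀ + v + w * p.1, y₀ + v' + w * p.2)) ?_ ?_ ?_
    · rintro ⟨i, j⟩ hij
      simp only [Finset.mem_filter, Finset.mem_product, Finset.mem_range, Finset.mem_Ico] at hij ⊢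
      obtain ⟨⟨hi, hj⟩, hc⟩ := hij
      have hi' := (lt_progLen_iff hw _).1 hi
      have hj' := (lt_progLen_iff hw _).1 hj
      have hi'' : (v : ℤ) + w * i < L := by exact_mod_cast hi'
      have hj'' : (v' : ℤ) + w * j < L := by exact_mod_cast hj'
      have hi0 : (0 : ℤ) ≤ v + w * i := by positivity
      have hj0 : (0 : ℤ) ≤ v' + w * j := by positivity
      refine ⟨⟨⟨by linarith, by linarith⟩, ⟨by linarith, by linarith⟩⟩, ?_, (hcond i j).2 hc⟩
      have e1 : ((v : ℕ) : ZMod w) = α - x₀ := by rw [hv]; simp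
      have e2 : ((v' : ℕ) : ZMod w) = β - y₀ := by rw [hv']; simp
      simp [e1, e2]
    · rintro ⟨i, j⟩ _ ⟨i', j'⟩ _ h
      simp only [Prod.mk.injEq, add_right_inj] at h ⊢
      have hw0 : (w : ℤ) ≠ 0 := by exact_mod_cast hw.ne'
      constructor
      · exact_mod_cast mul_left_cancel₀ hw0 h.1
      · exact_mod_cast mul_left_cancel₀ hw0 h.2
    · rintro ⟨x, y⟩ hxy
      simp only [Finset.mem_filter, Finset.mem_product, Finset.mem_Ico, Prod.mk.injEq] at hxy
      obtain ⟨⟨⟨hx1, hx2⟩, hy1, hy2⟩, ⟨ha, hb⟩, hdvd⟩ := hxy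
      have main : ∀ (x x₀ : ℤ) (α : ZMod w), x₀ ≤ x → x < x₀ + L → (x : ZMod w) = α →
          ∃ i : ℕ, x = x₀ + ((α - x₀ : ZMod w).val : ℤ) + w * i ∧ i < progLen w (α - x₀ : ZMod w).val L := by
        intro x x₀ α h1 h2 h3
        obtain ⟨k, hk⟩ : ∃ k : ℕ, x = x₀ + k := ⟨(x - x₀).toNat, by omega⟩
        have e : (α - x₀ : ZMod w) = (k : ZMod w) := by rw [← h3, hk]; simp
        rw [e, ZMod.val_natCast]
        refine ⟨k / w, ?_, ?_⟩
        · have := Nat.mod_add_div k w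
          rw [hk, add_assoc]; congr 1; exact_mod_cast this.symm
        · rw [lt_progLen_iff hw, Nat.mod_add_div]
          omega
      obtain ⟨i, hi, hi'⟩ := main x x₀ α hx1 hx2 ha
      obtain ⟨j, hj, hj'⟩ := main y y₀ β hy1 hy2 hb
      refine ⟨(i, j), ?_, by simp [hi, hj, hv, hv']⟩
      simp only [Finset.mem_filter, Finset.mem_product, Finset.mem_range]
      refine ⟨⟨hi', hj'⟩, (hcond i j).1 ?_⟩
      rw [hi, hj] at hdvd
      exact hdvd
  rw [hcount]
  have hℓn : ℓ ≤ n := progLen_le hw hL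
  have hℓn' : ℓ' ≤ n := progLen_le hw hL
  have h1 := hC n (ω * ω) s r ℓ ℓ' hℓn hℓn'
  have hone : (1 : ℝ) ≤ (n : ℝ) ^ (11 / 12 : ℝ) := Real.one_le_rpow (by exact_mod_cast hn) (by norm_num)
  have h2 : |(n.totient : ℝ) * ℓ * ℓ' / n ^ 2 - n.totient * L ^ 2 / (n ^ 2 * w ^ 2)| ≤ 2 := by
    have a1 := abs_progLen_sub_le (L := L) hw hvw
    have a2 := abs_progLen_sub_le (L := L) hw hvw'
    have e : (n.totient : ℝ) * ℓ * ℓ' / n ^ 2 - n.totient * L ^ 2 / (n ^ 2 * w ^ 2) =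
        (n.totient : ℝ) / n * (((ℓ : ℝ) - L / w) * (ℓ' / n) + (L / w) / n * (ℓ' - L / w)) := by
      field_simp; ring
    have b0 : (n.totient : ℝ) / n ≤ 1 := by
      rw [div_le_one hn']; exact_mod_cast Nat.totient_le n
    have b1 : (ℓ' : ℝ) / n ≤ 1 := by rw [div_le_one hn']; exact_mod_cast hℓn'
    have b2 : (L : ℝ) / w / n ≤ 1 := by
      rw [div_div, div_le_one (by positivity)]; exact_mod_cast hL
    rw [e, abs_mul, abs_of_nonneg (by positivity : (0 : ℝ) ≤ n.totient / n)]
    have c1 : |((ℓ : ℝ) - L / w) * (ℓ' / n) + (L / w) / n * (ℓ' - L / w)| ≤ 1 * 1 + 1 * 1 := by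
      refine (abs_add_le _ _).trans ?_
      rw [abs_mul, abs_mul, abs_of_nonneg (by positivity : (0 : ℝ) ≤ (ℓ' : ℝ) / n),
        abs_of_nonneg (by positivity : (0 : ℝ) ≤ (L : ℝ) / w / n)]
      gcongr
    calc _ ≤ 1 * (1 * 1 + 1 * 1 : ℝ) := by gcongr
      _ = 2 := by norm_num
  calc _ ≤ _ := abs_sub_le _ ((n.totient : ℝ) * ℓ * ℓ' / n ^ 2) _
    _ ≤ C * (n : ℝ) ^ (11 / 12 : ℝ) + 2 := add_le_add h1 h2
    _ ≤ _ := by nlinarith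

theorem exists_boxCount_bound :
    ∃ C : ℝ, 1 ≤ C ∧ ∀ (n w : ℕ) [NeZero n] [NeZero w] (V : Finset (ZMod w × ZMod w)) (x₀ y₀ : ℤ) (L : ℕ),
      n.Coprime w → L ≤ w * n →
      |(boxCount n w V x₀ y₀ L : ℝ) - V.card * (n.totient * L ^ 2 / (n ^ 2 * w ^ 2))|
        ≤ C * V.card * (n : ℝ) ^ (11 / 12 : ℝ) := by
  obtain ⟨C, hC1, hC⟩ := exists_single_class_bound
  refine ⟨C, hC1, fun n w _ _ V x₀ y₀ L hnw hL => ?_⟩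
  have h1 : boxCount n w V x₀ y₀ L = ∑ v ∈ V, ((Finset.Ico x₀ (x₀ + L) ×ˢ Finset.Ico y₀ (y₀ + L)).filter
      (fun p : ℤ × ℤ => (((p.1 : ZMod w), (p.2 : ZMod w)) = (v.1, v.2)) ∧ (n : ℤ) ∣ p.1 * p.2 - 1)).card := by
    unfold boxCount
    rw [Finset.card_eq_sum_card_fiberwise (t := V) (f := fun p : ℤ × ℤ => ((p.1 : ZMod w), (p.2 : ZMod w)))
      (fun p hp => (Finset.mem_filter.1 hp).2.1)]
    refine Finset.sum_congr rfl fun v hv => ?_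
    rw [Finset.filter_filter]
    congr 1
    refine Finset.filter_congr fun p _ => ?_
    constructor
    · rintro ⟨⟨_, h2⟩, h3⟩; exact ⟨h3, h2⟩
    · rintro ⟨h3, h2⟩; exact ⟨⟨by rw [h3]; exact hv, h2⟩, h3⟩
  rw [h1]
  push_cast
  rw [← nsmul_eq_mul, ← Finset.sum_const, ← Finset.sum_sub_distrib]
  refine (Finset.abs_sum_le_sum_abs _ _).trans ?_
  calc _ ≤ ∑ v ∈ V, C * (n : ℝ) ^ (11 / 12 : ℝ) :=
        Finset.sum_le_sum fun v _ => hC n w v.1 v.2 x₀ y₀ L hnw hL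
    _ = _ := by rw [Finset.sum_const, nsmul_eq_mul]; ring

theorem SL2Z.det_eq (γ : SL2Z) : γ 0 0 * γ 1 1 - γ 0 1 * γ 1 0 = 1 := by
  have := γ.2
  rwa [Matrix.det_fin_two] at this

theorem SL2Z.ext' {γ δ : SL2Z} (h00 : γ 0 0 = δ 0 0) (h01 : γ 0 1 = δ 0 1) (h10 : γ 1 0 = δ 1 0)
    (h11 : γ 1 1 = δ 1 1) : γ = δ := by
  ext i j
  fin_cases i <;> fin_cases j <;> assumption

/-- The matrix `(a b; c d)` of determinant one. -/
def SL2Z.mk (a b c d : ℤ) (h : a * d - b * c = 1) : SL2Z :=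
  ⟨!![a, b; c, d], by rw [Matrix.det_fin_two_of]; exact h⟩

@[simp] theorem SL2Z.mk_00 (a b c d : ℤ) (h : a * d - b * c = 1) : SL2Z.mk a b c d h 0 0 = a := rfl
@[simp] theorem SL2Z.mk_01 (a b c d : ℤ) (h : a * d - b * c = 1) : SL2Z.mk a b c d h 0 1 = b := rfl
@[simp] theorem SL2Z.mk_10 (a b c d : ℤ) (h : a * d - b * c = 1) : SL2Z.mk a b c d h 1 0 = c := rfl
@[simp] theorem SL2Z.mk_11 (a b c d : ℤ) (h : a * d - b * c = 1) : SL2Z.mk a b c d h 1 1 = d := rfl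

theorem SL2Z.mul_00 (γ δ : SL2Z) : (γ * δ) 0 0 = γ 0 0 * δ 0 0 + γ 0 1 * δ 1 0 := by
  simp [Matrix.SpecialLinearGroup.coe_mul, Matrix.mul_apply, Fin.sum_univ_two]
theorem SL2Z.mul_01 (γ δ : SL2Z) : (γ * δ) 0 1 = γ 0 0 * δ 0 1 + γ 0 1 * δ 1 1 := by
  simp [Matrix.SpecialLinearGroup.coe_mul, Matrix.mul_apply, Fin.sum_univ_two]
theorem SL2Z.mul_10 (γ δ : SL2Z) : (γ * δ) 1 0 = γ 1 0 * δ 0 0 + γ 1 1 * δ 1 0 := by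
  simp [Matrix.SpecialLinearGroup.coe_mul, Matrix.mul_apply, Fin.sum_univ_two]
theorem SL2Z.mul_11 (γ δ : SL2Z) : (γ * δ) 1 1 = γ 1 0 * δ 0 1 + γ 1 1 * δ 1 1 := by
  simp [Matrix.SpecialLinearGroup.coe_mul, Matrix.mul_apply, Fin.sum_univ_two]

/-- Squared Frobenius norm. -/
def normSq (γ : SL2Z) : ℤ := γ 0 0 ^ 2 + γ 0 1 ^ 2 + γ 1 0 ^ 2 + γ 1 1 ^ 2

theorem frobNorm_le_iff {γ : SL2Z} {T : ℝ} (hT : 0 ≤ T) : frobNorm γ ≤ T ↔ (normSq γ : ℝ) ≤ T ^ 2 := by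
  unfold frobNorm normSq
  rw [Real.sqrt_le_left hT]

theorem abs_entry_le {γ : SL2Z} {T : ℝ} (h : frobNorm γ ≤ T) (i j : Fin 2) : |(γ i j : ℝ)| ≤ T := by
  refine le_trans ?_ h
  unfold frobNorm
  apply Real.abs_le_sqrt
  push_cast
  fin_cases i <;> fin_cases j <;> simp only [Fin.zero_eta, Fin.mk_one, Fin.isValue] <;> nlinarith [sq_nonneg (γ 0 0 : ℝ), sq_nonneg (γ 0 1 : ℝ),
    sq_nonneg (γ 1 0 : ℝ), sq_nonneg (γ 1 1 : ℝ)]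

/-- Integers of absolute value at most `T`. -/
def intBall (T : ℝ) : Finset ℤ := Finset.Icc (-⌊T⌋) ⌊T⌋

theorem mem_intBall {T : ℝ} {x : ℤ} : x ∈ intBall T ↔ |(x : ℝ)| ≤ T := by
  unfold intBall
  rw [Finset.mem_Icc, abs_le, Int.le_floor, neg_le, Int.le_floor]
  push_cast
  constructor
  · rintro ⟨h1, h2⟩; exact ⟨by linarith, h2⟩
  · rintro ⟨h1, h2⟩; exact ⟨by linarith, h2⟩

theorem card_intBall_le {T : ℝ} (hT : 0 ≤ T) : ((intBall T).card : ℝ) ≤ 2 * T + 1 := by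
  unfold intBall
  have h0 : 0 ≤ ⌊T⌋ := Int.floor_nonneg.2 hT
  rw [Int.card_Icc]
  have : (((⌊T⌋ + 1 - -⌊T⌋).toNat : ℤ) : ℝ) = 2 * ⌊T⌋ + 1 := by
    rw [Int.toNat_of_nonneg (by omega)]; push_cast; ring
  have h2 := Int.floor_le T
  have h3 : (((⌊T⌋ + 1 - -⌊T⌋).toNat : ℕ) : ℝ) = 2 * ⌊T⌋ + 1 := by exact_mod_cast this
  rw [h3]; linarith

theorem finite_ball (T : ℝ) : {γ : SL2Z | frobNorm γ ≤ T}.Finite := by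
  refine Set.Finite.of_injOn (f := fun γ : SL2Z => (γ 0 0, γ 0 1, γ 1 0, γ 1 1))
    (t := ((intBall T ×ˢ intBall T ×ˢ intBall T ×ˢ intBall T : Finset (ℤ × ℤ × ℤ × ℤ)) : Set _)) ?_ ?_
    (Finset.finite_toSet _)
  · intro γ hγ
    simp only [Finset.coe_product, Set.mem_prod, Finset.mem_coe, mem_intBall]
    exact ⟨abs_entry_le hγ _ _, abs_entry_le hγ _ _, abs_entry_le hγ _ _, abs_entry_le hγ _ _⟩
  · intro γ _ δ _ h
    simp only [Prod.mk.injEq] at h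
    exact SL2Z.ext' h.1 h.2.1 h.2.2.1 h.2.2.2

/-- The elements of `SL(2,ℤ)` of Frobenius norm at most `T`. -/
def ball (T : ℝ) : Finset SL2Z := (finite_ball T).toFinset

@[simp] theorem mem_ball {T : ℝ} {γ : SL2Z} : γ ∈ ball T ↔ frobNorm γ ≤ T := by simp [ball]

open Classical in
/-- Number of elements of the ball of radius `T` satisfying `P`. -/
def cnt (T : ℝ) (P : SL2Z → Prop) : ℕ := ((ball T).filter P).card

theorem cnt_eq_card (T : ℝ) (P : SL2Z → Prop) [DecidablePred P] : cnt T P = ((ball T).filter P).card := by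
  unfold cnt; congr

theorem natCard_eq_cnt (T : ℝ) (P : SL2Z → Prop) :
    Nat.card {γ : SL2Z // frobNorm γ ≤ T ∧ P γ} = cnt T P := by
  classical
  unfold cnt
  have : ∀ γ, γ ∈ (ball T).filter P ↔ frobNorm γ ≤ T ∧ P γ := by intro γ; simp
  exact Nat.subtype_card _ this

theorem cnt_mono {T : ℝ} {P Q : SL2Z → Prop} (h : ∀ γ, frobNorm γ ≤ T → P γ → Q γ) : cnt T P ≤ cnt T Q := by
  classical
  refine Finset.card_le_card fun γ hγ => ?_
  simp only [Finset.mem_filter, mem_ball] at hγ ⊢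
  exact ⟨hγ.1, h γ hγ.1 hγ.2⟩

theorem cnt_congr {T : ℝ} {P Q : SL2Z → Prop} (h : ∀ γ, frobNorm γ ≤ T → (P γ ↔ Q γ)) : cnt T P = cnt T Q :=
  le_antisymm (cnt_mono fun γ hγ => (h γ hγ).1) (cnt_mono fun γ hγ => (h γ hγ).2)

theorem cnt_or_le (T : ℝ) (P Q : SL2Z → Prop) : cnt T (fun γ => P γ ∨ Q γ) ≤ cnt T P + cnt T Q := by
  classical
  simp only [cnt_eq_card]
  rw [Finset.filter_or]
  exact Finset.card_union_le _ _

theorem cnt_and_add_cnt_and_not (T : ℝ) (P Q : SL2Z → Prop) :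
    cnt T (fun γ => P γ ∧ Q γ) + cnt T (fun γ => P γ ∧ ¬ Q γ) = cnt T P := by
  classical
  simp only [cnt_eq_card]
  rw [← Finset.filter_filter, ← Finset.filter_filter, Finset.card_filter_add_card_filter_not]

/-- Fibering a count over a finite set of values. -/
theorem cnt_eq_sum {T : ℝ} {P : SL2Z → Prop} {β : Type*} [DecidableEq β] (f : SL2Z → β) (s : Finset β)
    (h : ∀ γ, frobNorm γ ≤ T → P γ → f γ ∈ s) :
    cnt T P = ∑ b ∈ s, cnt T (fun γ => P γ ∧ f γ = b) := by
  classical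
  simp only [cnt_eq_card]
  rw [Finset.card_eq_sum_card_fiberwise (f := f) (t := s)]
  · refine Finset.sum_congr rfl fun b _ => ?_
    rw [Finset.filter_filter]
  · intro γ hγ
    simp only [Finset.coe_filter, mem_ball, Set.mem_ofPred_eq] at hγ
    exact h γ hγ.1 hγ.2

theorem cnt_exists_le {T : ℝ} {β : Type*} (s : Finset β) (P : β → SL2Z → Prop) :
    cnt T (fun γ => ∃ b ∈ s, P b γ) ≤ ∑ b ∈ s, cnt T (P b) := by
  classical
  refine le_trans ?_ (Finset.card_biUnion_le (s := s) (t := fun b => (ball T).filter (P b)))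
  refine Finset.card_le_card fun γ hγ => ?_
  simp only [Finset.mem_filter, mem_ball, Finset.mem_biUnion] at hγ ⊢
  obtain ⟨h1, b, hb, h2⟩ := hγ
  exact ⟨b, hb, h1, h2⟩

theorem cnt_le_card {T : ℝ} {P : SL2Z → Prop} {β : Type*} (s : Finset β) (f : SL2Z → β)
    (hf : ∀ γ, frobNorm γ ≤ T → P γ → f γ ∈ s)
    (hinj : ∀ γ δ, frobNorm γ ≤ T → P γ → frobNorm δ ≤ T → P δ → f γ = f δ → γ = δ) : cnt T P ≤ s.card := by
  classical
  refine Finset.card_le_card_of_injOn f ?_ ?_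
  · intro γ hγ
    simp only [Finset.coe_filter, mem_ball, Set.mem_ofPred_eq] at hγ
    exact hf γ hγ.1 hγ.2
  · intro γ hγ δ hδ h
    simp only [Finset.coe_filter, mem_ball, Set.mem_ofPred_eq] at hγ hδ
    exact hinj γ δ hγ.1 hγ.2 hδ.1 hδ.2 h

theorem card_le_of_modEq {T : ℝ} {c : ℤ} (hc : c ≠ 0) (hT : 0 ≤ T) (S : Finset ℤ)
    (hS : ∀ x ∈ S, |(x : ℝ)| ≤ T) (hmod : ∀ x ∈ S, ∀ y ∈ S, c ∣ x - y) :
    (S.card : ℝ) ≤ 2 * T / |(c : ℝ)| + 1 := by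
  have hc' : 0 < |(c : ℝ)| := abs_pos.2 (by exact_mod_cast hc)
  rcases S.eq_empty_or_nonempty with rfl | hne
  · simp; positivity
  set m := S.min' hne with hm
  have hmS : m ∈ S := S.min'_mem hne
  have h1 : S.card ≤ (Finset.Icc (0 : ℤ) ⌊2 * T / |(c : ℝ)|⌋).card := by
    refine Finset.card_le_card_of_injOn (fun x => (x - m) / |c|) ?_ ?_
    · intro x hx
      simp only [Finset.coe_Icc, Set.mem_Icc]
      have hxm : m ≤ x := S.min'_le x hx
      refine ⟨Int.ediv_nonneg (by omega) (abs_nonneg _), ?_⟩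
      rw [Int.le_floor, le_div_iff₀ hc']
      have h2 : (x - m) / |c| * |c| = x - m := Int.ediv_mul_cancel ((abs_dvd _ _).2 (hmod x hx m hmS))
      have h3 : (((x - m) / |c| : ℤ) : ℝ) * |(c : ℝ)| = x - m := by exact_mod_cast h2
      rw [h3]
      have := abs_le.1 (hS x hx)
      have := abs_le.1 (hS m hmS)
      linarith
    · intro x hx y hy h
      have h2 : (x - m) / |c| * |c| = x - m := Int.ediv_mul_cancel ((abs_dvd _ _).2 (hmod x hx m hmS))
      have h3 : (y - m) / |c| * |c| = y - m := Int.ediv_mul_cancel ((abs_dvd _ _).2 (hmod y hy m hmS))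
      simp only at h
      rw [h] at h2
      omega
  have h0 : 0 ≤ ⌊2 * T / |(c : ℝ)|⌋ := Int.floor_nonneg.2 (by positivity)
  rw [Int.card_Icc] at h1
  have h2 : (S.card : ℤ) ≤ ⌊2 * T / |(c : ℝ)|⌋ + 1 := by omega
  have h3 : (S.card : ℝ) ≤ ⌊2 * T / |(c : ℝ)|⌋ + 1 := by exact_mod_cast h2
  have := Int.floor_le (2 * T / |(c : ℝ)|)
  linarith

theorem cnt_row_le {T : ℝ} {c d : ℤ} (hc : c ≠ 0) (hcT : |(c : ℝ)| ≤ T) :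
    (cnt T (fun γ => γ 1 0 = c ∧ γ 1 1 = d) : ℝ) ≤ 3 * T / |(c : ℝ)| := by
  classical
  have hc' : 0 < |(c : ℝ)| := abs_pos.2 (by exact_mod_cast hc)
  set B := (ball T).filter (fun γ : SL2Z => γ 1 0 = c ∧ γ 1 1 = d)
  have hB : ∀ γ ∈ B, frobNorm γ ≤ T ∧ γ 1 0 = c ∧ γ 1 1 = d := by
    intro γ hγ; simpa [B] using hγ
  have hcard : cnt T (fun γ => γ 1 0 = c ∧ γ 1 1 = d) = (B.image (fun γ : SL2Z => γ 0 0)).card := by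
    rw [Finset.card_image_of_injOn, cnt_eq_card]
    intro γ hγ δ hδ h
    obtain ⟨-, h1, h2⟩ := hB γ hγ
    obtain ⟨-, h3, h4⟩ := hB δ hδ
    have e1 := γ.det_eq
    have e2 := δ.det_eq
    rw [h1, h2] at e1
    rw [h3, h4] at e2
    simp only at h
    refine SL2Z.ext' h ?_ (h1.trans h3.symm) (h2.trans h4.symm)
    rw [h] at e1
    exact mul_right_cancel₀ hc (by linarith)
  rw [hcard]
  refine (card_le_of_modEq (T := T) hc ((abs_nonneg _).trans hcT) _ ?_ ?_).trans ?_
  · intro x hx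
    obtain ⟨γ, hγ, rfl⟩ := Finset.mem_image.1 hx
    exact abs_entry_le (hB γ hγ).1 _ _
  · intro x hx y hy
    obtain ⟨γ, hγ, rfl⟩ := Finset.mem_image.1 hx
    obtain ⟨δ, hδ, rfl⟩ := Finset.mem_image.1 hy
    obtain ⟨-, h1, h2⟩ := hB γ hγ
    obtain ⟨-, h3, h4⟩ := hB δ hδ
    have e1 := γ.det_eq
    have e2 := δ.det_eq
    rw [h1, h2] at e1
    rw [h3, h4] at e2
    refine ⟨γ 0 1 * δ 0 0 - δ 0 1 * γ 0 0, ?_⟩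
    linear_combination δ 0 0 * e1 - γ 0 0 * e2
  · rw [← sub_nonneg]
    have : 3 * T / |(c : ℝ)| - (2 * T / |(c : ℝ)| + 1) = (T - |(c : ℝ)|) / |(c : ℝ)| := by
      field_simp; ring
    rw [this]
    exact div_nonneg (by linarith) hc'.le

theorem cnt_row_le' {T : ℝ} {c d : ℤ} (hd : d ≠ 0) (hdT : |(d : ℝ)| ≤ T) :
    (cnt T (fun γ => γ 1 0 = c ∧ γ 1 1 = d) : ℝ) ≤ 3 * T / |(d : ℝ)| := by
  classical
  have hd' : 0 < |(d : ℝ)| := abs_pos.2 (by exact_mod_cast hd)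
  set B := (ball T).filter (fun γ : SL2Z => γ 1 0 = c ∧ γ 1 1 = d)
  have hB : ∀ γ ∈ B, frobNorm γ ≤ T ∧ γ 1 0 = c ∧ γ 1 1 = d := by
    intro γ hγ; simpa [B] using hγ
  have hcard : cnt T (fun γ => γ 1 0 = c ∧ γ 1 1 = d) = (B.image (fun γ : SL2Z => γ 0 1)).card := by
    rw [Finset.card_image_of_injOn, cnt_eq_card]
    intro γ hγ δ hδ h
    obtain ⟨-, h1, h2⟩ := hB γ hγ
    obtain ⟨-, h3, h4⟩ := hB δ hδ
    have e1 := γ.det_eq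
    have e2 := δ.det_eq
    rw [h1, h2] at e1
    rw [h3, h4] at e2
    simp only at h
    refine SL2Z.ext' ?_ h (h1.trans h3.symm) (h2.trans h4.symm)
    rw [h] at e1
    exact mul_right_cancel₀ hd (by linarith)
  rw [hcard]
  refine (card_le_of_modEq (T := T) hd ((abs_nonneg _).trans hdT) _ ?_ ?_).trans ?_
  · intro x hx
    obtain ⟨γ, hγ, rfl⟩ := Finset.mem_image.1 hx
    exact abs_entry_le (hB γ hγ).1 _ _
  · intro x hx y hy
    obtain ⟨γ, hγ, rfl⟩ := Finset.mem_image.1 hx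
    obtain ⟨δ, hδ, rfl⟩ := Finset.mem_image.1 hy
    obtain ⟨-, h1, h2⟩ := hB γ hγ
    obtain ⟨-, h3, h4⟩ := hB δ hδ
    have e1 := γ.det_eq
    have e2 := δ.det_eq
    rw [h1, h2] at e1
    rw [h3, h4] at e2
    refine ⟨γ 0 1 * δ 0 0 - δ 0 1 * γ 0 0, ?_⟩
    linear_combination δ 0 1 * e1 - γ 0 1 * e2
  · rw [← sub_nonneg]
    have : 3 * T / |(d : ℝ)| - (2 * T / |(d : ℝ)| + 1) = (T - |(d : ℝ)|) / |(d : ℝ)| := by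
      field_simp; ring
    rw [this]
    exact div_nonneg (by linarith) hd'.le

theorem cnt_lowerLeft_le {T : ℝ} (hT : 1 ≤ T) {c : ℤ} (hc : c ≠ 0) (hcT : |(c : ℝ)| ≤ T) :
    (cnt T (fun γ => γ 1 0 = c) : ℝ) ≤ 9 * T ^ 2 / |(c : ℝ)| := by
  have hc' : 0 < |(c : ℝ)| := abs_pos.2 (by exact_mod_cast hc)
  rw [cnt_eq_sum (fun γ : SL2Z => γ 1 1) (intBall T) (fun γ hγ _ => mem_intBall.2 (abs_entry_le hγ 1 1))]
  push_cast
  calc _ ≤ ∑ d ∈ intBall T, 3 * T / |(c : ℝ)| := Finset.sum_le_sum fun d _ => cnt_row_le hc hcT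
    _ = (intBall T).card * (3 * T / |(c : ℝ)|) := by rw [Finset.sum_const, nsmul_eq_mul]
    _ ≤ (3 * T) * (3 * T / |(c : ℝ)|) := by
        gcongr
        have := card_intBall_le (by linarith : 0 ≤ T)
        linarith
    _ = _ := by ring

theorem sum_intBall_erase (T : ℝ) (f : ℕ → ℝ) :
    ∑ c ∈ (intBall T).erase 0, f c.natAbs = 2 * ∑ k ∈ Finset.Icc 1 ⌊T⌋₊, f k := by
  have h : (intBall T).erase 0 = (Finset.Icc 1 ⌊T⌋₊).image (fun k : ℕ => (k : ℤ)) ∪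
      (Finset.Icc 1 ⌊T⌋₊).image (fun k : ℕ => -(k : ℤ)) := by
    have hfl : (⌊T⌋₊ : ℤ) = max ⌊T⌋ 0 := by
      rw [← Int.floor_toNat, Int.toNat_eq_max]
    ext x
    simp only [intBall, Finset.mem_erase, Finset.mem_Icc, Finset.mem_union, Finset.mem_image]
    constructor
    · rintro ⟨h0, h1, h2⟩
      rcases lt_or_gt_of_ne h0 with hx | hx
      · right; exact ⟨x.natAbs, by omega, by omega⟩
      · left; exact ⟨x.natAbs, by omega, by omega⟩
    · rintro (⟨k, hk, rfl⟩ | ⟨k, hk, rfl⟩) <;> omega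
  rw [h, Finset.sum_union]
  · rw [Finset.sum_image (by intro a _ b _ h; simpa using h), Finset.sum_image (by intro a _ b _ h; simpa using h)]
    simp; ring
  · rw [Finset.disjoint_left]
    intro x hx hx'
    obtain ⟨k, hk, rfl⟩ := Finset.mem_image.1 hx
    obtain ⟨l, hl, h⟩ := Finset.mem_image.1 hx'
    rw [Finset.mem_Icc] at hk hl
    omega

theorem sum_rpow_neg_le {s : ℝ} (h0 : 0 ≤ s) (h1 : s < 1) (N : ℕ) :
    ∑ k ∈ Finset.Icc 1 N, (k : ℝ) ^ (-s) ≤ (N : ℝ) ^ (1 - s) / (1 - s) := by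
  have hs : 0 < 1 - s := by linarith
  induction N with
  | zero => simp [Real.zero_rpow hs.ne']
  | succ N ih =>
    rw [Finset.sum_Icc_succ_top (by omega)]
    refine (add_le_add_left ih _).trans ?_
    rw [le_div_iff₀ hs, add_mul, div_mul_cancel₀ _ hs.ne']
    set M : ℝ := ((N + 1 : ℕ) : ℝ) with hM
    have hM0 : 0 < M := by positivity
    have hM1 : 1 ≤ M := by rw [hM]; push_cast; linarith [Nat.cast_nonneg (α := ℝ) N]
    have hN : (N : ℝ) = M * (1 + -(1 / M)) := by rw [hM]; push_cast; field_simp; ring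
    have hb := rpow_one_add_le_one_add_mul_self (s := -(1 / M))
      (by rw [neg_le_neg_iff, div_le_one hM0]; exact hM1) hs.le (by linarith)
    have hnn : 0 ≤ 1 + -(1 / M) := by
      have : 1 / M ≤ 1 := by rw [div_le_one hM0]; exact hM1
      linarith
    rw [hN, Real.mul_rpow hM0.le hnn]
    have e1 : M ^ (-s) = M ^ (1 - s) * (1 / M) := by
      rw [one_div, ← Real.rpow_neg_one, ← Real.rpow_add hM0]; congr 1; ring
    rw [e1]
    have hp : 0 ≤ M ^ (1 - s) := by positivity
    nlinarith [mul_le_mul_of_nonneg_left hb hp]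

theorem cnt_small_lowerLeft_le {T Y : ℝ} (hY : 1 ≤ Y) (hYT : Y ≤ T) :
    (cnt T (fun γ => |(γ 1 0 : ℝ)| ≤ Y) : ℝ) ≤ 76 * T ^ (5 / 4 : ℝ) * Y ^ (3 / 4 : ℝ) := by
  classical
  have hT : 1 ≤ T := hY.trans hYT
  have hT0 : 0 < T := by linarith
  have hY0 : 0 < Y := by linarith
  have h1 : (cnt T (fun γ => |(γ 1 0 : ℝ)| ≤ Y) : ℝ) ≤
      cnt T (fun γ => ∃ p ∈ ({(0, 1), (0, -1), (1, 0), (-1, 0)} : Finset (ℤ × ℤ)), γ 1 0 = p.1 ∧ γ 1 1 = p.2) +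
      cnt T (fun γ => ∃ p ∈ (intBall Y).erase 0 ×ˢ (intBall T).erase 0, γ 1 0 = p.1 ∧ γ 1 1 = p.2) := by
    norm_cast
    refine le_trans (cnt_mono fun γ hγ h => ?_) (cnt_or_le _ _ _)
    have hd := γ.det_eq
    by_cases hc0 : γ 1 0 = 0
    · left
      rw [hc0] at hd
      simp only [mul_zero, sub_zero] at hd
      have := Int.eq_one_or_neg_one_of_mul_eq_one' hd
      rcases this with ⟨_, h2⟩ | ⟨_, h2⟩
      · exact ⟨(0, 1), by simp, hc0, h2⟩
      · exact ⟨(0, -1), by simp, hc0, h2⟩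
    by_cases hd0 : γ 1 1 = 0
    · left
      rw [hd0] at hd
      have := Int.eq_one_or_neg_one_of_mul_eq_neg_one' (u := γ 0 1) (v := γ 1 0) (by linear_combination -hd)
      rcases this with ⟨_, h2⟩ | ⟨_, h2⟩
      · exact ⟨(-1, 0), by simp, h2, hd0⟩
      · exact ⟨(1, 0), by simp, h2, hd0⟩
    · right
      refine ⟨(γ 1 0, γ 1 1), ?_, rfl, rfl⟩
      rw [Finset.mem_product, Finset.mem_erase, Finset.mem_erase, mem_intBall, mem_intBall]
      exact ⟨⟨hc0, by exact_mod_cast h⟩, hd0, abs_entry_le hγ 1 1⟩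
  have h2 : (cnt T (fun γ => ∃ p ∈ ({(0, 1), (0, -1), (1, 0), (-1, 0)} : Finset (ℤ × ℤ)), γ 1 0 = p.1 ∧ γ 1 1 = p.2) : ℝ)
      ≤ 12 * T := by
    have := cnt_exists_le (T := T) ({(0, 1), (0, -1), (1, 0), (-1, 0)} : Finset (ℤ × ℤ))
      (fun p γ => γ 1 0 = p.1 ∧ γ 1 1 = p.2)
    have this' : (cnt T (fun γ => ∃ p ∈ ({(0, 1), (0, -1), (1, 0), (-1, 0)} : Finset (ℤ × ℤ)), γ 1 0 = p.1 ∧ γ 1 1 = p.2) : ℝ)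
      ≤ ∑ p ∈ ({(0, 1), (0, -1), (1, 0), (-1, 0)} : Finset (ℤ × ℤ)), (cnt T (fun γ => γ 1 0 = p.1 ∧ γ 1 1 = p.2) : ℝ) := by
      exact_mod_cast this
    refine this'.trans ?_
    calc _ ≤ ∑ p ∈ ({(0, 1), (0, -1), (1, 0), (-1, 0)} : Finset (ℤ × ℤ)), 3 * T := by
          refine Finset.sum_le_sum fun p hp => ?_
          simp only [Finset.mem_insert, Finset.mem_singleton] at hp
          rcases hp with rfl | rfl | rfl | rfl
          · simpa using cnt_row_le' (T := T) (c := 0) (d := 1) (by norm_num) (by simpa using hT)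
          · simpa using cnt_row_le' (T := T) (c := 0) (d := -1) (by norm_num) (by simpa using hT)
          · simpa using cnt_row_le (T := T) (c := 1) (d := 0) (by norm_num) (by simpa using hT)
          · simpa using cnt_row_le (T := T) (c := -1) (d := 0) (by norm_num) (by simpa using hT)
      _ = 12 * T := by
          rw [Finset.sum_const, show ({(0, 1), (0, -1), (1, 0), (-1, 0)} : Finset (ℤ × ℤ)).card = 4 by decide]
          simp; ring
  have h3 : (cnt T (fun γ => ∃ p ∈ (intBall Y).erase 0 ×ˢ (intBall T).erase 0, γ 1 0 = p.1 ∧ γ 1 1 = p.2) : ℝ)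
      ≤ 64 * T ^ (5 / 4 : ℝ) * Y ^ (3 / 4 : ℝ) := by
    have := cnt_exists_le (T := T) ((intBall Y).erase 0 ×ˢ (intBall T).erase 0) (fun p γ => γ 1 0 = p.1 ∧ γ 1 1 = p.2)
    have this' : (cnt T (fun γ => ∃ p ∈ (intBall Y).erase 0 ×ˢ (intBall T).erase 0, γ 1 0 = p.1 ∧ γ 1 1 = p.2) : ℝ)
      ≤ ∑ p ∈ (intBall Y).erase 0 ×ˢ (intBall T).erase 0, (cnt T (fun γ => γ 1 0 = p.1 ∧ γ 1 1 = p.2) : ℝ) := by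
      exact_mod_cast this
    refine this'.trans ?_
    calc _ ≤ ∑ p ∈ (intBall Y).erase 0 ×ˢ (intBall T).erase 0,
          3 * T * ((p.1.natAbs : ℝ) ^ (-(1 / 4) : ℝ) * (p.2.natAbs : ℝ) ^ (-(3 / 4) : ℝ)) := by
          refine Finset.sum_le_sum fun p hp => ?_
          rw [Finset.mem_product, Finset.mem_erase, Finset.mem_erase, mem_intBall, mem_intBall] at hp
          obtain ⟨⟨hc0, hcY⟩, hd0, hdT⟩ := hp
          have r1 := cnt_row_le (T := T) (c := p.1) (d := p.2) hc0 (hcY.trans hYT)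
          have r2 := cnt_row_le' (T := T) (c := p.1) (d := p.2) hd0 hdT
          set N : ℝ := (cnt T (fun γ => γ 1 0 = p.1 ∧ γ 1 1 = p.2) : ℝ)
          have ec : |(p.1 : ℝ)| = (p.1.natAbs : ℝ) := by rw [Nat.cast_natAbs]; simp
          have ed : |(p.2 : ℝ)| = (p.2.natAbs : ℝ) := by rw [Nat.cast_natAbs]; simp
          rw [ec] at r1
          rw [ed] at r2
          have hN0 : 0 ≤ N := Nat.cast_nonneg _
          have hx : (0 : ℝ) < p.1.natAbs := by exact_mod_cast Int.natAbs_pos.2 hc0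
          have hy : (0 : ℝ) < p.2.natAbs := by exact_mod_cast Int.natAbs_pos.2 hd0
          have e1 : N = N ^ (1 / 4 : ℝ) * N ^ (3 / 4 : ℝ) := by
            rw [← Real.rpow_add' hN0 (by norm_num)]; norm_num
          rw [e1]
          calc N ^ (1 / 4 : ℝ) * N ^ (3 / 4 : ℝ) ≤ (3 * T / p.1.natAbs) ^ (1 / 4 : ℝ) * (3 * T / p.2.natAbs) ^ (3 / 4 : ℝ) := by
                gcongr
            _ = (3 * T) ^ (1 / 4 : ℝ) * (3 * T) ^ (3 / 4 : ℝ) *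
                ((p.1.natAbs : ℝ) ^ (-(1 / 4) : ℝ) * (p.2.natAbs : ℝ) ^ (-(3 / 4) : ℝ)) := by
                rw [Real.div_rpow (by positivity) hx.le, Real.div_rpow (by positivity) hy.le,
                  Real.rpow_neg hx.le, Real.rpow_neg hy.le]
                ring
            _ = _ := by
                rw [← Real.rpow_add (by positivity)]; norm_num
      _ = 3 * T * ((2 * ∑ k ∈ Finset.Icc 1 ⌊Y⌋₊, (k : ℝ) ^ (-(1 / 4) : ℝ)) *
            (2 * ∑ k ∈ Finset.Icc 1 ⌊T⌋₊, (k : ℝ) ^ (-(3 / 4) : ℝ))) := by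
          rw [← sum_intBall_erase Y (fun k => (k : ℝ) ^ (-(1 / 4) : ℝ)),
            ← sum_intBall_erase T (fun k => (k : ℝ) ^ (-(3 / 4) : ℝ)), Finset.sum_mul_sum, ← Finset.mul_sum,
            Finset.sum_product]
      _ ≤ 3 * T * ((2 * (4 / 3 * Y ^ (3 / 4 : ℝ))) * (2 * (4 * T ^ (1 / 4 : ℝ)))) := by
          have s1 := sum_rpow_neg_le (s := 1 / 4) (by norm_num) (by norm_num) ⌊Y⌋₊
          have s2 := sum_rpow_neg_le (s := 3 / 4) (by norm_num) (by norm_num) ⌊T⌋₊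
          have t1 : ((⌊Y⌋₊ : ℕ) : ℝ) ^ (1 - 1 / 4 : ℝ) ≤ Y ^ (3 / 4 : ℝ) := by
            rw [show (1 - 1 / 4 : ℝ) = 3 / 4 by norm_num]
            exact Real.rpow_le_rpow (by positivity) (Nat.floor_le hY0.le) (by norm_num)
          have t2 : ((⌊T⌋₊ : ℕ) : ℝ) ^ (1 - 3 / 4 : ℝ) ≤ T ^ (1 / 4 : ℝ) := by
            rw [show (1 - 3 / 4 : ℝ) = 1 / 4 by norm_num]
            exact Real.rpow_le_rpow (by positivity) (Nat.floor_le hT0.le) (by norm_num)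
          have u1 : ∑ k ∈ Finset.Icc 1 ⌊Y⌋₊, (k : ℝ) ^ (-(1 / 4) : ℝ) ≤ 4 / 3 * Y ^ (3 / 4 : ℝ) := by
            refine s1.trans ?_
            rw [div_le_iff₀ (by norm_num)]
            refine t1.trans (le_of_eq (by ring))
          have u2 : ∑ k ∈ Finset.Icc 1 ⌊T⌋₊, (k : ℝ) ^ (-(3 / 4) : ℝ) ≤ 4 * T ^ (1 / 4 : ℝ) := by
            refine s2.trans ?_
            rw [div_le_iff₀ (by norm_num)]
            refine t2.trans (le_of_eq (by ring))
          have v2 : 0 ≤ ∑ k ∈ Finset.Icc 1 ⌊T⌋₊, (k : ℝ) ^ (-(3 / 4) : ℝ) := by positivity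
          gcongr
      _ = 64 * (T * T ^ (1 / 4 : ℝ)) * Y ^ (3 / 4 : ℝ) := by ring
      _ = _ := by rw [← Real.rpow_one_add' hT0.le (by norm_num)]; norm_num
  have h4 : T ≤ T ^ (5 / 4 : ℝ) * Y ^ (3 / 4 : ℝ) := by
    have a1 : T ≤ T ^ (5 / 4 : ℝ) := by
      conv_lhs => rw [← Real.rpow_one T]
      exact Real.rpow_le_rpow_of_exponent_le hT (by norm_num)
    have a2 : 1 ≤ Y ^ (3 / 4 : ℝ) := Real.one_le_rpow hY (by norm_num)
    nlinarith
  linarith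

theorem cnt_le_sq {T : ℝ} (hT : 1 ≤ T) (P : SL2Z → Prop) : (cnt T P : ℝ) ≤ 76 * T ^ 2 := by
  have h1 : (cnt T P : ℝ) ≤ cnt T (fun γ => |(γ 1 0 : ℝ)| ≤ T) := by
    exact_mod_cast cnt_mono fun γ hγ _ => abs_entry_le hγ 1 0
  refine h1.trans ((cnt_small_lowerLeft_le hT le_rfl).trans (le_of_eq ?_))
  rw [mul_assoc, ← Real.rpow_add (by linarith)]
  norm_num

theorem exists_completion {c d : ℤ} (hc : 1 ≤ c) (hd : 1 ≤ d) (h : IsCoprime c d) :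
    ∃ γ : SL2Z, γ 1 0 = c ∧ γ 1 1 = d ∧ |γ 0 0| ≤ c ∧ |γ 0 1| ≤ d := by
  obtain ⟨u, v, huv⟩ := h
  have hdet : (v % c) * d - (-u - (v / c) * d) * c = 1 := by
    have := Int.emod_add_mul_ediv v c
    linear_combination huv + d * this
  have h0 := Int.emod_nonneg v (by omega : c ≠ 0)
  have h1 := Int.emod_lt_of_pos v (by omega : 0 < c)
  refine ⟨SL2Z.mk _ _ _ _ hdet, rfl, rfl, ?_, ?_⟩
  · rw [SL2Z.mk_00, abs_le]; omega
  · rw [SL2Z.mk_01]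
    generalize v % c = a at *
    generalize -u - (v / c) * d = b at *
    rw [abs_le]
    constructor <;> by_contra hcon <;> push Not at hcon <;> nlinarith

theorem sum_inv_sq_le (N : ℕ) : ∑ k ∈ Finset.Icc 2 N, (1 / (k : ℝ) ^ 2 : ℝ) ≤ (3 / 4 : ℝ) := by
  have key : ∀ M : ℕ, ∑ k ∈ Finset.Icc 2 (M + 2), (1 / (k : ℝ) ^ 2 : ℝ) ≤ (3 / 4 - 1 / (M + 2) : ℝ) := by
    intro M
    induction M with
    | zero => norm_num
    | succ M ih =>
      rw [show M + 1 + 2 = (M + 2) + 1 by ring, Finset.sum_Icc_succ_top (by omega)]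
      have : 1 / (((M + 2 + 1 : ℕ) : ℝ)) ^ 2 ≤ 1 / ((M : ℝ) + 2) - 1 / ((M + 1 : ℕ) + 2 : ℝ) := by
        push_cast
        rw [div_sub_div _ _ (by positivity) (by positivity), div_le_div_iff₀ (by positivity) (by positivity)]
        nlinarith
      linarith
  rcases Nat.lt_or_ge N 2 with h | h
  · rw [Finset.Icc_eq_empty (by omega)]; norm_num
  · obtain ⟨M, rfl⟩ := Nat.exists_eq_add_of_le' h
    refine (key M).trans ?_
    have : (0 : ℝ) ≤ 1 / (M + 2) := by positivity
    linarith

theorem card_coprime_pairs_ge (N : ℕ) :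
    (N : ℝ) ^ 2 / 4 ≤
      (((Finset.Icc 1 N ×ˢ Finset.Icc 1 N).filter (fun p : ℕ × ℕ => p.1.Coprime p.2)).card : ℝ) := by
  set S := Finset.Icc 1 N ×ˢ Finset.Icc 1 N
  have h1 := Finset.card_filter_add_card_filter_not (s := S) (fun p : ℕ × ℕ => p.1.Coprime p.2)
  have h2 : S.card = N ^ 2 := by simp [S, sq]
  have h3 : ((S.filter (fun p : ℕ × ℕ => ¬ p.1.Coprime p.2)).card : ℝ) ≤ 3 / 4 * N ^ 2 := by
    have : (S.filter (fun p : ℕ × ℕ => ¬ p.1.Coprime p.2)) ⊆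
        (Finset.Icc 2 N).biUnion fun k => ((Finset.Ioc 0 N).filter (k ∣ ·)) ×ˢ ((Finset.Ioc 0 N).filter (k ∣ ·)) := by
      intro p hp
      simp only [Finset.mem_filter, S, Finset.mem_product, Finset.mem_Icc, Finset.mem_biUnion, Finset.mem_Ioc] at hp ⊢
      obtain ⟨⟨⟨a1, a2⟩, b1, b2⟩, hc⟩ := hp
      refine ⟨p.1.gcd p.2, ⟨?_, ?_⟩, ⟨⟨by omega, a2⟩, Nat.gcd_dvd_left _ _⟩, ⟨by omega, b2⟩, Nat.gcd_dvd_right _ _⟩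
      · have : 0 < p.1.gcd p.2 := Nat.gcd_pos_of_pos_left _ (by omega)
        have : p.1.gcd p.2 ≠ 1 := hc
        omega
      · exact (Nat.gcd_le_left _ (by omega)).trans a2
    calc _ ≤ ((∑ k ∈ Finset.Icc 2 N, (N / k) * (N / k) : ℕ) : ℝ) := by
          norm_cast
          refine (Finset.card_le_card this).trans (Finset.card_biUnion_le.trans (Finset.sum_le_sum fun k _ => ?_))
          rw [Finset.card_product, Nat.Ioc_filter_dvd_card_eq_div]
      _ ≤ ∑ k ∈ Finset.Icc 2 N, (N : ℝ) ^ 2 * (1 / (k : ℝ) ^ 2) := by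
          push_cast
          refine Finset.sum_le_sum fun k _ => ?_
          have : ((N / k : ℕ) : ℝ) ≤ N / k := Nat.cast_div_le
          calc _ ≤ ((N : ℝ) / k) * (N / k) := by gcongr
            _ = _ := by ring
      _ ≤ (N : ℝ) ^ 2 * (3 / 4) := by
          rw [← Finset.mul_sum]; gcongr; exact sum_inv_sq_le N
      _ = _ := by ring
  have h4 : (((S.filter (fun p : ℕ × ℕ => p.1.Coprime p.2)).card : ℝ)) +
      ((S.filter (fun p : ℕ × ℕ => ¬ p.1.Coprime p.2)).card : ℝ) = N ^ 2 := by
    rw [← Nat.cast_add, h1, h2]; push_cast; rfl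
  linarith

/-- The ball of radius `T` has at least a constant times `T ^ 2` elements. -/
theorem cnt_ge_sq {T : ℝ} (hT : 4 ≤ T) : T ^ 2 / 64 ≤ (cnt T (fun _ => True) : ℝ) := by
  set N := ⌊T / 2⌋₊
  have hN1 : (N : ℝ) ≤ T / 2 := Nat.floor_le (by linarith)
  have hN2 : T / 4 ≤ (N : ℝ) := by
    have := Nat.lt_floor_add_one (T / 2); change T / 2 < N + 1 at this; linarith
  have key := card_coprime_pairs_ge N
  set S := ((Finset.Icc 1 N ×ˢ Finset.Icc 1 N).filter (fun p : ℕ × ℕ => p.1.Coprime p.2))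
  have hS : ∀ p ∈ S, ∃ γ : SL2Z, frobNorm γ ≤ T ∧ γ 1 0 = p.1 ∧ γ 1 1 = p.2 := by
    intro p hp
    simp only [Finset.mem_filter, S, Finset.mem_product, Finset.mem_Icc] at hp
    obtain ⟨⟨⟨a1, a2⟩, b1, b2⟩, hc⟩ := hp
    obtain ⟨γ, h1, h2, h3, h4⟩ := exists_completion (c := p.1) (d := p.2) (by omega) (by omega)
      (Nat.isCoprime_iff_coprime.2 hc)
    refine ⟨γ, ?_, h1, h2⟩
    rw [frobNorm_le_iff (by linarith)]
    have e1 : (normSq γ) ≤ 4 * (N : ℤ) ^ 2 := by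
      unfold normSq
      rw [h1, h2]
      have q1 : |γ 0 0| ≤ N := h3.trans (by exact_mod_cast a2)
      have q2 : |γ 0 1| ≤ N := h4.trans (by exact_mod_cast b2)
      have q3 : (p.1 : ℤ) ≤ N := by exact_mod_cast a2
      have q4 : (p.2 : ℤ) ≤ N := by exact_mod_cast b2
      have r1 := sq_le_sq.2 (q1.trans (le_abs_self _))
      have r2 := sq_le_sq.2 (q2.trans (le_abs_self _))
      have r3 := pow_le_pow_left₀ (by positivity : (0 : ℤ) ≤ p.1) q3 2
      have r4 := pow_le_pow_left₀ (by positivity : (0 : ℤ) ≤ p.2) q4 2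
      linarith
    have e2 : (normSq γ : ℝ) ≤ 4 * (N : ℝ) ^ 2 := by exact_mod_cast e1
    nlinarith [(Nat.cast_nonneg N : (0 : ℝ) ≤ N)]
  classical
  choose! g hg using hS
  have : S.card ≤ cnt T (fun _ => True) := by
    rw [cnt_eq_card]
    refine Finset.card_le_card_of_injOn g ?_ ?_
    · intro p hp
      simpa using (hg p hp).1
    · intro p hp p' hp' h
      have h1 := (hg p hp).2
      have h2 := (hg p' hp').2
      rw [h] at h1
      ext
      · exact_mod_cast h1.1.symm.trans h2.1
      · exact_mod_cast h1.2.symm.trans h2.2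
  have : (S.card : ℝ) ≤ cnt T (fun _ => True) := by exact_mod_cast this
  nlinarith

open Classical in
/-- Two sets of lattice points which have almost the same number of points in every box of side `H`
have almost the same number of points in a down-closed region. -/
theorem abs_card_sub_card_le_of_boxes {N H : ℕ} (hH : 0 < H) (D X X' : ℕ × ℕ → Prop)
    (hD : ∀ p p' : ℕ × ℕ, p ≤ p' → D p' → D p) (E₁ E₂ : ℝ)
    (cX cX' : ℕ → ℕ → ℕ)
    (hX : ∀ i j, cX i j = ((Finset.Ico (i * H) (i * H + H) ×ˢ Finset.Ico (j * H) (j * H + H)).filter X).card)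
    (hX' : ∀ i j, cX' i j = ((Finset.Ico (i * H) (i * H + H) ×ˢ Finset.Ico (j * H) (j * H + H)).filter X').card)
    (h₁ : ∀ i j, |(cX i j : ℝ) - cX' i j| ≤ E₁)
    (h₂ : ∀ i j, (cX i j : ℝ) ≤ E₂) (h₂' : ∀ i j, (cX' i j : ℝ) ≤ E₂) :
    |(((Finset.range (N * H) ×ˢ Finset.range (N * H)).filter (fun p => X p ∧ D p)).card : ℝ) -
      ((Finset.range (N * H) ×ˢ Finset.range (N * H)).filter (fun p => X' p ∧ D p)).card| ≤
      N ^ 2 * E₁ + 2 * N * E₂ := by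
  have hE₁ : 0 ≤ E₁ := (abs_nonneg _).trans (h₁ 0 0)
  have hE₂ : 0 ≤ E₂ := le_trans (Nat.cast_nonneg _) (h₂ 0 0)
  set box : ℕ × ℕ → Finset (ℕ × ℕ) := fun b =>
    Finset.Ico (b.1 * H) (b.1 * H + H) ×ˢ Finset.Ico (b.2 * H) (b.2 * H + H) with hbox
  have hmem : ∀ b p, p ∈ box b ↔ (p.1 / H, p.2 / H) = b := by
    intro b p
    simp only [hbox, Finset.mem_product, Finset.mem_Ico, Prod.ext_iff]
    rw [Nat.div_eq_iff hH, Nat.div_eq_iff hH]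
    omega
  set I := Finset.range N ×ˢ Finset.range N with hI
  have decomp : ∀ Y : ℕ × ℕ → Prop,
      ((Finset.range (N * H) ×ˢ Finset.range (N * H)).filter (fun p => Y p ∧ D p)).card =
      ∑ b ∈ I, ((box b).filter (fun p => Y p ∧ D p)).card := by
    intro Y
    rw [Finset.card_eq_sum_card_fiberwise (f := fun p => (p.1 / H, p.2 / H)) (t := I)]
    · refine Finset.sum_congr rfl fun b hb => ?_
      congr 1
      ext p
      simp only [Finset.mem_filter, hmem, Finset.mem_product, Finset.mem_range]
      constructor
      · rintro ⟨⟨_, h2⟩, h3⟩; exact ⟨h3, h2⟩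
      · rintro ⟨h3, h2⟩
        refine ⟨⟨?_, h2⟩, h3⟩
        rw [← h3] at hb
        simp only [hI, Finset.mem_product, Finset.mem_range, Nat.div_lt_iff_lt_mul hH] at hb
        exact hb
    · intro p hp
      simp only [Finset.coe_filter, Finset.mem_product, Finset.mem_range, Set.mem_ofPred_eq] at hp
      simp only [hI, Finset.coe_product, Finset.coe_range, Set.mem_prod, Set.mem_Iio,
        Nat.div_lt_iff_lt_mul hH]
      exact hp.1
  rw [decomp, decomp]
  push_cast
  rw [← Finset.sum_sub_distrib]
  refine (Finset.abs_sum_le_sum_abs _ _).trans ?_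
  set Bd : ℕ × ℕ → Prop := fun b => D (b.1 * H, b.2 * H) ∧ ¬ D (b.1 * H + (H - 1), b.2 * H + (H - 1)) with hBd
  have term : ∀ b ∈ I, |(((box b).filter (fun p => X p ∧ D p)).card : ℝ) -
      ((box b).filter (fun p => X' p ∧ D p)).card| ≤ E₁ + if Bd b then E₂ else 0 := by
    intro b _
    have sub : ∀ Y : ℕ × ℕ → Prop, ((box b).filter (fun p => Y p ∧ D p)).card ≤ ((box b).filter Y).card :=
      fun Y => Finset.card_le_card fun p hp => by
        simp only [Finset.mem_filter] at hp ⊢; exact ⟨hp.1, hp.2.1⟩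
    by_cases hmin : D (b.1 * H, b.2 * H)
    · by_cases hmax : D (b.1 * H + (H - 1), b.2 * H + (H - 1))
      · have all : ∀ Y : ℕ × ℕ → Prop, (box b).filter (fun p => Y p ∧ D p) = (box b).filter Y := by
          intro Y
          refine Finset.filter_congr fun p hp => ?_
          have : D p := by
            refine hD _ _ ?_ hmax
            simp only [hbox, Finset.mem_product, Finset.mem_Ico] at hp
            exact ⟨by show p.1 ≤ b.1 * H + (H - 1); omega, by show p.2 ≤ b.2 * H + (H - 1); omega⟩
          tauto
        rw [all, all, if_neg (by simp only [hBd]; tauto)]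
        have := h₁ b.1 b.2
        rw [hX, hX'] at this
        simpa using this
      · rw [if_pos (by simp only [hBd]; tauto)]
        have a1 : (((box b).filter (fun p => X p ∧ D p)).card : ℝ) ≤ E₂ := by
          refine le_trans ?_ (h₂ b.1 b.2)
          rw [hX]; exact_mod_cast sub X
        have a2 : (((box b).filter (fun p => X' p ∧ D p)).card : ℝ) ≤ E₂ := by
          refine le_trans ?_ (h₂' b.1 b.2)
          rw [hX']; exact_mod_cast sub X'
        have b1 : (0 : ℝ) ≤ (((box b).filter (fun p => X p ∧ D p)).card : ℝ) := Nat.cast_nonneg _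
        have b2 : (0 : ℝ) ≤ (((box b).filter (fun p => X' p ∧ D p)).card : ℝ) := Nat.cast_nonneg _
        rw [abs_le]; constructor <;> linarith
    · have none : ∀ Y : ℕ × ℕ → Prop, (box b).filter (fun p => Y p ∧ D p) = ∅ := by
        intro Y
        refine Finset.filter_eq_empty_iff.2 fun p hp h => hmin (hD _ _ ?_ h.2)
        simp only [hbox, Finset.mem_product, Finset.mem_Ico] at hp
        exact ⟨hp.1.1, hp.2.1⟩
      rw [none, none, if_neg (by simp only [hBd]; tauto)]
      simpa using hE₁
  refine (Finset.sum_le_sum term).trans ?_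
  rw [Finset.sum_add_distrib, ← Finset.sum_filter, Finset.sum_const, Finset.sum_const]
  have cI : I.card = N ^ 2 := by simp [hI, sq]
  have cB : (I.filter Bd).card ≤ 2 * N := by
    have : (I.filter Bd).card ≤ (Finset.range (2 * N)).card := by
      refine Finset.card_le_card_of_injOn (fun b => N + b.1 - b.2) ?_ ?_
      · intro b hb
        simp only [hI, Finset.coe_filter, Finset.mem_product, Finset.mem_range, Set.mem_ofPred_eq] at hb
        simp only [Finset.coe_range, Set.mem_Iio]
        omega
      · have key : ∀ b b' : ℕ × ℕ, Bd b → Bd b' → b.1 < b'.1 → b.2 < b'.2 → False := by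
          intro b b' h h' l1 l2
          refine h.2 (hD _ _ ?_ h'.1)
          have e1 : b.1 * H + H ≤ b'.1 * H := by nlinarith
          have e2 : b.2 * H + H ≤ b'.2 * H := by nlinarith
          exact ⟨by show b.1 * H + (H - 1) ≤ b'.1 * H; omega, by show b.2 * H + (H - 1) ≤ b'.2 * H; omega⟩
        intro b hb b' hb' h
        simp only [hI, Finset.coe_filter, Finset.mem_product, Finset.mem_range, Set.mem_ofPred_eq] at hb hb' h
        rcases lt_trichotomy b.1 b'.1 with h1 | h1 | h1
        · exact (key b b' hb.2 hb'.2 h1 (by omega)).elim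
        · exact Prod.ext h1 (by omega)
        · exact (key b' b hb'.2 hb.2 h1 (by omega)).elim
    simpa using this
  rw [cI, nsmul_eq_mul, nsmul_eq_mul]
  have cB' : ((I.filter Bd).card : ℝ) ≤ 2 * N := by exact_mod_cast cB
  push_cast
  gcongr

open Classical in
/-- Box counts in a quadrant, in terms of positive coordinates. -/
theorem card_signed_box {n w : ℕ} (V : Finset (ZMod w × ZMod w)) {s t : ℤ} (hs : s = 1 ∨ s = -1)
    (ht : t = 1 ∨ t = -1) (H i j : ℕ) :
    ∃ x₀ y₀ : ℤ, ((Finset.Ico (i * H) (i * H + H) ×ˢ Finset.Ico (j * H) (j * H + H)).filter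
      (fun p : ℕ × ℕ => (((s * (p.1 + 1) : ℤ) : ZMod w), ((t * (p.2 + 1) : ℤ) : ZMod w)) ∈ V ∧
        (n : ℤ) ∣ (s * (p.1 + 1)) * (t * (p.2 + 1)) - 1)).card = boxCount n w V x₀ y₀ H := by
  have key : ∀ s : ℤ, (s = 1 ∨ s = -1) → ∀ i : ℕ, ∃ x₀ : ℤ, ∀ x : ℤ,
      x ∈ Finset.Ico x₀ (x₀ + H) ↔ ∃ k ∈ Finset.Ico (i * H) (i * H + H), s * ((k : ℤ) + 1) = x := by
    rintro s (rfl | rfl) i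
    · refine ⟨i * H + 1, fun x => ?_⟩
      simp only [Finset.mem_Ico]
      generalize hz : (i : ℤ) * H = z
      have hz' : ((i * H : ℕ) : ℤ) = z := by push_cast; exact hz
      constructor
      · rintro ⟨h1, h2⟩
        exact ⟨(x - 1).toNat, by omega, by omega⟩
      · rintro ⟨k, h1, h2⟩
        omega
    · refine ⟨-(i * H) - H, fun x => ?_⟩
      simp only [Finset.mem_Ico]
      generalize hz : (i : ℤ) * H = z
      have hz' : ((i * H : ℕ) : ℤ) = z := by push_cast; exact hz
      constructor
      · rintro ⟨h1, h2⟩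
        exact ⟨(-x - 1).toNat, by omega, by omega⟩
      · rintro ⟨k, h1, h2⟩
        omega
  obtain ⟨x₀, hx⟩ := key s hs i
  obtain ⟨y₀, hy⟩ := key t ht j
  refine ⟨x₀, y₀, ?_⟩
  unfold boxCount
  refine Finset.card_nbij (fun p => (s * (p.1 + 1), t * (p.2 + 1))) ?_ ?_ ?_
  · intro p hp
    simp only [Finset.coe_filter, Finset.mem_product, Set.mem_ofPred_eq] at hp ⊢
    exact ⟨⟨(hx _).2 ⟨p.1, hp.1.1, rfl⟩, (hy _).2 ⟨p.2, hp.1.2, rfl⟩⟩, hp.2⟩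
  · intro p _ p' _ h
    simp only [Prod.mk.injEq] at h
    rcases hs with rfl | rfl <;> rcases ht with rfl | rfl <;> ext <;> omega
  · intro x hxm
    simp only [Finset.coe_filter, Finset.mem_product, Set.mem_ofPred_eq] at hxm
    obtain ⟨⟨h1, h2⟩, h3⟩ := hxm
    obtain ⟨k, hk, hk'⟩ := (hx _).1 h1
    obtain ⟨l, hl, hl'⟩ := (hy _).1 h2
    refine ⟨(k, l), ?_, ?_⟩
    · simp only [Finset.coe_filter, Finset.mem_product, Set.mem_ofPred_eq]
      rw [hk', hl']
      exact ⟨⟨hk, hl⟩, h3⟩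
    · exact Prod.ext hk' hl'

open Classical in
/-- The count of matrices with lower left entry `c`, split according to the signs of the diagonal
entries. -/
theorem cnt_eq_sum_quadrants {T : ℝ} (hT : 0 ≤ T) {c : ℤ} (hc : 2 ≤ |c|) (P : SL2Z → Prop) (R : ℤ → ℤ → Prop)
    (hPR : ∀ γ : SL2Z, γ 1 0 = c → (P γ ↔ R (γ 0 0) (γ 1 1))) (hR : ∀ a d, R a d → c ∣ a * d - 1)
    {M : ℕ} (hM : T ≤ M) :
    cnt T (fun γ => γ 1 0 = c ∧ P γ) = ∑ s ∈ ({(1, 1), (1, -1), (-1, 1), (-1, -1)} : Finset (ℤ × ℤ)),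
      ((Finset.range M ×ˢ Finset.range M).filter (fun p : ℕ × ℕ => R (s.1 * (p.1 + 1)) (s.2 * (p.2 + 1)) ∧
        ((p.1 + 1 : ℝ) ^ 2 + ((s.1 * s.2 : ℤ) * ((p.1 + 1) * (p.2 + 1)) - 1) ^ 2 / c ^ 2 + c ^ 2 + (p.2 + 1) ^ 2 ≤ T ^ 2))).card := by
  have hc0 : c ≠ 0 := by rintro rfl; simp at hc
  have hcr : (c : ℝ) ≠ 0 := by exact_mod_cast hc0
  have nz : ∀ γ : SL2Z, γ 1 0 = c → γ 0 0 ≠ 0 ∧ γ 1 1 ≠ 0 := by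
    intro γ h
    have hd := γ.det_eq
    have : ∀ x : ℤ, x * c = -1 → False := by
      intro x hx
      have : c ∣ 1 := ⟨-x, by linarith⟩
      have := Int.le_of_dvd one_pos ((abs_dvd _ _).2 this)
      omega
    constructor <;> intro h0 <;> rw [h0, h] at hd <;> exact this (γ 0 1) (by linarith)
  rw [cnt_eq_sum (fun γ : SL2Z => ((γ 0 0).sign, (γ 1 1).sign)) ({(1, 1), (1, -1), (-1, 1), (-1, -1)} : Finset (ℤ × ℤ))]
  · refine Finset.sum_congr rfl fun s hs => ?_
    have hs' : (s.1 = 1 ∨ s.1 = -1) ∧ (s.2 = 1 ∨ s.2 = -1) := by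
      simp only [Finset.mem_insert, Finset.mem_singleton] at hs
      rcases hs with rfl | rfl | rfl | rfl <;> simp
    have sq1 : s.1 * s.1 = 1 := by rcases hs'.1 with h | h <;> rw [h] <;> rfl
    have sq2 : s.2 * s.2 = 1 := by rcases hs'.2 with h | h <;> rw [h] <;> rfl
    rw [cnt_eq_card]
    have norm_eq : ∀ γ : SL2Z, γ 1 0 = c → ∀ x y : ℤ, γ 0 0 = s.1 * x → γ 1 1 = s.2 * y →
        (normSq γ : ℝ) = (x : ℝ) ^ 2 + ((s.1 * s.2 : ℤ) * ((x : ℝ) * y) - 1) ^ 2 / c ^ 2 + c ^ 2 + (y : ℝ) ^ 2 := by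
      intro γ h x y hx hy
      have hd := γ.det_eq
      rw [h, hx, hy] at hd
      have hb : (γ 0 1 : ℝ) = ((s.1 * s.2 : ℤ) * ((x : ℝ) * y) - 1) / c := by
        rw [eq_div_iff hcr]
        have : (γ 0 1) * c = (s.1 * s.2) * (x * y) - 1 := by linear_combination -hd
        exact_mod_cast this
      have e1 : ((s.1 : ℤ) : ℝ) ^ 2 = 1 := by
        have : s.1 ^ 2 = 1 := by rw [sq]; exact sq1
        exact_mod_cast this
      have e2 : ((s.2 : ℤ) : ℝ) ^ 2 = 1 := by
        have : s.2 ^ 2 = 1 := by rw [sq]; exact sq2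
        exact_mod_cast this
      unfold normSq
      push_cast
      rw [hb, h, hx, hy]
      push_cast
      rw [mul_pow, mul_pow, e1, e2, div_pow]
      ring
    refine Finset.card_nbij (fun γ => ((γ 0 0).natAbs - 1, (γ 1 1).natAbs - 1)) ?_ ?_ ?_
    · intro γ hγ
      simp only [Finset.coe_filter, mem_ball, Finset.mem_product, Finset.mem_range, Set.mem_ofPred_eq] at hγ ⊢
      obtain ⟨hn, ⟨h1, h2⟩, h3⟩ := hγ
      obtain ⟨na, nd⟩ := nz γ h1
      have pa : 1 ≤ (γ 0 0).natAbs := by omega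
      have pd : 1 ≤ (γ 1 1).natAbs := by omega
      have ea : (((γ 0 0).natAbs - 1 : ℕ) : ℤ) + 1 = |γ 0 0| := by rw [Int.abs_eq_natAbs]; omega
      have ed : (((γ 1 1).natAbs - 1 : ℕ) : ℤ) + 1 = |γ 1 1| := by rw [Int.abs_eq_natAbs]; omega
      have ga : γ 0 0 = s.1 * |γ 0 0| := by rw [← h3]; exact (Int.sign_mul_abs _).symm
      have gd : γ 1 1 = s.2 * |γ 1 1| := by rw [← h3]; exact (Int.sign_mul_abs _).symm
      have ba : ((γ 0 0).natAbs : ℝ) ≤ M := by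
        rw [Nat.cast_natAbs]; push_cast; exact (abs_entry_le hn 0 0).trans hM
      have bd : ((γ 1 1).natAbs : ℝ) ≤ M := by
        rw [Nat.cast_natAbs]; push_cast; exact (abs_entry_le hn 1 1).trans hM
      have ba' : (γ 0 0).natAbs ≤ M := by exact_mod_cast ba
      have bd' : (γ 1 1).natAbs ≤ M := by exact_mod_cast bd
      refine ⟨⟨by omega, by omega⟩, ?_, ?_⟩
      · rw [ea, ed, ← ga, ← gd]; exact (hPR γ h1).1 h2
      · have := norm_eq γ h1 _ _ ga gd
        rw [frobNorm_le_iff hT, this] at hn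
        have ea' : (((γ 0 0).natAbs - 1 : ℕ) : ℝ) + 1 = ((|γ 0 0| : ℤ) : ℝ) := by exact_mod_cast ea
        have ed' : (((γ 1 1).natAbs - 1 : ℕ) : ℝ) + 1 = ((|γ 1 1| : ℤ) : ℝ) := by exact_mod_cast ed
        rw [ea', ed']; exact hn
    · intro γ hγ δ hδ h
      simp only [Finset.coe_filter, mem_ball, Set.mem_ofPred_eq] at hγ hδ
      obtain ⟨hn, ⟨h1, h2⟩, h3⟩ := hγ
      obtain ⟨hn', ⟨h1', h2'⟩, h3'⟩ := hδ
      obtain ⟨na, nd⟩ := nz γ h1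
      obtain ⟨na', nd'⟩ := nz δ h1'
      simp only [Prod.mk.injEq] at h
      have ga : γ 0 0 = s.1 * |γ 0 0| := by rw [← h3]; exact (Int.sign_mul_abs _).symm
      have gd : γ 1 1 = s.2 * |γ 1 1| := by rw [← h3]; exact (Int.sign_mul_abs _).symm
      have ga' : δ 0 0 = s.1 * |δ 0 0| := by rw [← h3']; exact (Int.sign_mul_abs _).symm
      have gd' : δ 1 1 = s.2 * |δ 1 1| := by rw [← h3']; exact (Int.sign_mul_abs _).symm
      have e1 : |γ 0 0| = |δ 0 0| := by rw [Int.abs_eq_natAbs, Int.abs_eq_natAbs]; omega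
      have e2 : |γ 1 1| = |δ 1 1| := by rw [Int.abs_eq_natAbs, Int.abs_eq_natAbs]; omega
      have f1 : γ 0 0 = δ 0 0 := by rw [ga, ga', e1]
      have f2 : γ 1 1 = δ 1 1 := by rw [gd, gd', e2]
      refine SL2Z.ext' f1 ?_ (h1.trans h1'.symm) f2
      have d1 := γ.det_eq
      have d2 := δ.det_eq
      rw [h1, f1, f2] at d1
      rw [h1'] at d2
      exact mul_right_cancel₀ hc0 (by linarith)
    · intro p hp
      simp only [Finset.coe_filter, Finset.mem_product, Finset.mem_range, Set.mem_ofPred_eq] at hp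
      obtain ⟨_, h1, h2⟩ := hp
      obtain ⟨b, hb⟩ := hR _ _ h1
      let γ : SL2Z := SL2Z.mk (s.1 * (p.1 + 1)) b c (s.2 * (p.2 + 1)) (by rw [mul_comm b, ← hb]; ring)
      refine ⟨γ, ?_, ?_⟩
      · simp only [Finset.coe_filter, mem_ball, Set.mem_ofPred_eq]
        refine ⟨?_, ⟨rfl, (hPR γ rfl).2 h1⟩, ?_⟩
        · rw [frobNorm_le_iff hT, norm_eq γ rfl (p.1 + 1) (p.2 + 1) rfl rfl]
          push_cast at h2 ⊢
          exact h2
        · have z1 : Int.sign ((p.1 : ℤ) + 1) = 1 := Int.sign_eq_one_of_pos (by omega)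
          have z2 : Int.sign ((p.2 : ℤ) + 1) = 1 := Int.sign_eq_one_of_pos (by omega)
          show ((s.1 * ((p.1 : ℤ) + 1)).sign, (s.2 * ((p.2 : ℤ) + 1)).sign) = s
          rw [Int.sign_mul, Int.sign_mul, z1, z2]
          rcases s with ⟨s1, s2⟩
          rcases hs' with ⟨h | h, h' | h'⟩ <;> simp only at h h' <;> subst h <;> subst h' <;> rfl
      · show ((s.1 * ((p.1 : ℤ) + 1)).natAbs - 1, (s.2 * ((p.2 : ℤ) + 1)).natAbs - 1) = p
        rw [Int.natAbs_mul, Int.natAbs_mul]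
        have z1 : s.1.natAbs = 1 := by rcases hs'.1 with h | h <;> rw [h] <;> rfl
        have z2 : s.2.natAbs = 1 := by rcases hs'.2 with h | h <;> rw [h] <;> rfl
        rw [z1, z2]
        ext <;> simp <;> omega
  · intro γ _ h
    obtain ⟨na, nd⟩ := nz γ h.1
    rcases lt_or_gt_of_ne na with h1 | h1 <;> rcases lt_or_gt_of_ne nd with h2 | h2 <;>
      simp [Int.sign_eq_one_of_pos, Int.sign_eq_neg_one_of_neg, h1, h2]

/-- Reduction of `SL(2,ℤ)` modulo `q`. -/
def redMod (q : ℕ) : SL2Z →* Matrix.SpecialLinearGroup (Fin 2) (ZMod q) :=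
  Matrix.SpecialLinearGroup.map (Int.castRingHom (ZMod q))

theorem redMod_apply (q : ℕ) (γ : SL2Z) (i j : Fin 2) : redMod q γ i j = ((γ i j : ℤ) : ZMod q) := rfl

theorem cast_eq_iff_dvd {q : ℕ} {x y : ℤ} : (x : ZMod q) = y ↔ (q : ℤ) ∣ x - y := by
  rw [eq_comm, ZMod.intCast_eq_intCast_iff_dvd_sub]

theorem redMod_eq_iff {q : ℕ} {γ g : SL2Z} : redMod q γ = redMod q g ↔
    (q : ℤ) ∣ γ 0 0 - g 0 0 ∧ (q : ℤ) ∣ γ 0 1 - g 0 1 ∧ (q : ℤ) ∣ γ 1 0 - g 1 0 ∧ (q : ℤ) ∣ γ 1 1 - g 1 1 := by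
  simp only [← cast_eq_iff_dvd]
  constructor
  · intro h
    simp only [← redMod_apply, h, and_self]
  · rintro ⟨h1, h2, h3, h4⟩
    ext i j
    rw [redMod_apply, redMod_apply]
    fin_cases i <;> fin_cases j <;> assumption

open Classical in
/-- Residues of the diagonal entries of the matrices congruent to `g` modulo `q` with given
lower left entry `c`. -/
def diagResidues (m q : ℕ) [NeZero (m * q)] (c : ℤ) (g : SL2Z) : Finset (ZMod (m * q) × ZMod (m * q)) :=
  Finset.univ.filter fun v => v.1 * v.2 - 1 = (c : ZMod (m * q)) * (g 0 1 : ℤ) ∧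
    ZMod.castHom (Dvd.intro_left m rfl : q ∣ m * q) (ZMod q) v.1 = (g 0 0 : ℤ) ∧
    ZMod.castHom (Dvd.intro_left m rfl : q ∣ m * q) (ZMod q) v.2 = (g 1 1 : ℤ)

theorem intCast_mem_diagResidues {m q : ℕ} [NeZero (m * q)] {c : ℤ} {g : SL2Z} {a d : ℤ} :
    ((a : ZMod (m * q)), (d : ZMod (m * q))) ∈ diagResidues m q c g ↔
      ((m * q : ℕ) : ℤ) ∣ a * d - 1 - c * g 0 1 ∧ (q : ℤ) ∣ a - g 0 0 ∧ (q : ℤ) ∣ d - g 1 1 := by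
  unfold diagResidues
  simp only [Finset.mem_filter, Finset.mem_univ, true_and, map_intCast, cast_eq_iff_dvd]
  rw [← cast_eq_iff_dvd (q := m * q) (x := a * d - 1)]
  push_cast
  rfl

theorem card_diagResidues_T_mul {m q : ℕ} [NeZero (m * q)] {c : ℤ} {g : SL2Z} (hm : (m : ℤ) ∣ c)
    (hc : (q : ℤ) ∣ c - g 1 0) :
    (diagResidues m q c (ModularGroup.T * g)).card = (diagResidues m q c g).card := by
  have t00 : (ModularGroup.T * g) 0 0 = g 0 0 + g 1 0 := by
    rw [SL2Z.mul_00]; simp [ModularGroup.T]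
  have t01 : (ModularGroup.T * g) 0 1 = g 0 1 + g 1 1 := by
    rw [SL2Z.mul_01]; simp [ModularGroup.T]
  have t11 : (ModularGroup.T * g) 1 1 = g 1 1 := by
    rw [SL2Z.mul_11]; simp [ModularGroup.T]
  symm
  have key : ∀ a d : ℤ, (((a : ZMod (m * q)), (d : ZMod (m * q))) ∈ diagResidues m q c g ↔
      (((a + c : ℤ) : ZMod (m * q)), (d : ZMod (m * q))) ∈ diagResidues m q c (ModularGroup.T * g)) := by
    intro a d
    rw [intCast_mem_diagResidues, intCast_mem_diagResidues, t00, t01, t11]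
    by_cases hd : (q : ℤ) ∣ d - g 1 1
    · have e1 : ((m * q : ℕ) : ℤ) ∣ c * (d - g 1 1) := by
        push_cast; exact mul_dvd_mul hm hd
      have e2 : (a + c) * d - 1 - c * (g 0 1 + g 1 1) = (a * d - 1 - c * g 0 1) + c * (d - g 1 1) := by ring
      have e3 : a + c - (g 0 0 + g 1 0) = (a - g 0 0) + (c - g 1 0) := by ring
      rw [e2, e3, dvd_add_left e1, dvd_add_left hc]
    · simp only [hd, and_false]
  refine Finset.card_nbij' (fun v => (v.1 + (c : ZMod (m * q)), v.2)) (fun v => (v.1 - (c : ZMod (m * q)), v.2)) ?_ ?_ ?_ ?_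
  · rintro ⟨α, β⟩ h
    obtain ⟨a, rfl⟩ := ZMod.intCast_surjective α
    obtain ⟨d, rfl⟩ := ZMod.intCast_surjective β
    have := (key a d).1 h
    push_cast at this
    exact this
  · rintro ⟨α, β⟩ h
    obtain ⟨a, rfl⟩ := ZMod.intCast_surjective α
    obtain ⟨d, rfl⟩ := ZMod.intCast_surjective β
    have := (key (a - c) d).2 (by rw [sub_add_cancel]; exact h)
    push_cast at this
    exact this
  · rintro ⟨α, β⟩ _; simp
  · rintro ⟨α, β⟩ _; simp

theorem redMod_eq_iff_of_lowerLeft {m n q : ℕ} [NeZero (m * q)] {c : ℤ} {γ g : SL2Z} (hc0 : c ≠ 0)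
    (hcmn : c.natAbs = m * n) (hn : n.Coprime (m * q)) (hcg : (q : ℤ) ∣ c - g 1 0) (hγ : γ 1 0 = c) :
    redMod q γ = redMod q g ↔
      ((γ 0 0 : ZMod (m * q)), (γ 1 1 : ZMod (m * q))) ∈ diagResidues m q c g ∧
        (n : ℤ) ∣ γ 0 0 * γ 1 1 - 1 := by
  rw [redMod_eq_iff, intCast_mem_diagResidues]
  have hd := γ.det_eq
  rw [hγ] at hd ⊢
  have hmc : (m : ℤ) ∣ c := Int.natCast_dvd.2 (hcmn ▸ Dvd.intro _ rfl)
  have hnc : (n : ℤ) ∣ c := Int.natCast_dvd.2 (hcmn ▸ Dvd.intro_left _ rfl)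
  constructor
  · rintro ⟨h1, h2, h3, h4⟩
    refine ⟨⟨?_, h1, h4⟩, ?_⟩
    · have : γ 0 0 * γ 1 1 - 1 - c * g 0 1 = c * (γ 0 1 - g 0 1) := by linear_combination hd
      rw [this]; push_cast; exact mul_dvd_mul hmc h2
    · have : γ 0 0 * γ 1 1 - 1 = γ 0 1 * c := by linear_combination hd
      rw [this]; exact Dvd.dvd.mul_left hnc _
  · rintro ⟨⟨h1, h2, h3⟩, h4⟩
    refine ⟨h2, ?_, hcg, h3⟩
    have e : γ 0 0 * γ 1 1 - 1 - c * g 0 1 = c * (γ 0 1 - g 0 1) := by linear_combination hd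
    have h5 : (n : ℤ) ∣ γ 0 0 * γ 1 1 - 1 - c * g 0 1 := dvd_sub h4 (Dvd.dvd.mul_right hnc _)
    have h6 : (n : ℤ) * ((m * q : ℕ) : ℤ) ∣ γ 0 0 * γ 1 1 - 1 - c * g 0 1 :=
      (Nat.isCoprime_iff_coprime.2 hn).mul_dvd h5 h1
    rw [e] at h6
    have h7 : (c.natAbs : ℤ) * q ∣ c * (γ 0 1 - g 0 1) := by
      rw [hcmn]; push_cast at h6 ⊢
      rwa [mul_assoc, mul_left_comm]
    have h8 : c * q ∣ c * (γ 0 1 - g 0 1) := by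
      refine dvd_trans ?_ h7
      exact mul_dvd_mul (Int.dvd_natAbs.2 dvd_rfl) dvd_rfl
    exact (mul_dvd_mul_iff_left hc0).1 h8

theorem dvd_of_mem_diagResidues {m n q : ℕ} [NeZero (m * q)] {c : ℤ} {g : SL2Z} {a d : ℤ}
    (hcmn : c.natAbs = m * n) (hn : n.Coprime (m * q))
    (h : ((a : ZMod (m * q)), (d : ZMod (m * q))) ∈ diagResidues m q c g ∧ (n : ℤ) ∣ a * d - 1) :
    c ∣ a * d - 1 := by
  rw [intCast_mem_diagResidues] at h
  obtain ⟨⟨h1, _, _⟩, h4⟩ := h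
  have hmc : (m : ℤ) ∣ c := Int.natCast_dvd.2 (hcmn ▸ Dvd.intro _ rfl)
  have h5 : (m : ℤ) ∣ a * d - 1 - c * g 0 1 := dvd_trans (by push_cast; exact Dvd.intro _ rfl) h1
  have h6 : (m : ℤ) ∣ a * d - 1 := by
    have := dvd_add h5 (Dvd.dvd.mul_right hmc (g 0 1))
    simpa using this
  have : (m : ℤ) * n ∣ a * d - 1 :=
    (Nat.isCoprime_iff_coprime.2 (Nat.Coprime.coprime_mul_right_right hn).symm).mul_dvd h6 h4
  rw [← Int.natAbs_dvd, hcmn]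
  exact_mod_cast this

/-- The region of a quadrant cut out by the norm bound is down-closed. -/
theorem quadrant_region_anti {s : ℤ} (hs : s = 1 ∨ s = -1) {c : ℤ} {B : ℝ} {p p' : ℕ × ℕ} (h : p ≤ p')
    (hp' : (p'.1 + 1 : ℝ) ^ 2 + ((s : ℝ) * ((p'.1 + 1) * (p'.2 + 1)) - 1) ^ 2 / c ^ 2 + c ^ 2 + (p'.2 + 1) ^ 2 ≤ B) :
    (p.1 + 1 : ℝ) ^ 2 + ((s : ℝ) * ((p.1 + 1) * (p.2 + 1)) - 1) ^ 2 / c ^ 2 + c ^ 2 + (p.2 + 1) ^ 2 ≤ B := by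
  have h1 : (p.1 : ℝ) ≤ p'.1 := by exact_mod_cast h.1
  have h2 : (p.2 : ℝ) ≤ p'.2 := by exact_mod_cast h.2
  have h3 : (p.1 + 1 : ℝ) * (p.2 + 1) ≤ (p'.1 + 1) * (p'.2 + 1) := by gcongr
  have h4 : (1 : ℝ) ≤ (p.1 + 1) * (p.2 + 1) := by
    have : (0 : ℝ) ≤ p.1 := Nat.cast_nonneg _
    have : (0 : ℝ) ≤ p.2 := Nat.cast_nonneg _
    nlinarith
  refine le_trans ?_ hp'
  have h5 : ((s : ℝ) * ((p.1 + 1) * (p.2 + 1)) - 1) ^ 2 ≤ ((s : ℝ) * ((p'.1 + 1) * (p'.2 + 1)) - 1) ^ 2 := by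
    rcases hs with rfl | rfl
    · push_cast; nlinarith
    · push_cast; nlinarith
  gcongr

theorem exists_cnt_lowerLeft_sub_le : ∃ C : ℝ, 1 ≤ C ∧ ∀ (m n q N H : ℕ) (T : ℝ) (c : ℤ) (g : SL2Z),
    1 ≤ m * q → 2 ≤ |c| → c.natAbs = m * n → n.Coprime (m * q) → 0 < H → H ≤ m * q * n → 0 ≤ T →
    T ≤ N * H →
    |(cnt T (fun γ => γ 1 0 = c ∧ redMod q γ = redMod q g) : ℝ) -
      cnt T (fun γ => γ 1 0 = c ∧ redMod q γ = redMod q (ModularGroup.T * g))| ≤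
    4 * (N ^ 2 * (2 * (C * (m * q) ^ 2 * (n : ℝ) ^ (11 / 12 : ℝ))) +
      2 * N * ((H : ℝ) ^ 2 / n + C * (m * q) ^ 2 * (n : ℝ) ^ (11 / 12 : ℝ))) := by
  obtain ⟨C, hC1, hC⟩ := exists_boxCount_bound
  refine ⟨C, hC1, ?_⟩
  intro m n q N H T c g hmq hc hcmn hn hH hHle hT hTN
  have : NeZero (m * q) := ⟨by omega⟩
  have hc0 : c ≠ 0 := by rintro rfl; simp at hc
  have hn0 : n ≠ 0 := by rintro rfl; simp at hcmn; exact hc0 hcmn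
  have : NeZero n := ⟨hn0⟩
  by_cases hcg : (q : ℤ) ∣ c - g 1 0
  swap
  · have z : ∀ g' : SL2Z, g' 1 0 = g 1 0 → cnt T (fun γ => γ 1 0 = c ∧ redMod q γ = redMod q g') = 0 := by
      intro g' hg'
      classical
      rw [cnt_eq_card, Finset.card_eq_zero, Finset.filter_eq_empty_iff]
      rintro γ _ ⟨h1, h2⟩
      rw [redMod_eq_iff, h1, hg'] at h2
      exact hcg h2.2.2.1
    rw [z g rfl, z (ModularGroup.T * g) (by rw [SL2Z.mul_10]; simp [ModularGroup.T])]
    simp only [Nat.cast_zero, sub_self, abs_zero]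
    positivity
  have hcg' : (q : ℤ) ∣ c - (ModularGroup.T * g) 1 0 := by
    rw [SL2Z.mul_10]; simpa [ModularGroup.T] using hcg
  have hmc : (m : ℤ) ∣ c := Int.natCast_dvd.2 (hcmn ▸ Dvd.intro _ rfl)
  have hTM : T ≤ ((N * H : ℕ) : ℝ) := by push_cast; exact hTN
  have expand : ∀ g' : SL2Z, (q : ℤ) ∣ c - g' 1 0 → _ := fun g' hg' =>
    cnt_eq_sum_quadrants hT hc (fun γ => redMod q γ = redMod q g')
      (fun a d => ((a : ZMod (m * q)), (d : ZMod (m * q))) ∈ diagResidues m q c g' ∧ (n : ℤ) ∣ a * d - 1)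
      (fun γ hγ => redMod_eq_iff_of_lowerLeft hc0 hcmn hn hg' hγ)
      (fun a d h => dvd_of_mem_diagResidues hcmn hn h) hTM
  rw [expand g hcg, expand _ hcg']
  push_cast
  rw [← Finset.sum_sub_distrib]
  refine (Finset.abs_sum_le_sum_abs _ _).trans ?_
  set V := diagResidues m q c g
  set V' := diagResidues m q c (ModularGroup.T * g)
  have hVV : V'.card = V.card := card_diagResidues_T_mul hmc hcg
  have hVw : (V.card : ℝ) ≤ (m * q : ℝ) ^ 2 := by
    have : V.card ≤ (m * q) ^ 2 := by
      refine (Finset.card_le_univ V).trans ?_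
      rw [Fintype.card_prod, ZMod.card, sq]
    exact_mod_cast this
  have hnpos : (0 : ℝ) < n := by exact_mod_cast Nat.pos_of_ne_zero hn0
  have hwpos : (0 : ℝ) < m * q := by exact_mod_cast hmq
  set X : ℝ := (n : ℝ) ^ (11 / 12 : ℝ)
  have hX : 0 ≤ X := by positivity
  have main : (V.card : ℝ) * (n.totient * (H : ℝ) ^ 2 / ((n : ℝ) ^ 2 * ((m * q : ℕ) : ℝ) ^ 2)) ≤ (H : ℝ) ^ 2 / n := by
    have ht : (n.totient : ℝ) ≤ n := by exact_mod_cast Nat.totient_le n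
    push_cast
    calc _ ≤ (m * q : ℝ) ^ 2 * (n * (H : ℝ) ^ 2 / ((n : ℝ) ^ 2 * (m * q : ℝ) ^ 2)) := by gcongr
      _ = _ := by
        have hm' : (m : ℝ) ≠ 0 := left_ne_zero_of_mul hwpos.ne'
        have hq' : (q : ℝ) ≠ 0 := right_ne_zero_of_mul hwpos.ne'
        field_simp
  have bV : ∀ x₀ y₀, |(boxCount n (m * q) V x₀ y₀ H : ℝ) - V.card * (n.totient * (H : ℝ) ^ 2 / ((n : ℝ) ^ 2 * ((m * q : ℕ) : ℝ) ^ 2))| ≤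
      C * (m * q) ^ 2 * X := by
    intro x₀ y₀
    refine (hC n (m * q) V x₀ y₀ H hn hHle).trans ?_
    gcongr
  have bV' : ∀ x₀ y₀, |(boxCount n (m * q) V' x₀ y₀ H : ℝ) - V.card * (n.totient * (H : ℝ) ^ 2 / ((n : ℝ) ^ 2 * ((m * q : ℕ) : ℝ) ^ 2))| ≤
      C * (m * q) ^ 2 * X := by
    intro x₀ y₀
    have := hC n (m * q) V' x₀ y₀ H hn hHle
    rw [hVV] at this
    refine this.trans ?_
    gcongr
  refine (Finset.sum_le_card_nsmul _ _ (N ^ 2 * (2 * (C * (m * q) ^ 2 * X)) +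
      2 * N * ((H : ℝ) ^ 2 / n + C * (m * q) ^ 2 * X)) ?_).trans ?_
  · intro s hs
    have hs' : (s.1 = 1 ∨ s.1 = -1) ∧ (s.2 = 1 ∨ s.2 = -1) := by
      simp only [Finset.mem_insert, Finset.mem_singleton] at hs
      rcases hs with rfl | rfl | rfl | rfl <;> simp
    have hss : s.1 * s.2 = 1 ∨ s.1 * s.2 = -1 := by
      rcases hs' with ⟨h | h, h' | h'⟩ <;> rw [h, h'] <;> simp
    classical
    choose x y e using fun i j => card_signed_box (n := n) V hs'.1 hs'.2 H i j
    choose x' y' e' using fun i j => card_signed_box (n := n) V' hs'.1 hs'.2 H i j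
    have := abs_card_sub_card_le_of_boxes (N := N) hH
      (fun p => ((p.1 + 1 : ℝ) ^ 2 + ((s.1 * s.2 : ℤ) * ((p.1 + 1) * (p.2 + 1)) - 1) ^ 2 / c ^ 2 + c ^ 2 + (p.2 + 1) ^ 2 ≤ T ^ 2))
      (fun p => (((s.1 * (p.1 + 1) : ℤ) : ZMod (m * q)), ((s.2 * (p.2 + 1) : ℤ) : ZMod (m * q))) ∈ V ∧
        (n : ℤ) ∣ (s.1 * (p.1 + 1)) * (s.2 * (p.2 + 1)) - 1)
      (fun p => (((s.1 * (p.1 + 1) : ℤ) : ZMod (m * q)), ((s.2 * (p.2 + 1) : ℤ) : ZMod (m * q))) ∈ V' ∧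
        (n : ℤ) ∣ (s.1 * (p.1 + 1)) * (s.2 * (p.2 + 1)) - 1)
      (fun p p' hpp h => quadrant_region_anti hss hpp h)
      (2 * (C * (m * q) ^ 2 * X)) ((H : ℝ) ^ 2 / n + C * (m * q) ^ 2 * X) 
      (fun i j => boxCount n (m * q) V (x i j) (y i j) H)
      (fun i j => boxCount n (m * q) V' (x' i j) (y' i j) H)
      (fun i j => by rw [← e]; congr) (fun i j => by rw [← e']; congr) ?_ ?_ ?_
    · push_cast at this
      convert this using 4
    · intro i j
      have h1 := abs_le.1 (bV (x i j) (y i j))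
      have h2 := abs_le.1 (bV' (x' i j) (y' i j))
      rw [abs_le]; constructor <;> linarith
    · intro i j
      have h1 := abs_le.1 (bV (x i j) (y i j))
      linarith
    · intro i j
      have h1 := abs_le.1 (bV' (x' i j) (y' i j))
      linarith
  · rw [show ({(1, 1), (1, -1), (-1, 1), (-1, -1)} : Finset (ℤ × ℤ)).card = 4 by decide, nsmul_eq_mul]
    norm_num

theorem card_multiples_intBall_le {T : ℝ} (hT : 0 ≤ T) {k : ℕ} (hk : k ≠ 0) :
    ((((intBall T).erase 0).filter (fun c : ℤ => k ∣ c.natAbs)).card : ℝ) ≤ 2 * T / k := by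
  have h0 : (0 : ℤ) ∈ (intBall T).filter (fun c : ℤ => k ∣ c.natAbs) := by
    simp [mem_intBall, hT]
  have h1 := card_le_of_modEq (T := T) (c := k) (by exact_mod_cast hk) hT
    ((intBall T).filter (fun c : ℤ => k ∣ c.natAbs))
    (fun x hx => by simpa [mem_intBall] using (Finset.mem_filter.1 hx).1)
    (fun x hx y hy => by
      have h1 := Int.natCast_dvd.2 (Finset.mem_filter.1 hx).2
      have h2 := Int.natCast_dvd.2 (Finset.mem_filter.1 hy).2
      exact dvd_sub h1 h2)
  rw [Finset.filter_erase, Finset.card_erase_of_mem h0, Nat.cast_sub (Finset.card_pos.2 ⟨_, h0⟩)]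
  have : |((k : ℤ) : ℝ)| = k := by simp
  rw [this] at h1
  push_cast
  linarith

/-- The part of `c` composed of primes dividing `q`, provided no prime divisor of `q` divides `c`
to a large power. -/
theorem coprime_div_gcd_pow {q K c : ℕ} (hq : q ≠ 0) 
    (h : ¬ ∃ p ∈ q.primeFactors, p ^ (K + 1) ∣ c) :
    (c / c.gcd (q ^ K)).Coprime (c.gcd (q ^ K) * q) := by
  have main : (c / c.gcd (q ^ K)).Coprime q := by
    rw [Nat.coprime_iff_gcd_eq_one]
    by_contra hne
    obtain ⟨p, hp, hpd⟩ := Nat.exists_prime_and_dvd hne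
    have h1 := hpd.trans (Nat.gcd_dvd_left _ _)
    have h2 := hpd.trans (Nat.gcd_dvd_right _ _)
    have hk : ¬ p ^ (K + 1) ∣ c := fun hh => h ⟨p, Nat.mem_primeFactors.2 ⟨hp, h2, hq⟩, hh⟩
    have hg : p * c.gcd (q ^ K) ∣ c := by
      have := mul_dvd_mul_right h1 (c.gcd (q ^ K))
      rwa [Nat.div_mul_cancel (Nat.gcd_dvd_left c (q ^ K))] at this
    have key : ∀ e ≤ K + 1, p ^ e ∣ c := by
      intro e
      induction e with
      | zero => simp
      | succ e ih =>
        intro he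
        have i1 : p ^ e ∣ c.gcd (q ^ K) :=
          Nat.dvd_gcd (ih (by omega)) ((pow_dvd_pow p (by omega)).trans (pow_dvd_pow_of_dvd h2 K))
        rw [pow_succ']
        exact (mul_dvd_mul_left p i1).trans hg
    exact hk (key _ le_rfl)
  exact Nat.Coprime.mul_right
    ((main.pow_right K).coprime_dvd_right (Nat.gcd_dvd_right _ _)) main

theorem exists_good_lowerLeft_bound (q K : ℕ) (hq : q ≠ 0) : ∃ A : ℝ, 0 ≤ A ∧ ∀ (δ η T : ℝ) (c : ℤ) (g : SL2Z),
    0 < η → η ≤ δ → η ≤ 1 → 1 ≤ η * T → 1 ≤ T → 2 ≤ |c| → δ * T ≤ |(c : ℝ)| → |(c : ℝ)| ≤ T →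
    (¬ ∃ p ∈ q.primeFactors, p ^ (K + 1) ∣ c.natAbs) →
    |(cnt T (fun γ => γ 1 0 = c ∧ redMod q γ = redMod q g) : ℝ) -
      cnt T (fun γ => γ 1 0 = c ∧ redMod q γ = redMod q (ModularGroup.T * g))| ≤
      (72 / η ^ 2 + 24 / η) * A * T ^ (11 / 12 : ℝ) + 24 * η / δ * (q : ℝ) ^ K * T := by
  obtain ⟨C, hC1, hC⟩ := exists_cnt_lowerLeft_sub_le
  refine ⟨C * ((q : ℝ) ^ K * q) ^ 2, by positivity, ?_⟩
  intro δ η T c g hη hηδ hη1 hηT hT hc hcδ hcT hgood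
  have hδ : 0 < δ := by linarith
  set m := c.natAbs.gcd (q ^ K) with hm
  set n := c.natAbs / m with hn
  have hc0 : c ≠ 0 := by rintro rfl; simp at hc
  have hcn0 : c.natAbs ≠ 0 := by simpa using hc0
  have hmpos : 0 < m := Nat.gcd_pos_of_pos_left _ (Nat.pos_of_ne_zero hcn0)
  have hcmn : c.natAbs = m * n := (Nat.mul_div_cancel' (Nat.gcd_dvd_left _ _)).symm
  have hqpos : 0 < q := Nat.pos_of_ne_zero hq
  have hmM : (m : ℝ) ≤ (q : ℝ) ^ K := by exact_mod_cast Nat.gcd_le_right _ (by positivity)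
  have hcabs : |(c : ℝ)| = m * n := by
    have : ((c.natAbs : ℕ) : ℝ) = |(c : ℝ)| := by rw [Nat.cast_natAbs]; simp
    rw [← this, hcmn]; push_cast; rfl
  have hn0 : n ≠ 0 := by intro h; rw [h] at hcmn; simp at hcmn; exact hc0 hcmn
  have hnpos : (0 : ℝ) < n := by exact_mod_cast Nat.pos_of_ne_zero hn0
  have hm1 : (1 : ℝ) ≤ m := by exact_mod_cast hmpos
  have hq1 : (1 : ℝ) ≤ q := by exact_mod_cast hqpos
  set H := ⌊η * T⌋₊ with hH
  have hHpos : 0 < H := Nat.floor_pos.2 hηT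
  have hH1 : (H : ℝ) ≤ η * T := Nat.floor_le (by linarith)
  have hH2 : η * T / 2 ≤ H := by
    have h1 := Nat.lt_floor_add_one (η * T)
    have h2 : (1 : ℝ) ≤ H := by exact_mod_cast hHpos
    change η * T < H + 1 at h1
    linarith
  have hHr : (0 : ℝ) < H := by exact_mod_cast hHpos
  set N := ⌊T / H⌋₊ + 1 with hN
  have hN1 : T ≤ N * H := by
    have := Nat.lt_floor_add_one (T / H)
    rw [div_lt_iff₀ hHr] at this
    rw [hN]; push_cast; linarith
  have hN2 : (N : ℝ) ≤ 3 / η := by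
    have h1 : ((⌊T / H⌋₊ : ℕ) : ℝ) ≤ T / H := Nat.floor_le (by positivity)
    have h2 : T / H ≤ 2 / η := by
      rw [div_le_div_iff₀ hHr hη]; linarith
    have h3 : 1 ≤ 1 / η := by rw [le_div_iff₀ hη]; linarith
    rw [hN]; push_cast
    have : 3 / η = 2 / η + 1 / η := by ring
    linarith
  have hHle : H ≤ m * q * n := by
    have : (H : ℝ) ≤ m * q * n := by
      calc (H : ℝ) ≤ η * T := hH1
        _ ≤ δ * T := by gcongr
        _ ≤ m * n := by rw [← hcabs]; exact hcδ
        _ ≤ m * q * n := by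
          have : (0 : ℝ) ≤ m * n := by positivity
          nlinarith
    exact_mod_cast this
  refine (hC m n q N H T c g (Nat.mul_pos hmpos hqpos) hc hcmn (coprime_div_gcd_pow hq hgood) hHpos hHle
    (by linarith) hN1).trans ?_
  have hX : C * (m * q : ℝ) ^ 2 * (n : ℝ) ^ (11 / 12 : ℝ) ≤ C * ((q : ℝ) ^ K * q) ^ 2 * T ^ (11 / 12 : ℝ) := by
    have : (n : ℝ) ≤ T := by
      refine le_trans ?_ hcT
      rw [hcabs]; nlinarith
    gcongr
  have hH2n : (H : ℝ) ^ 2 / n ≤ η ^ 2 / δ * (q : ℝ) ^ K * T := by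
    rw [div_le_iff₀ hnpos]
    have e1 : δ * T ≤ (q : ℝ) ^ K * n := by
      refine hcδ.trans ?_
      rw [hcabs]; gcongr
    calc (H : ℝ) ^ 2 ≤ (η * T) ^ 2 := by gcongr
      _ = η ^ 2 / δ * T * (δ * T) := by field_simp
      _ ≤ η ^ 2 / δ * T * ((q : ℝ) ^ K * n) := by gcongr
      _ = _ := by ring
  set A := C * ((q : ℝ) ^ K * q) ^ 2 * T ^ (11 / 12 : ℝ)
  have hA : 0 ≤ A := by positivity
  calc _ ≤ 4 * ((3 / η) ^ 2 * (2 * A) + 2 * (3 / η) * (η ^ 2 / δ * (q : ℝ) ^ K * T + A)) := by gcongr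
    _ = (72 / η ^ 2 + 24 / η) * A + 24 * η / δ * (q : ℝ) ^ K * T := by
      field_simp; ring
    _ = _ := by ring

theorem abs_sub_le_of_le_le {a b c : ℝ} (ha : 0 ≤ a) (hb : 0 ≤ b) (hac : a ≤ c) (hbc : b ≤ c) : |a - b| ≤ c := by
  rw [abs_le]; constructor <;> linarith

theorem cnt_lowerLeft_gt_eq_sum (T Y : ℝ) (P : SL2Z → Prop) :
    cnt T (fun γ => P γ ∧ ¬ |(γ 1 0 : ℝ)| ≤ Y) =
      ∑ c ∈ (intBall T).filter (fun c : ℤ => Y < |(c : ℝ)|), cnt T (fun γ => γ 1 0 = c ∧ P γ) := by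
  rw [cnt_eq_sum (fun γ => γ 1 0) ((intBall T).filter (fun c : ℤ => Y < |(c : ℝ)|))]
  · refine Finset.sum_congr rfl fun c hc => cnt_congr fun γ _ => ?_
    rw [Finset.mem_filter] at hc
    constructor
    · rintro ⟨⟨h1, _⟩, h2⟩; exact ⟨h2, h1⟩
    · rintro ⟨h1, h2⟩; refine ⟨⟨h2, ?_⟩, h1⟩; rw [h1]; exact not_le.2 hc.2
  · rintro γ hγ ⟨_, h⟩
    exact Finset.mem_filter.2 ⟨mem_intBall.2 (abs_entry_le hγ 1 0), not_le.1 h⟩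

theorem card_bad_le {T : ℝ} (hT : 0 ≤ T) (q K : ℕ) :
    ((((intBall T).erase 0).filter (fun c : ℤ => ∃ p ∈ q.primeFactors, p ^ (K + 1) ∣ c.natAbs)).card : ℝ) ≤
      q / 2 ^ K * T := by
  have sub : (((intBall T).erase 0).filter (fun c : ℤ => ∃ p ∈ q.primeFactors, p ^ (K + 1) ∣ c.natAbs)) ⊆
      q.primeFactors.biUnion fun p => ((intBall T).erase 0).filter (fun c : ℤ => p ^ (K + 1) ∣ c.natAbs) := by
    intro c hc
    simp only [Finset.mem_filter, Finset.mem_biUnion] at hc ⊢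
    obtain ⟨h1, p, hp, h2⟩ := hc
    exact ⟨p, hp, h1, h2⟩
  calc _ ≤ ∑ p ∈ q.primeFactors, ((((intBall T).erase 0).filter (fun c : ℤ => p ^ (K + 1) ∣ c.natAbs)).card : ℝ) := by
        exact_mod_cast (Finset.card_le_card sub).trans Finset.card_biUnion_le
    _ ≤ ∑ p ∈ q.primeFactors, T / 2 ^ K := by
        refine Finset.sum_le_sum fun p hp => ?_
        have hp' := Nat.prime_of_mem_primeFactors hp
        refine (card_multiples_intBall_le hT (pow_ne_zero _ hp'.ne_zero)).trans ?_
        have : (2 : ℝ) ≤ p := by exact_mod_cast hp'.two_le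
        push_cast
        calc 2 * T / (p : ℝ) ^ (K + 1) ≤ 2 * T / 2 ^ (K + 1) := by gcongr
          _ = _ := by rw [pow_succ]; field_simp
    _ = q.primeFactors.card * (T / 2 ^ K) := by rw [Finset.sum_const, nsmul_eq_mul]
    _ ≤ q * (T / 2 ^ K) := by
        have : (q.primeFactors.card : ℝ) ≤ q := by
          have : q.primeFactors ⊆ Finset.Icc 1 q := fun p hp =>
            Finset.mem_Icc.2 ⟨(Nat.prime_of_mem_primeFactors hp).one_le, Nat.le_of_mem_primeFactors hp⟩
          have := Finset.card_le_card this
          rw [Nat.card_Icc] at this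
          exact_mod_cast this
        gcongr
    _ = _ := by ring

/-- Left translation by `T` does not change the asymptotic proportion of a residue class. -/
theorem eventually_abs_cnt_sub_T_mul_le (q : ℕ) (hq : q ≠ 0) (g : SL2Z) {ε : ℝ} (hε : 0 < ε) :
    ∀ᶠ T : ℝ in atTop, |(cnt T (fun γ => redMod q γ = redMod q g) : ℝ) -
      cnt T (fun γ => redMod q γ = redMod q (ModularGroup.T * g))| ≤ ε * T ^ 2 := by
  obtain ⟨δ, hδ0, hδ1, hδ⟩ : ∃ δ : ℝ, 0 < δ ∧ δ ≤ 1 ∧ 76 * δ ^ (3 / 4 : ℝ) ≤ ε / 4 := by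
    refine ⟨min 1 ((ε / 304) ^ (4 / 3 : ℝ)), by positivity, min_le_left _ _, ?_⟩
    have : (min 1 ((ε / 304) ^ (4 / 3 : ℝ))) ^ (3 / 4 : ℝ) ≤ ((ε / 304) ^ (4 / 3 : ℝ)) ^ (3 / 4 : ℝ) := by
      gcongr; exact min_le_right _ _
    rw [← Real.rpow_mul (by positivity)] at this
    norm_num at this
    linarith
  obtain ⟨K, hK⟩ : ∃ K : ℕ, 9 * q / δ / 2 ^ K ≤ ε / 4 := by
    have : Tendsto (fun K : ℕ => 9 * (q : ℝ) / δ * (1 / 2) ^ K) atTop (𝓝 (9 * q / δ * 0)) :=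
      (tendsto_pow_atTop_nhds_zero_of_lt_one (by norm_num) (by norm_num)).const_mul _
    rw [mul_zero] at this
    obtain ⟨K, hK⟩ := (this.eventually (gt_mem_nhds (by positivity : 0 < ε / 4))).exists
    refine ⟨K, le_trans (le_of_eq ?_) hK.le⟩
    rw [one_div, inv_pow]; rfl
  obtain ⟨A, hA0, hA⟩ := exists_good_lowerLeft_bound q K hq
  have hqK : (0 : ℝ) < (q : ℝ) ^ K := by
    have : (0 : ℝ) < q := by exact_mod_cast Nat.pos_of_ne_zero hq
    positivity
  obtain ⟨η, hη0, hηδ, hη⟩ : ∃ η : ℝ, 0 < η ∧ η ≤ δ ∧ 72 * η / δ * (q : ℝ) ^ K ≤ ε / 4 := by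
    refine ⟨min δ (ε * δ / (288 * (q : ℝ) ^ K)), by positivity, min_le_left _ _, ?_⟩
    calc _ ≤ 72 * (ε * δ / (288 * (q : ℝ) ^ K)) / δ * (q : ℝ) ^ K := by gcongr; exact min_le_right _ _
      _ = _ := by field_simp; norm_num
  have hlim : Tendsto (fun T : ℝ => 3 * ((72 / η ^ 2 + 24 / η) * A) * T ^ (-(1 / 12) : ℝ)) atTop (𝓝 0) := by
    rw [show (0 : ℝ) = 3 * ((72 / η ^ 2 + 24 / η) * A) * 0 by ring]
    exact (tendsto_rpow_neg_atTop (by norm_num)).const_mul _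
  filter_upwards [hlim.eventually (gt_mem_nhds (by positivity : 0 < ε / 4)), eventually_ge_atTop 1,
    eventually_ge_atTop (1 / η), eventually_ge_atTop (2 / δ)] with T hT4 hT1 hTη hTδ
  have hT0 : 0 < T := by linarith
  have hηT : 1 ≤ η * T := by rwa [div_le_iff₀' hη0] at hTη
  have hδT : 2 ≤ δ * T := by rwa [div_le_iff₀' hδ0] at hTδ
  set P := fun γ => redMod q γ = redMod q g with hP
  set P' := fun γ => redMod q γ = redMod q (ModularGroup.T * g) with hP'
  set Y := δ * T with hY
  have split : ∀ Q : SL2Z → Prop, (cnt T Q : ℝ) = cnt T (fun γ => Q γ ∧ |(γ 1 0 : ℝ)| ≤ Y) +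
      ∑ c ∈ (intBall T).filter (fun c : ℤ => Y < |(c : ℝ)|), (cnt T (fun γ => γ 1 0 = c ∧ Q γ) : ℝ) := by
    intro Q
    rw [← cnt_and_add_cnt_and_not T Q (fun γ => |(γ 1 0 : ℝ)| ≤ Y), cnt_lowerLeft_gt_eq_sum]
    push_cast; rfl
  have small : ∀ Q : SL2Z → Prop, (cnt T (fun γ => Q γ ∧ |(γ 1 0 : ℝ)| ≤ Y) : ℝ) ≤ ε / 4 * T ^ 2 := by
    intro Q
    have h1 : (cnt T (fun γ => Q γ ∧ |(γ 1 0 : ℝ)| ≤ Y) : ℝ) ≤ cnt T (fun γ => |(γ 1 0 : ℝ)| ≤ Y) := by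
      exact_mod_cast cnt_mono fun γ _ (h : Q γ ∧ _) => h.2
    refine h1.trans ((cnt_small_lowerLeft_le (by linarith) (by rw [hY]; nlinarith)).trans ?_)
    rw [hY, Real.mul_rpow hδ0.le hT0.le]
    calc 76 * T ^ (5 / 4 : ℝ) * (δ ^ (3 / 4 : ℝ) * T ^ (3 / 4 : ℝ)) =
        76 * δ ^ (3 / 4 : ℝ) * (T ^ (5 / 4 : ℝ) * T ^ (3 / 4 : ℝ)) := by ring
      _ = 76 * δ ^ (3 / 4 : ℝ) * T ^ 2 := by rw [← Real.rpow_add hT0]; norm_num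
      _ ≤ _ := by gcongr
  classical
  set G := (72 / η ^ 2 + 24 / η) * A * T ^ (11 / 12 : ℝ) + 24 * η / δ * (q : ℝ) ^ K * T with hG
  set bad := fun c : ℤ => ∃ p ∈ q.primeFactors, p ^ (K + 1) ∣ c.natAbs with hbad
  set S := (intBall T).filter (fun c : ℤ => Y < |(c : ℝ)|) with hS
  have hSmem : ∀ c ∈ S, c ≠ 0 ∧ 2 ≤ |c| ∧ Y ≤ |(c : ℝ)| ∧ |(c : ℝ)| ≤ T := by
    intro c hc
    rw [hS, Finset.mem_filter, mem_intBall] at hc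
    have : (2 : ℝ) ≤ |(c : ℝ)| := by linarith [hc.2]
    have : 2 ≤ |c| := by exact_mod_cast this
    refine ⟨by rintro rfl; simp at this, this, hc.2.le, hc.1⟩
  have term : ∀ c ∈ S, |(cnt T (fun γ => γ 1 0 = c ∧ P γ) : ℝ) - cnt T (fun γ => γ 1 0 = c ∧ P' γ)| ≤
      |G| + if bad c then 9 / δ * T else 0 := by
    intro c hc
    obtain ⟨hc0, hc2, hcY, hcT⟩ := hSmem c hc
    by_cases hb : bad c
    · rw [if_pos hb]
      have hle : ∀ Q : SL2Z → Prop, (cnt T (fun γ => γ 1 0 = c ∧ Q γ) : ℝ) ≤ 9 / δ * T := by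
        intro Q
        have h1 : (cnt T (fun γ => γ 1 0 = c ∧ Q γ) : ℝ) ≤ cnt T (fun γ => γ 1 0 = c) := by
          exact_mod_cast cnt_mono fun γ _ (h : γ 1 0 = c ∧ Q γ) => h.1
        refine h1.trans ((cnt_lowerLeft_le hT1 hc0 hcT).trans ?_)
        rw [div_le_iff₀ (by linarith)]
        calc 9 * T ^ 2 = 9 / δ * T * (δ * T) := by field_simp
          _ ≤ _ := by gcongr
      have := abs_sub_le_of_le_le (Nat.cast_nonneg _) (Nat.cast_nonneg _) (hle P) (hle P')
      linarith [abs_nonneg G]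
    · rw [if_neg hb, add_zero]
      exact (hA δ η T c g hη0 hηδ (by linarith) hηT hT1 hc2 hcY hcT hb).trans (le_abs_self _)
  have hScard : (S.card : ℝ) ≤ 3 * T := by
    have : (S.card : ℝ) ≤ (intBall T).card := by exact_mod_cast Finset.card_filter_le _ _
    linarith [card_intBall_le hT0.le]
  have hbadcard : ((S.filter bad).card : ℝ) ≤ q / 2 ^ K * T := by
    refine le_trans ?_ (card_bad_le hT0.le q K)
    norm_cast
    refine Finset.card_le_card fun c hc => ?_
    rw [Finset.mem_filter] at hc
    rw [Finset.mem_filter, Finset.mem_erase]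
    exact ⟨⟨(hSmem c hc.1).1, (Finset.mem_filter.1 hc.1).1⟩, hc.2⟩
  have big : |∑ c ∈ S, (cnt T (fun γ => γ 1 0 = c ∧ P γ) : ℝ) - ∑ c ∈ S, (cnt T (fun γ => γ 1 0 = c ∧ P' γ) : ℝ)| ≤
      3 * T * |G| + (q / 2 ^ K * T) * (9 / δ * T) := by
    rw [← Finset.sum_sub_distrib]
    refine (Finset.abs_sum_le_sum_abs _ _).trans ((Finset.sum_le_sum term).trans ?_)
    rw [Finset.sum_add_distrib, ← Finset.sum_filter, Finset.sum_const, Finset.sum_const, nsmul_eq_mul, nsmul_eq_mul]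
    gcongr
  have hTT : T * T ^ (11 / 12 : ℝ) = T ^ (-(1 / 12) : ℝ) * T ^ 2 := by
    rw [← Real.rpow_one_add' hT0.le (by norm_num), ← Real.rpow_natCast T 2, ← Real.rpow_add hT0]
    norm_num
  have hG0 : 0 ≤ G := by positivity
  rw [abs_of_nonneg hG0] at big
  have e1 : 3 * T * G = 3 * ((72 / η ^ 2 + 24 / η) * A) * T ^ (-(1 / 12) : ℝ) * T ^ 2 +
      72 * η / δ * (q : ℝ) ^ K * T ^ 2 := by
    rw [hG]
    linear_combination 3 * ((72 / η ^ 2 + 24 / η) * A) * hTT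
  have e2 : (q / 2 ^ K * T) * (9 / δ * T) = 9 * q / δ / 2 ^ K * T ^ 2 := by field_simp
  have f1 : 3 * ((72 / η ^ 2 + 24 / η) * A) * T ^ (-(1 / 12) : ℝ) * T ^ 2 ≤ ε / 4 * T ^ 2 := by gcongr
  have f2 : 72 * η / δ * (q : ℝ) ^ K * T ^ 2 ≤ ε / 4 * T ^ 2 := by gcongr
  have f3 : 9 * q / δ / 2 ^ K * T ^ 2 ≤ ε / 4 * T ^ 2 := by gcongr
  have f4 := abs_sub_le_of_le_le (Nat.cast_nonneg _) (Nat.cast_nonneg _) (small P) (small P')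
  rw [split P, split P', add_sub_add_comm]
  refine (abs_add_le _ _).trans ?_
  linarith

theorem S_mul_entries (γ : SL2Z) : (ModularGroup.S * γ) 0 0 = - γ 1 0 ∧ (ModularGroup.S * γ) 0 1 = - γ 1 1 ∧
    (ModularGroup.S * γ) 1 0 = γ 0 0 ∧ (ModularGroup.S * γ) 1 1 = γ 0 1 := by
  rw [SL2Z.mul_00, SL2Z.mul_01, SL2Z.mul_10, SL2Z.mul_11]
  simp [ModularGroup.S]

theorem frobNorm_S_mul (γ : SL2Z) : frobNorm (ModularGroup.S * γ) = frobNorm γ := by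
  obtain ⟨h1, h2, h3, h4⟩ := S_mul_entries γ
  unfold frobNorm
  rw [h1, h2, h3, h4]
  congr 2
  ring

theorem cnt_S_mul (T : ℝ) (Q : SL2Z → Prop) : cnt T (fun γ => Q (ModularGroup.S * γ)) = cnt T Q := by
  classical
  rw [cnt_eq_card, cnt_eq_card]
  refine Finset.card_nbij' (fun γ => ModularGroup.S * γ) (fun γ => ModularGroup.S⁻¹ * γ) ?_ ?_ ?_ ?_
  · intro γ hγ
    simpa [frobNorm_S_mul] using hγ
  · intro γ hγ
    have : frobNorm (ModularGroup.S⁻¹ * γ) = frobNorm γ := by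
      rw [← frobNorm_S_mul (ModularGroup.S⁻¹ * γ), mul_inv_cancel_left]
    simp only [Finset.coe_filter, mem_ball, Set.mem_ofPred_eq] at hγ ⊢
    rw [this, mul_inv_cancel_left]
    exact hγ
  · intro γ _; simp
  · intro γ _; simp

/-- Two residue classes have the same asymptotic proportion. -/
def SameDensity (q : ℕ) (g g' : SL2Z) : Prop :=
  (fun T : ℝ => (cnt T (fun γ => redMod q γ = redMod q g) : ℝ) - cnt T (fun γ => redMod q γ = redMod q g'))
    =o[atTop] (fun T : ℝ => T ^ 2)

theorem SameDensity.symm {q : ℕ} {g g' : SL2Z} (h : SameDensity q g g') : SameDensity q g' g := by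
  unfold SameDensity at *
  simpa using h.neg_left

theorem SameDensity.trans {q : ℕ} {g g' g'' : SL2Z} (h : SameDensity q g g') (h' : SameDensity q g' g'') :
    SameDensity q g g'' := by
  unfold SameDensity at *
  simpa using h.add h'

/-- All residue classes in the image of `SL(2,ℤ)` have the same asymptotic proportion. -/
theorem sameDensity (q : ℕ) (hq : q ≠ 0) (g g' : SL2Z) : SameDensity q g g' := by
  let G : Subgroup SL2Z :=
    { carrier := {h | ∀ g, SameDensity q g (h * g)}
      one_mem' := fun g => by simp [SameDensity]
      mul_mem' := fun {a b} ha hb g => by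
        rw [mul_assoc]; exact (hb g).trans (ha (b * g))
      inv_mem' := fun {a} ha g => by
        have := ha (a⁻¹ * g)
        rw [mul_inv_cancel_left] at this
        exact this.symm }
  have hG : G = ⊤ := by
    rw [eq_top_iff, ← SpecialLinearGroup.SL2Z_generators, Subgroup.closure_le]
    rintro h (rfl | rfl)
    · intro g
      have : ∀ T : ℝ, cnt T (fun γ => redMod q γ = redMod q g) =
          cnt T (fun γ => redMod q γ = redMod q (ModularGroup.S * g)) := by
        intro T
        rw [← cnt_S_mul T (fun γ => redMod q γ = redMod q (ModularGroup.S * g))]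
        refine cnt_congr fun γ _ => ?_
        rw [map_mul, map_mul]
        exact (mul_right_inj _).symm
      simp [SameDensity, this]
    · intro g
      refine Asymptotics.isLittleO_iff.2 fun ε hε => ?_
      filter_upwards [eventually_abs_cnt_sub_T_mul_le q hq g hε] with T hT
      rwa [Real.norm_eq_abs, Real.norm_eq_abs, abs_of_nonneg (sq_nonneg T)]
  have : g' * g⁻¹ ∈ G := hG ▸ Subgroup.mem_top _
  have := this g
  rwa [inv_mul_cancel_right] at this

/-- The proportion of elements of the ball of radius `T` satisfying `P`. -/
def prop (T : ℝ) (P : SL2Z → Prop) : ℝ := (cnt T P : ℝ) / cnt T (fun _ => True)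

theorem prop_nonneg (T : ℝ) (P : SL2Z → Prop) : 0 ≤ prop T P := by unfold prop; positivity

theorem prop_le_one (T : ℝ) (P : SL2Z → Prop) : prop T P ≤ 1 := by
  unfold prop
  refine div_le_one_of_le₀ ?_ (by positivity)
  exact_mod_cast cnt_mono fun _ _ _ => trivial

theorem prop_mono {T : ℝ} {P Q : SL2Z → Prop} (h : ∀ γ, P γ → Q γ) : prop T P ≤ prop T Q := by
  unfold prop
  have : (cnt T P : ℝ) ≤ cnt T Q := by exact_mod_cast cnt_mono fun γ _ => h γ
  gcongr

theorem prop_congr {T : ℝ} {P Q : SL2Z → Prop} (h : ∀ γ, P γ ↔ Q γ) : prop T P = prop T Q :=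
  le_antisymm (prop_mono fun γ => (h γ).1) (prop_mono fun γ => (h γ).2)

theorem prop_or_le (T : ℝ) (P Q : SL2Z → Prop) : prop T (fun γ => P γ ∨ Q γ) ≤ prop T P + prop T Q := by
  unfold prop
  rw [← add_div]
  have : (cnt T (fun γ => P γ ∨ Q γ) : ℝ) ≤ cnt T P + cnt T Q := by exact_mod_cast cnt_or_le T P Q
  gcongr

theorem prop_and_add (T : ℝ) (P Q : SL2Z → Prop) :
    prop T (fun γ => P γ ∧ Q γ) + prop T (fun γ => P γ ∧ ¬ Q γ) = prop T P := by
  unfold prop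
  rw [← add_div]
  congr 1
  exact_mod_cast cnt_and_add_cnt_and_not T P Q

theorem prop_le_of_cnt_le {T : ℝ} (hT : 4 ≤ T) {P : SL2Z → Prop} {B : ℝ} (h : (cnt T P : ℝ) ≤ B * T ^ 2) :
    prop T P ≤ 64 * B := by
  have h1 := cnt_ge_sq hT
  have hT2 : 0 < T ^ 2 := by positivity
  unfold prop
  have hB : 0 ≤ B := by
    by_contra hB
    have : (0 : ℝ) ≤ cnt T P := Nat.cast_nonneg _
    nlinarith
  rw [div_le_iff₀ (by linarith)]
  nlinarith

theorem prop_true {T : ℝ} (hT : 4 ≤ T) : prop T (fun _ => True) = 1 := by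
  have h1 := cnt_ge_sq hT
  have hT2 : 0 < T ^ 2 := by positivity
  exact div_self (by linarith)

/-- The number of residue classes modulo `q`. -/
def numClasses (q : ℕ) : ℕ := Nat.card (Set.range (redMod q))

theorem finite_SL_ZMod (q : ℕ) (hq : q ≠ 0) : Finite (Matrix.SpecialLinearGroup (Fin 2) (ZMod q)) := by
  have : NeZero q := ⟨hq⟩
  infer_instance

theorem numClasses_pos (q : ℕ) (hq : q ≠ 0) : 0 < numClasses q := by
  have := finite_SL_ZMod q hq
  exact Nat.card_pos

open Classical in
theorem prop_eq_sum {T : ℝ} (q : ℕ) (P : SL2Z → Prop) (s : Finset (Matrix.SpecialLinearGroup (Fin 2) (ZMod q)))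
    (hs : ∀ γ, P γ → redMod q γ ∈ s) :
    prop T P = ∑ x ∈ s, prop T (fun γ => P γ ∧ redMod q γ = x) := by
  unfold prop
  rw [← Finset.sum_div]
  congr 1
  rw [cnt_eq_sum (redMod q) s (fun γ _ h => hs γ h)]
  push_cast
  rfl

theorem tendsto_prop_class (q : ℕ) (hq : q ≠ 0) (g : SL2Z) :
    Tendsto (fun T : ℝ => prop T (fun γ => redMod q γ = redMod q g)) atTop (𝓝 (1 / numClasses q)) := by
  classical
  have := finite_SL_ZMod q hq
  have := Fintype.ofFinite (Matrix.SpecialLinearGroup (Fin 2) (ZMod q))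
  set R : Finset (Matrix.SpecialLinearGroup (Fin 2) (ZMod q)) := Finset.univ.filter (fun x => x ∈ Set.range (redMod q)) with hR
  have hRcard : R.card = numClasses q := by
    unfold numClasses
    rw [Nat.card_eq_fintype_card, hR, Fintype.card_subtype]
  have h1 : (fun T : ℝ => ∑ x ∈ R, ((cnt T (fun γ => redMod q γ = redMod q g) : ℝ) - cnt T (fun γ => redMod q γ = x)))
      =o[atTop] (fun T : ℝ => T ^ 2) := by
    refine Asymptotics.IsLittleO.fun_sum (s := R) (g' := fun T : ℝ => T ^ 2)
      (A := fun x T => (cnt T (fun γ => redMod q γ = redMod q g) : ℝ) - cnt T (fun γ => redMod q γ = x))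
      fun x hx => ?_
    obtain ⟨g', rfl⟩ := (Finset.mem_filter.1 hx).2
    exact sameDensity q hq g g'
  have h2 : ∀ T : ℝ, ∑ x ∈ R, ((cnt T (fun γ => redMod q γ = redMod q g) : ℝ) - cnt T (fun γ => redMod q γ = x)) =
      numClasses q * cnt T (fun γ => redMod q γ = redMod q g) - cnt T (fun _ => True) := by
    intro T
    rw [Finset.sum_sub_distrib, Finset.sum_const, nsmul_eq_mul, hRcard,
      cnt_eq_sum (P := fun _ => True) (redMod q) R (fun γ _ _ => Finset.mem_filter.2 ⟨Finset.mem_univ _, γ, rfl⟩)]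
    push_cast
    simp only [true_and]
  simp only [h2] at h1
  have hk : (0 : ℝ) < numClasses q := by exact_mod_cast numClasses_pos q hq
  rw [Metric.tendsto_atTop']
  intro ε hε
  have h3 := Asymptotics.isLittleO_iff.1 h1 (show 0 < ε * numClasses q / 128 by positivity)
  obtain ⟨T₀, hT₀⟩ := eventually_atTop.1 h3
  refine ⟨max T₀ 4, fun T hT => ?_⟩
  have hT4 : 4 ≤ T := (le_max_right _ _).trans hT.le
  have h4 := hT₀ T ((le_max_left _ _).trans hT.le)
  rw [Real.norm_eq_abs, Real.norm_eq_abs, abs_of_nonneg (sq_nonneg T)] at h4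
  have h5 := cnt_ge_sq hT4
  have hT2 : 0 < T ^ 2 := by positivity
  have h6 : (0 : ℝ) < cnt T (fun _ => True) := by linarith
  rw [Real.dist_eq]
  unfold prop
  rw [div_sub_div _ _ h6.ne' hk.ne', abs_div, abs_of_pos (mul_pos h6 hk), div_lt_iff₀ (mul_pos h6 hk)]
  calc _ = |(numClasses q : ℝ) * cnt T (fun γ => redMod q γ = redMod q g) - cnt T (fun _ => True)| := by
        congr 1; ring
    _ ≤ ε * numClasses q / 128 * T ^ 2 := h4
    _ < ε * numClasses q / 64 * T ^ 2 := by
        have : 0 < ε * numClasses q * T ^ 2 := by positivity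
        linarith
    _ = ε * (T ^ 2 / 64 * numClasses q) := by ring
    _ ≤ _ := by gcongr

/-- `C` depends only on the reduction modulo `q`. -/
def ModInvariant (q : ℕ) (C : SL2Z → Prop) : Prop := ∀ γ γ', redMod q γ = redMod q γ' → C γ → C γ'

/-- A condition modulo `q` has an asymptotic proportion, invariant under left translations. -/
theorem ModInvariant.exists_tendsto {q : ℕ} (hq : q ≠ 0) {C : SL2Z → Prop} (hC : ModInvariant q C) :
    ∃ L : ℝ, ∀ h : SL2Z, Tendsto (fun T : ℝ => prop T (fun γ => C (h * γ))) atTop (𝓝 L) := by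
  classical
  have := finite_SL_ZMod q hq
  have := Fintype.ofFinite (Matrix.SpecialLinearGroup (Fin 2) (ZMod q))
  let s : SL2Z → Finset (Matrix.SpecialLinearGroup (Fin 2) (ZMod q)) := fun h =>
    Finset.univ.filter (fun x => ∃ γ, redMod q γ = x ∧ C (h * γ))
  have hinv : ∀ h γ γ', redMod q γ = redMod q γ' → C (h * γ) → C (h * γ') := fun h γ γ' e =>
    hC _ _ (by rw [map_mul, map_mul, e])
  have hs : ∀ h, (s h).card = (s 1).card := by
    intro h
    refine Finset.card_nbij' (fun x => redMod q h * x) (fun x => redMod q h⁻¹ * x) ?_ ?_ ?_ ?_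
    · intro x hx
      simp only [s, Finset.coe_filter, Finset.mem_univ, true_and, Set.mem_ofPred_eq] at hx ⊢
      obtain ⟨γ, rfl, h2⟩ := hx
      exact ⟨h * γ, map_mul _ _ _, by rwa [one_mul]⟩
    · intro x hx
      simp only [s, Finset.coe_filter, Finset.mem_univ, true_and, Set.mem_ofPred_eq] at hx ⊢
      obtain ⟨γ, rfl, h2⟩ := hx
      exact ⟨h⁻¹ * γ, map_mul _ _ _, by rwa [mul_inv_cancel_left, ← one_mul γ]⟩
    · intro x _; simp
    · intro x _; simp
  refine ⟨(s 1).card * (1 / numClasses q), fun h => ?_⟩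
  have key : ∀ T : ℝ, prop T (fun γ => C (h * γ)) = ∑ x ∈ s h, prop T (fun γ => redMod q γ = x) := by
    intro T
    rw [prop_eq_sum q _ (s h) (fun γ hγ => Finset.mem_filter.2 ⟨Finset.mem_univ _, γ, rfl, hγ⟩)]
    refine Finset.sum_congr rfl fun x hx => prop_congr fun γ => ?_
    obtain ⟨γ', h1, h2⟩ := (Finset.mem_filter.1 hx).2
    constructor
    · rintro ⟨_, h3⟩; exact h3
    · intro h3; exact ⟨hinv h γ' γ (h1.trans h3.symm) h2, h3⟩
  simp only [key]
  rw [← hs h, ← nsmul_eq_mul, ← Finset.sum_const]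
  refine tendsto_finsetSum _ fun x hx => ?_
  obtain ⟨g, h1, _⟩ := (Finset.mem_filter.1 hx).2
  rw [← h1]
  exact tendsto_prop_class q hq g

theorem redMod_eq_of_dvd {q q' : ℕ} (h : q ∣ q') {γ γ' : SL2Z} (e : redMod q' γ = redMod q' γ') :
    redMod q γ = redMod q γ' := by
  rw [redMod_eq_iff] at e ⊢
  have : (q : ℤ) ∣ q' := by exact_mod_cast h
  exact ⟨this.trans e.1, this.trans e.2.1, this.trans e.2.2.1, this.trans e.2.2.2⟩

theorem ModInvariant.of_dvd {q q' : ℕ} (h : q ∣ q') {C : SL2Z → Prop} (hC : ModInvariant q C) :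
    ModInvariant q' C := fun γ γ' e => hC γ γ' (redMod_eq_of_dvd h e)

theorem ModInvariant.and {q : ℕ} {C C' : SL2Z → Prop} (hC : ModInvariant q C) (hC' : ModInvariant q C') :
    ModInvariant q (fun γ => C γ ∧ C' γ) := fun γ γ' e h => ⟨hC γ γ' e h.1, hC' γ γ' e h.2⟩

theorem exists_mod_one_mod {M N : ℕ} (h : M.Coprime N) : ∃ j : ℤ, (M : ℤ) ∣ j - 1 ∧ (N : ℤ) ∣ j := by
  obtain ⟨u, v, huv⟩ := Nat.isCoprime_iff_coprime.2 h
  exact ⟨v * N, ⟨-u, by linear_combination huv⟩, ⟨v, by ring⟩⟩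

/-- The principal congruence subgroup of level `N` surjects onto the reductions modulo a coprime `M`. -/
theorem exists_redMod_eq {M N : ℕ} (h : M.Coprime N) (x : SL2Z) :
    ∃ y : SL2Z, redMod N y = 1 ∧ redMod M y = redMod M x := by
  let K : Subgroup SL2Z := ((redMod N).ker.map (redMod M)).comap (redMod M)
  obtain ⟨j, hj1, hj2⟩ := exists_mod_one_mod h
  have hone : redMod N 1 = 1 := map_one _
  have hT : ModularGroup.T ∈ K := by
    refine ⟨SL2Z.mk 1 j 0 1 (by ring), ?_, ?_⟩
    · show redMod N _ = 1
      rw [← hone, redMod_eq_iff]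
      simpa using hj2
    · rw [redMod_eq_iff]
      simpa [ModularGroup.T] using hj1
  have hL : SL2Z.mk 1 0 1 1 (by ring) ∈ K := by
    refine ⟨SL2Z.mk 1 0 j 1 (by ring), ?_, ?_⟩
    · show redMod N _ = 1
      rw [← hone, redMod_eq_iff]
      simpa using hj2
    · rw [redMod_eq_iff]
      simpa using hj1
  have hS : ModularGroup.S ∈ K := by
    have : ModularGroup.S = ModularGroup.T⁻¹ * SL2Z.mk 1 0 1 1 (by ring) * ModularGroup.T⁻¹ := by
      rw [eq_mul_inv_iff_mul_eq, eq_inv_mul_iff_mul_eq]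
      refine SL2Z.ext' ?_ ?_ ?_ ?_ <;>
        simp only [SL2Z.mul_00, SL2Z.mul_01, SL2Z.mul_10, SL2Z.mul_11] <;>
        simp [ModularGroup.S, ModularGroup.T]
    rw [this]
    exact K.mul_mem (K.mul_mem (K.inv_mem hT) hL) (K.inv_mem hT)
  have hK : K = ⊤ := by
    rw [eq_top_iff, ← SpecialLinearGroup.SL2Z_generators, Subgroup.closure_le]
    rintro h (rfl | rfl)
    · exact hS
    · exact hT
  have : x ∈ K := hK ▸ Subgroup.mem_top x
  obtain ⟨y, hy1, hy2⟩ := this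
  exact ⟨y, hy1, hy2⟩

/-- Conditions to coprime moduli are independent. -/
theorem tendsto_prop_class_and {M N : ℕ} (hM : M ≠ 0) (hN : N ≠ 0) (hMN : M.Coprime N) (g : SL2Z)
    {B : SL2Z → Prop} (hB : ModInvariant N B) {β : ℝ} (hβ : Tendsto (fun T : ℝ => prop T B) atTop (𝓝 β)) :
    Tendsto (fun T : ℝ => prop T (fun γ => redMod M γ = redMod M g ∧ B γ)) atTop (𝓝 (β / numClasses M)) := by
  classical
  have hC : ModInvariant (M * N) (fun γ => redMod M γ = redMod M g ∧ B γ) :=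
    ModInvariant.and (ModInvariant.of_dvd (Dvd.intro _ rfl) fun γ γ' e h => e ▸ h)
      (hB.of_dvd (Dvd.intro_left _ rfl))
  obtain ⟨L, hL⟩ := hC.exists_tendsto (mul_ne_zero hM hN)
  have := finite_SL_ZMod M hM
  have := Fintype.ofFinite (Matrix.SpecialLinearGroup (Fin 2) (ZMod M))
  set R : Finset (Matrix.SpecialLinearGroup (Fin 2) (ZMod M)) := Finset.univ.filter (fun x => x ∈ Set.range (redMod M)) with hR
  have hRcard : R.card = numClasses M := by
    unfold numClasses
    rw [Nat.card_eq_fintype_card, hR, Fintype.card_subtype]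
  have h1 : Tendsto (fun T : ℝ => ∑ x ∈ R, prop T (fun γ => B γ ∧ redMod M γ = x)) atTop (𝓝 (∑ x ∈ R, L)) := by
    refine tendsto_finsetSum _ fun x hx => ?_
    obtain ⟨g', rfl⟩ := (Finset.mem_filter.1 hx).2
    obtain ⟨h, hh1, hh2⟩ := exists_redMod_eq hMN (g * g'⁻¹)
    refine (hL h).congr fun T => prop_congr fun γ => ?_
    have e1 : redMod M (h * γ) = redMod M g ↔ redMod M γ = redMod M g' := by
      rw [map_mul, hh2, map_mul, map_inv, mul_assoc, mul_eq_left, inv_mul_eq_one, eq_comm]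
    have e2 : B (h * γ) ↔ B γ := by
      have : redMod N (h * γ) = redMod N γ := by rw [map_mul, hh1, one_mul]
      exact ⟨hB _ _ this, hB _ _ this.symm⟩
    rw [e1, e2, and_comm]
  have h2 : ∀ T : ℝ, ∑ x ∈ R, prop T (fun γ => B γ ∧ redMod M γ = x) = prop T B := fun T =>
    (prop_eq_sum M B R (fun γ _ => Finset.mem_filter.2 ⟨Finset.mem_univ _, γ, rfl⟩)).symm
  simp only [h2] at h1
  have h3 := tendsto_nhds_unique h1 hβ
  rw [Finset.sum_const, hRcard, nsmul_eq_mul] at h3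
  have hk : (numClasses M : ℝ) ≠ 0 := by exact_mod_cast (numClasses_pos M hM).ne'
  have h4 : L = β / numClasses M := by rw [← h3]; field_simp
  rw [← h4]
  simpa using hL 1

theorem card_traceClasses_le (m q : ℕ) (hm : 0 < m) (hq : 0 < q) (t : ℤ) (V : Finset (ZMod (m * q) × ZMod (m * q)))
    (hV : ∀ v ∈ V, ∃ x y : ℤ, (x : ZMod (m * q)) = v.1 ∧ (y : ZMod (m * q)) = v.2 ∧ (m : ℤ) ∣ x * y - 1 ∧
      (q : ℤ) ∣ x + y - t) :
    V.card ≤ 3 * m.gcd q * (m * q) := by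
  classical
  have : NeZero (m * q) := ⟨(Nat.mul_pos hm hq).ne'⟩
  have key : ∀ α ∈ V.image Prod.fst, (V.filter (fun v => v.1 = α)).card ≤ 3 * m.gcd q := by
    intro α _
    have hinj : Set.InjOn (fun v : ZMod (m * q) × ZMod (m * q) => (v.2.val : ℤ)) (V.filter (fun v => v.1 = α)) := by
      intro v hv v' hv' h
      simp only [Finset.coe_filter, Set.mem_ofPred_eq] at hv hv'
      refine Prod.ext (hv.2.trans hv'.2.symm) (ZMod.val_injective _ ?_)
      exact_mod_cast (show (v.2.val : ℤ) = v'.2.val from h)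
    rw [← Finset.card_image_of_injOn hinj]
    have hl : 0 < m.lcm q := Nat.lcm_pos hm hq
    have := card_le_of_modEq (T := ((m * q : ℕ) : ℝ)) (c := ((m.lcm q : ℕ) : ℤ)) (by exact_mod_cast hl.ne')
      (Nat.cast_nonneg _)
      ((V.filter (fun v => v.1 = α)).image (fun v : ZMod (m * q) × ZMod (m * q) => (v.2.val : ℤ))) ?_ ?_
    · have e : ((m * q : ℕ) : ℝ) = m.gcd q * m.lcm q := by exact_mod_cast (Nat.gcd_mul_lcm m q).symm
      have hl' : (0 : ℝ) < m.lcm q := by exact_mod_cast hl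
      rw [e, Int.cast_natCast, abs_of_pos hl', ← mul_assoc, mul_div_cancel_right₀ _ hl'.ne'] at this
      have hg : (1 : ℝ) ≤ m.gcd q := by exact_mod_cast Nat.gcd_pos_of_pos_left q hm
      have : (_ : ℝ) ≤ 3 * m.gcd q := this.trans (by linarith)
      exact_mod_cast this
    · intro x hx
      obtain ⟨v, _, rfl⟩ := Finset.mem_image.1 hx
      rw [Int.cast_natCast, abs_of_nonneg (Nat.cast_nonneg _)]
      exact_mod_cast (ZMod.val_lt v.2).le
    · intro x hx x' hx'
      obtain ⟨v, hv, rfl⟩ := Finset.mem_image.1 hx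
      obtain ⟨v', hv', rfl⟩ := Finset.mem_image.1 hx'
      rw [Finset.mem_filter] at hv hv'
      obtain ⟨a, b, h1, h2, h3, h4⟩ := hV v hv.1
      obtain ⟨a', b', h1', h2', h3', h4'⟩ := hV v' hv'.1
      have ea : ((m * q : ℕ) : ℤ) ∣ a - a' := cast_eq_iff_dvd.1 (by rw [h1, h1', hv.2, hv'.2])
      have eb : ((m * q : ℕ) : ℤ) ∣ (v.2.val : ℤ) - b := cast_eq_iff_dvd.1 (by rw [h2]; simp)
      have eb' : ((m * q : ℕ) : ℤ) ∣ (v'.2.val : ℤ) - b' := cast_eq_iff_dvd.1 (by rw [h2']; simp)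
      have hmm : (m : ℤ) ∣ ((m * q : ℕ) : ℤ) := by push_cast; exact Dvd.intro _ rfl
      have hqq : (q : ℤ) ∣ ((m * q : ℕ) : ℤ) := by push_cast; exact Dvd.intro_left _ rfl
      have hd : ∀ z : ℤ, (m : ℤ) ∣ z → (q : ℤ) ∣ z → ((m.lcm q : ℕ) : ℤ) ∣ z := by
        intro z h h'
        rw [Int.natCast_dvd] at h h' ⊢
        exact Nat.lcm_dvd h h'
      have split : (v.2.val : ℤ) - v'.2.val = ((v.2.val : ℤ) - b) + (b - b') - ((v'.2.val : ℤ) - b') := by ring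
      rw [split]
      refine hd _ ?_ ?_
      · refine (((hmm.trans eb).add ?_)).sub (hmm.trans eb')
        have : b - b' = -(b - b') * (a * b - 1) + b * ((a * b - 1) - (a' * b' - 1)) - b * b' * (a - a') := by ring
        rw [this]
        exact ((h3.mul_left _).add ((h3.sub h3').mul_left _)).sub ((hmm.trans ea).mul_left _)
      · refine (((hqq.trans eb).add ?_)).sub (hqq.trans eb')
        have : b - b' = (a + b - t) - (a' + b' - t) - (a - a') := by ring
        rw [this]
        exact (h4.sub h4').sub (hqq.trans ea)
  calc V.card ≤ 3 * m.gcd q * (V.image Prod.fst).card := Finset.card_le_mul_card_image _ _ key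
    _ ≤ _ := by
      gcongr
      calc (V.image Prod.fst).card ≤ (Finset.univ : Finset (ZMod (m * q))).card := Finset.card_le_univ _
        _ = m * q := by rw [Finset.card_univ, ZMod.card]

/-- Matrices with a given lower left entry and a given trace modulo a prime power. -/
theorem exists_cnt_lowerLeft_trace_le : ∃ C : ℝ, 1 ≤ C ∧ ∀ (p j : ℕ) (t c : ℤ) (T : ℝ), p.Prime → 1 ≤ T →
    c ≠ 0 → |(c : ℝ)| ≤ T → 3 * T ≤ (p ^ j : ℕ) * |(c : ℝ)| → ¬ (p ^ j) ^ 2 ∣ c.natAbs →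
    (cnt T (fun γ => γ 1 0 = c ∧ ((p ^ j : ℕ) : ℤ) ∣ trZ γ - t) : ℝ) ≤
      27 * T ^ 2 * (c.natAbs.gcd (p ^ j) / ((p ^ j : ℕ) * c.natAbs)) + C * (p ^ j : ℕ) ^ 4 * T ^ (11 / 12 : ℝ) := by
  classical
  obtain ⟨C, hC1, hC⟩ := exists_boxCount_bound
  refine ⟨3 * C, by linarith, fun p j t c T hp hT hc hcT hcY hbad => ?_⟩
  have hT0 : 0 < T := by linarith
  obtain ⟨i, n, hpn, hcn⟩ := Nat.exists_eq_pow_mul_and_not_dvd (Int.natAbs_ne_zero.2 hc) p hp.one_lt.ne'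
  set q := p ^ j with hq
  set m := p ^ i with hm
  have hq0 : 0 < q := pow_pos hp.pos _
  have hm0 : 0 < m := pow_pos hp.pos _
  have hn0 : 0 < n := Nat.pos_of_ne_zero (by rintro rfl; simp at hpn)
  have hnp : n.Coprime p := ((Nat.Prime.coprime_iff_not_dvd hp).2 hpn).symm
  have hcop : n.Coprime (m * q) := by
    rw [hm, hq, ← pow_add]; exact hnp.pow_right _
  have hmq : m ≤ q ^ 2 := by
    by_contra hlt
    refine hbad ?_
    rw [hcn]
    refine Dvd.dvd.mul_right ?_ n
    rw [hq, hm, ← pow_mul] at hlt ⊢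
    exact pow_dvd_pow _ ((Nat.pow_lt_pow_iff_right hp.one_lt).1 (not_le.1 hlt)).le
  have hgcd : c.natAbs.gcd q = m.gcd q := by
    rw [hcn]; exact Nat.Coprime.gcd_mul_right_cancel m (hnp.pow_right j)
  have : NeZero n := ⟨hn0.ne'⟩
  have : NeZero (m * q) := ⟨(Nat.mul_pos hm0 hq0).ne'⟩
  have hcabs : |(c : ℝ)| = m * n := by
    have : ((c.natAbs : ℕ) : ℝ) = (m * n : ℕ) := by rw [hcn]
    rw [Nat.cast_natAbs] at this
    push_cast at this ⊢
    exact this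
  have hmc : (m : ℤ) ∣ c := by rw [Int.natCast_dvd, hcn]; exact Dvd.intro _ rfl
  have hnc : (n : ℤ) ∣ c := by rw [Int.natCast_dvd, hcn]; exact Dvd.intro_left _ rfl
  set V : Finset (ZMod (m * q) × ZMod (m * q)) := Finset.univ.filter (fun v => ∃ x y : ℤ, (x : ZMod (m * q)) = v.1 ∧
    (y : ZMod (m * q)) = v.2 ∧ (m : ℤ) ∣ x * y - 1 ∧ (q : ℤ) ∣ x + y - t) with hV
  have hVcard : (V.card : ℝ) ≤ 3 * m.gcd q * (m * q) := by
    exact_mod_cast card_traceClasses_le m q hm0 hq0 t V (fun v hv => (Finset.mem_filter.1 hv).2)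
  set L : ℕ := 2 * ⌊T⌋₊ + 1 with hL
  have hL3 : (L : ℝ) ≤ 3 * T := by
    have := Nat.floor_le hT0.le
    rw [hL]; push_cast; linarith
  have hfl : (⌊T⌋₊ : ℤ) = ⌊T⌋ := Int.natCast_floor_eq_floor hT0.le
  have hLw : L ≤ m * q * n := by
    have : (L : ℝ) ≤ m * q * n := by
      calc (L : ℝ) ≤ 3 * T := hL3
        _ ≤ q * (m * n) := by rw [← hcabs]; exact hcY
        _ = _ := by ring
    exact_mod_cast this
  have hbox := hC n (m * q) V (-⌊T⌋) (-⌊T⌋) L hcop hLw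
  have hle : cnt T (fun γ => γ 1 0 = c ∧ (q : ℤ) ∣ trZ γ - t) ≤ boxCount n (m * q) V (-⌊T⌋) (-⌊T⌋) L := by
    unfold boxCount
    refine cnt_le_card _ (fun γ => (γ 0 0, γ 1 1)) ?_ ?_
    · rintro γ hγ ⟨h1, h2⟩
      have hI : ∀ i j, γ i j ∈ Finset.Ico (-⌊T⌋) (-⌊T⌋ + L) := by
        intro i j
        have := mem_intBall.2 (abs_entry_le hγ i j)
        simp only [intBall, Finset.mem_Icc] at this
        rw [Finset.mem_Ico, hL]
        push_cast
        rw [hfl]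
        omega
      have hdet : γ 0 0 * γ 1 1 - 1 = γ 0 1 * c := by rw [← h1]; linear_combination SL2Z.det_eq γ
      simp only [Finset.mem_filter, Finset.mem_product, hV, Finset.mem_univ, true_and]
      exact ⟨⟨hI 0 0, hI 1 1⟩, ⟨γ 0 0, γ 1 1, rfl, rfl, hdet ▸ hmc.mul_left _, h2⟩, hdet ▸ hnc.mul_left _⟩
    · intro γ γ' _ h _ h' e
      simp only [Prod.mk.injEq] at e
      refine SL2Z.ext' e.1 ?_ (h.1.trans h'.1.symm) e.2
      have d1 := SL2Z.det_eq γ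
      have d2 := SL2Z.det_eq γ'
      rw [h.1] at d1
      rw [h'.1] at d2
      have : γ 0 1 * c = γ' 0 1 * c := by rw [e.1, e.2] at d1; linarith
      exact mul_right_cancel₀ hc this
  have hmr : (0 : ℝ) < m := by exact_mod_cast hm0
  have hqr : (0 : ℝ) < q := by exact_mod_cast hq0
  have hnr : (0 : ℝ) < n := by exact_mod_cast hn0
  have hqr1 : (1 : ℝ) ≤ q := by exact_mod_cast hq0
  have hmqr : (m : ℝ) ≤ q ^ 2 := by exact_mod_cast hmq
  have hgq : (m.gcd q : ℝ) ≤ q := by exact_mod_cast Nat.gcd_le_right m hq0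
  have main : (V.card : ℝ) * (n.totient * L ^ 2 / (n ^ 2 * ((m * q : ℕ) : ℝ) ^ 2)) ≤
      27 * T ^ 2 * (c.natAbs.gcd q / (q * c.natAbs)) := by
    have hφ : (n.totient : ℝ) ≤ n := by exact_mod_cast Nat.totient_le n
    rw [hgcd, hcn]
    push_cast
    calc _ ≤ (3 * m.gcd q * (m * q) : ℝ) * (n * (3 * T) ^ 2 / (n ^ 2 * (m * q) ^ 2)) := by gcongr
      _ = _ := by field_simp; ring
  have err : C * V.card * (n : ℝ) ^ (11 / 12 : ℝ) ≤ 3 * C * q ^ 4 * T ^ (11 / 12 : ℝ) := by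
    have hnT : (n : ℝ) ≤ T := by
      refine le_trans ?_ hcT
      rw [hcabs]
      have : (1 : ℝ) ≤ m := by exact_mod_cast hm0
      nlinarith
    calc _ ≤ C * (3 * q * (q ^ 2 * q)) * T ^ (11 / 12 : ℝ) := by
          gcongr
          exact hVcard.trans (by gcongr)
      _ = _ := by ring
  have hle' : (cnt T (fun γ => γ 1 0 = c ∧ (q : ℤ) ∣ trZ γ - t) : ℝ) ≤ boxCount n (m * q) V (-⌊T⌋) (-⌊T⌋) L := by
    exact_mod_cast hle
  linarith [(abs_le.1 hbox).2]

theorem sum_filter_dvd_rpow_neg_le {d : ℕ} (hd : 0 < d) (N : ℕ) {s : ℝ} (h0 : 0 ≤ s) (h1 : s < 1) :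
    ∑ k ∈ (Finset.Icc 1 N).filter (fun k => d ∣ k), (k : ℝ) ^ (-s) ≤ (N : ℝ) ^ (1 - s) / (1 - s) / d := by
  have hd' : (0 : ℝ) < d := by exact_mod_cast hd
  have sub : (Finset.Icc 1 N).filter (fun k => d ∣ k) ⊆ (Finset.Icc 1 (N / d)).image (fun l => d * l) := by
    intro k hk
    simp only [Finset.mem_filter, Finset.mem_Icc, Finset.mem_image] at hk ⊢
    obtain ⟨⟨h1, h2⟩, l, rfl⟩ := hk
    refine ⟨l, ⟨Nat.pos_of_ne_zero (by rintro rfl; simp at h1), ?_⟩, rfl⟩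
    rw [Nat.le_div_iff_mul_le hd]; linarith
  calc _ ≤ ∑ k ∈ (Finset.Icc 1 (N / d)).image (fun l => d * l), (k : ℝ) ^ (-s) :=
        Finset.sum_le_sum_of_subset_of_nonneg sub fun _ _ _ => by positivity
    _ = ∑ l ∈ Finset.Icc 1 (N / d), ((d * l : ℕ) : ℝ) ^ (-s) :=
        Finset.sum_image fun x _ y _ h => Nat.eq_of_mul_eq_mul_left hd h
    _ = (d : ℝ) ^ (-s) * ∑ l ∈ Finset.Icc 1 (N / d), (l : ℝ) ^ (-s) := by
        rw [Finset.mul_sum]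
        refine Finset.sum_congr rfl fun l _ => ?_
        push_cast
        rw [Real.mul_rpow hd'.le (Nat.cast_nonneg _)]
    _ ≤ (d : ℝ) ^ (-s) * (((N / d : ℕ) : ℝ) ^ (1 - s) / (1 - s)) := by
        gcongr; exact sum_rpow_neg_le h0 h1 _
    _ ≤ (d : ℝ) ^ (-s) * (((N : ℝ) / d) ^ (1 - s) / (1 - s)) := by
        have : 0 < 1 - s := by linarith
        gcongr
        exact Nat.cast_div_le
    _ = _ := by
        rw [Real.div_rpow (Nat.cast_nonneg _) hd'.le, div_div, div_div, mul_comm, div_mul_eq_mul_div]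
        have hh : (d : ℝ) = (d : ℝ) ^ (1 - s) * (d : ℝ) ^ s := by
          rw [← Real.rpow_add hd']; simp
        have : 0 < 1 - s := by linarith
        rw [Real.rpow_neg hd'.le]
        rw [div_eq_div_iff (by positivity) (by positivity)]
        nth_rewrite 2 [hh]
        field_simp

theorem sum_gcd_mul_rpow_le {T : ℝ} (hT : 1 ≤ T) {q : ℕ} (hq : q ≠ 0) :
    ∑ c ∈ (intBall T).erase 0, (c.natAbs.gcd q : ℝ) * (c.natAbs : ℝ) ^ (-(7 / 8) : ℝ) ≤
      16 * q.divisors.card * T ^ (1 / 8 : ℝ) := by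
  rw [sum_intBall_erase T (fun k => (k.gcd q : ℝ) * (k : ℝ) ^ (-(7 / 8) : ℝ))]
  have step : ∀ k ∈ Finset.Icc 1 ⌊T⌋₊, (k.gcd q : ℝ) * (k : ℝ) ^ (-(7 / 8) : ℝ) ≤
      ∑ d ∈ q.divisors, if d ∣ k then (d : ℝ) * (k : ℝ) ^ (-(7 / 8) : ℝ) else 0 := by
    intro k _
    have := Finset.single_le_sum (f := fun d : ℕ => if d ∣ k then (d : ℝ) * (k : ℝ) ^ (-(7 / 8) : ℝ) else 0)
      (s := q.divisors) (fun d _ => by positivity) (Nat.mem_divisors.2 ⟨Nat.gcd_dvd_right k q, hq⟩)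
    simpa [Nat.gcd_dvd_left] using this
  have hfl : (⌊T⌋₊ : ℝ) ≤ T := Nat.floor_le (by linarith)
  calc _ ≤ 2 * ∑ k ∈ Finset.Icc 1 ⌊T⌋₊, ∑ d ∈ q.divisors, if d ∣ k then (d : ℝ) * (k : ℝ) ^ (-(7 / 8) : ℝ) else 0 := by
        gcongr with k hk; exact step k hk
    _ = 2 * ∑ d ∈ q.divisors, (d : ℝ) * ∑ k ∈ (Finset.Icc 1 ⌊T⌋₊).filter (fun k => d ∣ k), (k : ℝ) ^ (-(7 / 8) : ℝ) := by
        rw [Finset.sum_comm]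
        congr 1
        refine Finset.sum_congr rfl fun d _ => ?_
        rw [← Finset.sum_filter, Finset.mul_sum]
    _ ≤ 2 * ∑ d ∈ q.divisors, 8 * T ^ (1 / 8 : ℝ) := by
        refine mul_le_mul_of_nonneg_left (Finset.sum_le_sum fun d hd => ?_) (by norm_num)
        have hd0 : 0 < d := Nat.pos_of_mem_divisors hd
        have hd' : (0 : ℝ) < d := by exact_mod_cast hd0
        calc _ ≤ (d : ℝ) * ((⌊T⌋₊ : ℝ) ^ (1 - 7 / 8 : ℝ) / (1 - 7 / 8) / d) := by
              gcongr; exact sum_filter_dvd_rpow_neg_le hd0 _ (by norm_num) (by norm_num)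
          _ = 8 * (⌊T⌋₊ : ℝ) ^ (1 / 8 : ℝ) := by
              rw [show (1 - 7 / 8 : ℝ) = 1 / 8 by norm_num]; field_simp
          _ ≤ _ := by gcongr
    _ = _ := by rw [Finset.sum_const, nsmul_eq_mul]; ring

/-- The trace of a matrix in a large ball is divisible by a given prime power with small proportion. -/
theorem exists_cnt_trace_le : ∃ C : ℝ, 1 ≤ C ∧ ∀ (p j : ℕ) (t : ℤ) (T : ℝ), p.Prime →
    ((p ^ j : ℕ) : ℝ) ^ 60 ≤ T →
    (cnt T (fun γ => ((p ^ j : ℕ) : ℤ) ∣ trZ γ - t) : ℝ) ≤ C * T ^ 2 * ((p ^ j : ℕ) : ℝ) ^ (-(3 / 4) : ℝ) := by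
  classical
  obtain ⟨C, hC1, hC⟩ := exists_cnt_lowerLeft_trace_le
  obtain ⟨D, hD1, hD⟩ := card_divisors_le_rpow (show (0 : ℝ) < 1 / 8 by norm_num)
  refine ⟨304 + 432 * D + 3 * C + 6, by linarith, fun p j t T hp hT60 => ?_⟩
  have hCj := fun c => hC p j t c T hp
  set q := p ^ j with hq
  have hq0 : 0 < q := pow_pos hp.pos _
  have hq1 : (1 : ℝ) ≤ q := by exact_mod_cast hq0
  have hqr : (0 : ℝ) < q := by linarith
  have hqT : (q : ℝ) ≤ T := (le_self_pow₀ hq1 (by norm_num)).trans hT60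
  have hT1 : 1 ≤ T := hq1.trans hqT
  have hT0 : 0 < T := by linarith
  set ρ := (q : ℝ) ^ (-(3 / 4) : ℝ) with hρ
  have hρ0 : 0 < ρ := by positivity
  have hρ1 : 1 / (q : ℝ) ≤ ρ := by
    rw [hρ, one_div, ← Real.rpow_neg_one]
    exact Real.rpow_le_rpow_of_exponent_le hq1 (by norm_num)
  have hρ2 : (q : ℝ) ^ 4 * T ^ (11 / 12 : ℝ) * T ≤ T ^ 2 * ρ := by
    have h5 : (q : ℝ) ^ 5 ≤ T ^ (1 / 12 : ℝ) := by
      calc (q : ℝ) ^ 5 = (((q : ℝ) ^ 60)) ^ (1 / 12 : ℝ) := by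
            rw [← Real.rpow_natCast, ← Real.rpow_natCast, ← Real.rpow_mul hqr.le]; norm_num
        _ ≤ _ := by gcongr
    have h6 : (q : ℝ) ^ 4 ≤ T ^ (1 / 12 : ℝ) * ρ := by
      calc (q : ℝ) ^ 4 = (q : ℝ) ^ 5 * (1 / q) := by field_simp
        _ ≤ _ := by gcongr
    calc _ ≤ T ^ (1 / 12 : ℝ) * ρ * T ^ (11 / 12 : ℝ) * T := by gcongr
      _ = (T ^ (1 / 12 : ℝ) * T ^ (11 / 12 : ℝ)) * T * ρ := by ring
      _ = T ^ 2 * ρ := by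
          rw [← Real.rpow_add hT0]; norm_num; left; ring
  have hρ3 : (q.divisors.card : ℝ) * (q : ℝ) ^ (1 / 8 : ℝ) / q ≤ D * ρ := by
    calc _ ≤ D * (q : ℝ) ^ (1 / 8 : ℝ) * (q : ℝ) ^ (1 / 8 : ℝ) / q := by gcongr; exact hD q hq0.ne'
      _ = D * ((q : ℝ) ^ (1 / 8 : ℝ) * (q : ℝ) ^ (1 / 8 : ℝ) * (q : ℝ) ^ (-1 : ℝ)) := by
          rw [Real.rpow_neg_one]; ring
      _ = D * ρ := by rw [← Real.rpow_add hqr, ← Real.rpow_add hqr, hρ]; norm_num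
  have hTρ : 0 < T ^ 2 * ρ := by positivity
  by_cases hq4 : q < 4
  · have h4 : 1 ≤ 4 * ρ := by
      have : (q : ℝ) ≤ 4 := by exact_mod_cast hq4.le
      have h1 : 1 / (4 : ℝ) ≤ 1 / q := by gcongr
      linarith
    have h0 := cnt_le_sq hT1 (fun γ => (q : ℤ) ∣ trZ γ - t)
    have h2 : T ^ 2 * 1 ≤ T ^ 2 * (4 * ρ) := by gcongr
    nlinarith
  have hq4r : (4 : ℝ) ≤ q := by exact_mod_cast not_lt.1 hq4
  set Y := 3 * T / q with hY
  have hY1 : 1 ≤ Y := by rw [hY, le_div_iff₀ hqr]; linarith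
  have hYT : Y ≤ T := by rw [hY, div_le_iff₀ hqr]; nlinarith
  have hY0 : 0 < Y := by linarith
  have small : (cnt T (fun γ => (q : ℤ) ∣ trZ γ - t ∧ |(γ 1 0 : ℝ)| ≤ Y) : ℝ) ≤ 228 * (T ^ 2 * ρ) := by
    have h1 : (cnt T (fun γ => (q : ℤ) ∣ trZ γ - t ∧ |(γ 1 0 : ℝ)| ≤ Y) : ℝ) ≤
        cnt T (fun γ => |(γ 1 0 : ℝ)| ≤ Y) := by
      exact_mod_cast cnt_mono fun γ _ (h : _ ∧ _) => h.2
    refine h1.trans ((cnt_small_lowerLeft_le hY1 hYT).trans ?_)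
    have h3 : (3 : ℝ) ^ (3 / 4 : ℝ) ≤ 3 := by
      calc (3 : ℝ) ^ (3 / 4 : ℝ) ≤ 3 ^ (1 : ℝ) := Real.rpow_le_rpow_of_exponent_le (by norm_num) (by norm_num)
        _ = 3 := Real.rpow_one 3
    have hTT : T ^ (5 / 4 : ℝ) * T ^ (3 / 4 : ℝ) = T ^ 2 := by rw [← Real.rpow_add hT0]; norm_num
    rw [hY, Real.div_rpow (by positivity) hqr.le, Real.mul_rpow (by norm_num) hT0.le]
    calc _ = 76 * 3 ^ (3 / 4 : ℝ) * (T ^ (5 / 4 : ℝ) * T ^ (3 / 4 : ℝ)) * ρ := by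
          rw [hρ, Real.rpow_neg hqr.le]; ring
      _ = 76 * 3 ^ (3 / 4 : ℝ) * T ^ 2 * ρ := by rw [hTT]
      _ ≤ 76 * 3 * T ^ 2 * ρ := by gcongr
      _ = _ := by ring
  set S := (intBall T).filter (fun c : ℤ => Y < |(c : ℝ)|) with hS
  have hSmem : ∀ c ∈ S, c ≠ 0 ∧ Y < |(c : ℝ)| ∧ |(c : ℝ)| ≤ T := by
    intro c hc
    rw [hS, Finset.mem_filter, mem_intBall] at hc
    refine ⟨?_, hc.2, hc.1⟩
    rintro rfl
    have := hc.2
    simp at this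
    linarith
  have hSsub : S ⊆ (intBall T).erase 0 := fun c hc =>
    Finset.mem_erase.2 ⟨(hSmem c hc).1, (Finset.mem_filter.1 hc).1⟩
  set E := 27 * T ^ 2 * ((q : ℝ) ^ (1 / 8 : ℝ) / q) * T ^ (-(1 / 8) : ℝ) with hE
  have term : ∀ c ∈ S, (cnt T (fun γ => γ 1 0 = c ∧ (q : ℤ) ∣ trZ γ - t) : ℝ) ≤
      E * ((c.natAbs.gcd q : ℝ) * (c.natAbs : ℝ) ^ (-(7 / 8) : ℝ)) + C * (q : ℝ) ^ 4 * T ^ (11 / 12 : ℝ) +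
        if q ^ 2 ∣ c.natAbs then 3 * T * q else 0 := by
    intro c hc
    obtain ⟨hc0, hcY, hcT⟩ := hSmem c hc
    have hcY' : 3 * T ≤ q * |(c : ℝ)| := by
      rw [hY, div_lt_iff₀ hqr] at hcY; linarith
    have hcpos : 0 < |(c : ℝ)| := by linarith
    have hcabs : (c.natAbs : ℝ) = |(c : ℝ)| := by rw [Nat.cast_natAbs]; push_cast; rfl
    by_cases hb : q ^ 2 ∣ c.natAbs
    · rw [if_pos hb]
      have h1 : (cnt T (fun γ => γ 1 0 = c ∧ (q : ℤ) ∣ trZ γ - t) : ℝ) ≤ cnt T (fun γ => γ 1 0 = c) := by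
        exact_mod_cast cnt_mono fun γ _ (h : _ ∧ _) => h.1
      have h2 : 9 * T ^ 2 / |(c : ℝ)| ≤ 3 * T * q := by
        rw [div_le_iff₀ hcpos]; nlinarith
      have h3 : 0 ≤ E * ((c.natAbs.gcd q : ℝ) * (c.natAbs : ℝ) ^ (-(7 / 8) : ℝ)) + C * (q : ℝ) ^ 4 * T ^ (11 / 12 : ℝ) := by
        positivity
      linarith [cnt_lowerLeft_le hT1 hc0 hcT]
    · rw [if_neg hb, add_zero]
      refine (hCj c hT1 hc0 hcT hcY' hb).trans (add_le_add ?_ le_rfl)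
      have hinv : ((c.natAbs : ℝ))⁻¹ ≤ T ^ (-(1 / 8) : ℝ) * (q : ℝ) ^ (1 / 8 : ℝ) * (c.natAbs : ℝ) ^ (-(7 / 8) : ℝ) := by
        have h1 : ((c.natAbs : ℝ))⁻¹ = (c.natAbs : ℝ) ^ (-(1 / 8) : ℝ) * (c.natAbs : ℝ) ^ (-(7 / 8) : ℝ) := by
          rw [← Real.rpow_add (by rw [hcabs]; exact hcpos), ← Real.rpow_neg_one]; norm_num
        have h2 : T / q ≤ c.natAbs := by
          rw [hcabs, div_le_iff₀ hqr]; linarith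
        rw [h1]
        gcongr
        calc (c.natAbs : ℝ) ^ (-(1 / 8) : ℝ) ≤ (T / q) ^ (-(1 / 8) : ℝ) :=
              Real.rpow_le_rpow_of_nonpos (by positivity) h2 (by norm_num)
          _ = _ := by
              rw [Real.div_rpow hT0.le hqr.le, Real.rpow_neg hqr.le, div_inv_eq_mul]
      calc 27 * T ^ 2 * ((c.natAbs.gcd q : ℝ) / (q * c.natAbs)) =
          27 * T ^ 2 / q * c.natAbs.gcd q * (c.natAbs : ℝ)⁻¹ := by
            rw [div_eq_mul_inv _ ((q : ℝ) * _), mul_inv]; ring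
        _ ≤ 27 * T ^ 2 / q * c.natAbs.gcd q * (T ^ (-(1 / 8) : ℝ) * (q : ℝ) ^ (1 / 8 : ℝ) * (c.natAbs : ℝ) ^ (-(7 / 8) : ℝ)) := by
            gcongr
        _ = _ := by rw [hE]; ring
  have hScard : (S.card : ℝ) ≤ 3 * T := by
    have : (S.card : ℝ) ≤ (intBall T).card := by exact_mod_cast Finset.card_filter_le _ _
    linarith [card_intBall_le hT0.le]
  have hbadcard : ((S.filter (fun c => q ^ 2 ∣ c.natAbs)).card : ℝ) ≤ 2 * T / (q ^ 2 : ℕ) := by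
    refine le_trans ?_ (card_multiples_intBall_le hT0.le (pow_ne_zero 2 hq0.ne'))
    exact_mod_cast Finset.card_le_card (Finset.filter_subset_filter _ hSsub)
  have hgsum : ∑ c ∈ S, (c.natAbs.gcd q : ℝ) * (c.natAbs : ℝ) ^ (-(7 / 8) : ℝ) ≤
      16 * q.divisors.card * T ^ (1 / 8 : ℝ) :=
    (Finset.sum_le_sum_of_subset_of_nonneg hSsub fun _ _ _ => by positivity).trans
      (sum_gcd_mul_rpow_le hT1 hq0.ne')
  have hE1 : E * (16 * q.divisors.card * T ^ (1 / 8 : ℝ)) ≤ 432 * D * (T ^ 2 * ρ) := by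
    have hTT : T ^ (-(1 / 8) : ℝ) * T ^ (1 / 8 : ℝ) = 1 := by rw [← Real.rpow_add hT0]; norm_num
    calc _ = 432 * T ^ 2 * (q.divisors.card * (q : ℝ) ^ (1 / 8 : ℝ) / q) * (T ^ (-(1 / 8) : ℝ) * T ^ (1 / 8 : ℝ)) := by
          rw [hE]; ring
      _ ≤ 432 * T ^ 2 * (D * ρ) * 1 := by rw [hTT]; gcongr
      _ = _ := by ring
  have big : ∑ c ∈ S, (cnt T (fun γ => γ 1 0 = c ∧ (q : ℤ) ∣ trZ γ - t) : ℝ) ≤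
      432 * D * (T ^ 2 * ρ) + 3 * C * (T ^ 2 * ρ) + 6 * (T ^ 2 * ρ) := by
    refine (Finset.sum_le_sum term).trans ?_
    rw [Finset.sum_add_distrib, Finset.sum_add_distrib, ← Finset.sum_filter, ← Finset.mul_sum, Finset.sum_const,
      Finset.sum_const, nsmul_eq_mul, nsmul_eq_mul]
    refine add_le_add (add_le_add ?_ ?_) ?_
    · refine le_trans ?_ hE1
      gcongr
    · calc _ ≤ 3 * T * (C * (q : ℝ) ^ 4 * T ^ (11 / 12 : ℝ)) := by gcongr
        _ = 3 * C * ((q : ℝ) ^ 4 * T ^ (11 / 12 : ℝ) * T) := by ring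
        _ ≤ _ := by gcongr
    · calc _ ≤ 2 * T / (q ^ 2 : ℕ) * (3 * T * q) := by gcongr
        _ = 6 * (T ^ 2 * (1 / q)) := by push_cast; field_simp; norm_num
        _ ≤ _ := by gcongr
  have split : (cnt T (fun γ => (q : ℤ) ∣ trZ γ - t) : ℝ) = cnt T (fun γ => (q : ℤ) ∣ trZ γ - t ∧ |(γ 1 0 : ℝ)| ≤ Y) +
      ∑ c ∈ S, (cnt T (fun γ => γ 1 0 = c ∧ (q : ℤ) ∣ trZ γ - t) : ℝ) := by
    rw [← cnt_and_add_cnt_and_not T (fun γ => (q : ℤ) ∣ trZ γ - t) (fun γ => |(γ 1 0 : ℝ)| ≤ Y),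
      cnt_lowerLeft_gt_eq_sum]
    push_cast; rfl
  rw [split, mul_assoc]
  linarith

theorem cnt_trace_diag_le {T : ℝ} {t a : ℤ} (h : a * (t - a) - 1 ≠ 0) :
    cnt T (fun γ => trZ γ = t ∧ γ 0 0 = a) ≤ 2 * (a * (t - a) - 1).natAbs.divisors.card := by
  classical
  set N := (a * (t - a) - 1).natAbs with hN
  refine (cnt_le_card (N.divisors.image (fun k : ℕ => (k : ℤ)) ∪ N.divisors.image (fun k : ℕ => -(k : ℤ)))
    (fun γ => γ 0 1) ?_ ?_).trans ?_
  · rintro γ _ ⟨h1, h2⟩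
    have hbc : γ 0 1 * γ 1 0 = a * (t - a) - 1 := by
      have := SL2Z.det_eq γ
      rw [← h1, ← h2]; unfold trZ; linear_combination -this
    have hd : (γ 0 1).natAbs ∈ N.divisors := by
      rw [Nat.mem_divisors]
      exact ⟨Int.natAbs_dvd_natAbs.2 ⟨_, hbc.symm⟩, Int.natAbs_ne_zero.2 h⟩
    rw [Finset.mem_union, Finset.mem_image, Finset.mem_image]
    rcases Int.natAbs_eq (γ 0 1) with e | e
    · exact Or.inl ⟨_, hd, e.symm⟩
    · exact Or.inr ⟨_, hd, e.symm⟩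
  · rintro γ γ' _ ⟨h1, h2⟩ _ ⟨h1', h2'⟩ e
    have hd : γ 1 1 = γ' 1 1 := by unfold trZ at h1 h1'; omega
    have d1 := SL2Z.det_eq γ
    have d2 := SL2Z.det_eq γ'
    refine SL2Z.ext' (h2.trans h2'.symm) e ?_ hd
    have hne : γ' 0 1 ≠ 0 := by
      intro h0
      apply h
      rw [h0] at d2
      rw [← h1', ← h2']; unfold trZ; linear_combination d2
    refine mul_left_cancel₀ hne ?_
    change γ 0 1 = γ' 0 1 at e
    rw [h2, hd, e] at d1
    rw [h2'] at d2
    linarith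
  · refine (Finset.card_union_le _ _).trans ?_
    have h1 : (N.divisors.image (fun k : ℕ => (k : ℤ))).card ≤ N.divisors.card := Finset.card_image_le
    have h2 : (N.divisors.image (fun k : ℕ => -(k : ℤ))).card ≤ N.divisors.card := Finset.card_image_le
    omega

theorem exists_cnt_trace_eq_le {ε : ℝ} (hε : 0 < ε) : ∃ C : ℝ, 1 ≤ C ∧ ∀ (t : ℤ) (T : ℝ), 1 ≤ T → 2 < |t| →
    (cnt T (fun γ => trZ γ = t) : ℝ) ≤ C * T ^ (1 + ε) := by
  obtain ⟨C, hC1, hC⟩ := card_divisors_le_rpow (half_pos hε)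
  have h2ε : (1 : ℝ) ≤ 2 ^ (ε / 2) := Real.one_le_rpow (by norm_num) (by positivity)
  refine ⟨6 * C * 2 ^ (ε / 2), by nlinarith, fun t T hT ht => ?_⟩
  have hT0 : 0 < T := by linarith
  rw [cnt_eq_sum (fun γ : SL2Z => γ 0 0) (intBall T) (fun γ hγ _ => mem_intBall.2 (abs_entry_le hγ 0 0))]
  push_cast
  have term : ∀ a ∈ intBall T, (cnt T (fun γ => trZ γ = t ∧ γ 0 0 = a) : ℝ) ≤ 2 * (C * (2 * T ^ 2) ^ (ε / 2)) := by
    intro a ha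
    have hne : a * (t - a) - 1 ≠ 0 := by
      intro h
      have h1 : a * (t - a) = 1 := by linarith
      rcases Int.mul_eq_one_iff_eq_one_or_neg_one.1 h1 with ⟨h2, h3⟩ | ⟨h2, h3⟩
      · have : t = 2 := by omega
        rw [this] at ht; norm_num at ht
      · have : t = -2 := by omega
        rw [this] at ht; norm_num at ht
    by_cases hta : |((t - a : ℤ) : ℝ)| ≤ T
    · have h1 : (cnt T (fun γ => trZ γ = t ∧ γ 0 0 = a) : ℝ) ≤ 2 * (a * (t - a) - 1).natAbs.divisors.card := by
        exact_mod_cast cnt_trace_diag_le hne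
      have h2 : (((a * (t - a) - 1).natAbs : ℕ) : ℝ) ≤ 2 * T ^ 2 := by
        rw [Nat.cast_natAbs]
        push_cast at hta ⊢
        rw [mem_intBall] at ha
        have h3 : |(a : ℝ) * (t - a)| ≤ T * T := by rw [abs_mul]; gcongr
        have h4 := abs_sub (a * (t - a) : ℝ) 1
        rw [abs_one] at h4
        nlinarith
      refine h1.trans ?_
      gcongr
      refine (hC _ (Int.natAbs_ne_zero.2 hne)).trans ?_
      gcongr
    · have : cnt T (fun γ => trZ γ = t ∧ γ 0 0 = a) = 0 := by
        classical
        rw [cnt_eq_card, Finset.card_eq_zero, Finset.filter_eq_empty_iff]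
        rintro γ hγ ⟨h1, h2⟩
        apply hta
        have : t - a = γ 1 1 := by rw [← h1, ← h2]; unfold trZ; ring
        rw [this]
        exact abs_entry_le (mem_ball.1 hγ) 1 1
      rw [this, Nat.cast_zero]; positivity
  refine (Finset.sum_le_sum term).trans ?_
  rw [Finset.sum_const, nsmul_eq_mul]
  have hcard : ((intBall T).card : ℝ) ≤ 3 * T := by linarith [card_intBall_le hT0.le]
  calc _ ≤ 3 * T * (2 * (C * (2 * T ^ 2) ^ (ε / 2))) := by gcongr
    _ = 6 * C * 2 ^ (ε / 2) * (T * T ^ ε) := by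
        rw [Real.mul_rpow (by norm_num) (by positivity), ← Real.rpow_natCast T 2, ← Real.rpow_mul hT0.le,
          Nat.cast_two, mul_div_cancel₀ ε two_ne_zero]
        ring
    _ = _ := by rw [Real.rpow_add hT0, Real.rpow_one]

theorem card_traces_le {T : ℝ} (hT : 1 ≤ T) {q : ℕ} (hq : 0 < q) {s : ℤ} (hs : |s| = 2) :
    (((intBall (2 * T)).filter (fun t => 2 < |t| ∧ (q : ℤ) ∣ t - s)).card : ℝ) ≤ 8 * T / q := by
  set S := (intBall (2 * T)).filter (fun t => 2 < |t| ∧ (q : ℤ) ∣ t - s) with hS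
  have hqr : (0 : ℝ) < q := by exact_mod_cast hq
  have hSb : ∀ t ∈ S, |(t : ℝ)| ≤ 2 * T := fun t ht => mem_intBall.1 (Finset.mem_filter.1 ht).1
  have hsr : |(s : ℝ)| = 2 := by exact_mod_cast hs
  rcases S.eq_empty_or_nonempty with h | ⟨t, ht⟩
  · rw [h]; simp; positivity
  · have hq4 : (q : ℝ) ≤ 4 * T := by
      obtain ⟨h2, h3⟩ := (Finset.mem_filter.1 ht).2
      have hne : t - s ≠ 0 := by intro h; rw [sub_eq_zero.1 h] at h2; omega
      have h4 : (q : ℤ) ≤ |t - s| := Int.le_of_dvd (abs_pos.2 hne) ((dvd_abs _ _).2 h3)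
      have h5 : (q : ℝ) ≤ |(t : ℝ) - s| := by exact_mod_cast h4
      have := abs_sub (t : ℝ) s
      have := hSb t ht
      linarith
    have := card_le_of_modEq (T := 2 * T) (c := q) (by exact_mod_cast hq.ne') (by linarith) S hSb (fun x hx y hy => by
      have h1 := (Finset.mem_filter.1 hx).2.2
      have h2 := (Finset.mem_filter.1 hy).2.2
      have : x - y = (x - s) - (y - s) := by ring
      rw [this]; exact h1.sub h2)
    refine this.trans ?_
    rw [Int.cast_natCast, abs_of_pos hqr]
    have h1 : 1 ≤ 4 * T / q := by rwa [le_div_iff₀ hqr, one_mul]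
    calc _ ≤ 2 * (2 * T) / q + 4 * T / q := by gcongr
      _ = _ := by ring

theorem cnt_large_trace_le {T B : ℝ} (hT : 1 ≤ T) {q : ℕ} (hq : 0 < q) {s : ℤ} (hs : |s| = 2) (hB : 0 ≤ B)
    (h : ∀ t : ℤ, 2 < |t| → (cnt T (fun γ => trZ γ = t) : ℝ) ≤ B) :
    (cnt T (fun γ => 2 < |trZ γ| ∧ (q : ℤ) ∣ trZ γ - s) : ℝ) ≤ 8 * T / q * B := by
  rw [cnt_eq_sum trZ ((intBall (2 * T)).filter (fun t => 2 < |t| ∧ (q : ℤ) ∣ t - s)) (fun γ hγ hP => by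
    rw [Finset.mem_filter, mem_intBall]
    refine ⟨?_, hP⟩
    have h1 := abs_entry_le hγ 0 0
    have h2 := abs_entry_le hγ 1 1
    unfold trZ
    push_cast
    linarith [abs_add_le (γ 0 0 : ℝ) (γ 1 1)])]
  push_cast
  calc _ ≤ ∑ t ∈ (intBall (2 * T)).filter (fun t => 2 < |t| ∧ (q : ℤ) ∣ t - s), B := by
        refine Finset.sum_le_sum fun t ht => ?_
        refine le_trans ?_ (h t (Finset.mem_filter.1 ht).2.1)
        exact_mod_cast cnt_mono fun γ _ (h : _ ∧ _) => h.2
    _ ≤ _ := by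
        rw [Finset.sum_const, nsmul_eq_mul]
        gcongr
        exact card_traces_le hT hq hs

theorem pow_dvd_sub_or_add_of_odd {p : ℕ} (hp : p.Prime) (hp2 : p ≠ 2) (j : ℕ) {t : ℤ}
    (h : ((p ^ j : ℕ) : ℤ) ∣ t ^ 2 - 4) : ((p ^ j : ℕ) : ℤ) ∣ t - 2 ∨ ((p ^ j : ℕ) : ℤ) ∣ t - (-2) := by
  have hpp : Prime (p : ℤ) := Nat.prime_iff_prime_int.1 hp
  have e : t ^ 2 - 4 = (t - 2) * (t - (-2)) := by ring
  rw [e] at h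
  push_cast at h ⊢
  by_cases h2 : (p : ℤ) ∣ t - 2
  · left
    have h3 : ¬ (p : ℤ) ∣ t - (-2) := by
      intro h3
      have h4 : (p : ℤ) ∣ 2 ^ 2 := by
        have := h3.sub h2
        ring_nf at this ⊢
        exact this
      have h5 := Int.natCast_dvd_natCast.1 (by exact_mod_cast hpp.dvd_of_dvd_pow h4 : (p : ℤ) ∣ ((2 : ℕ) : ℤ))
      exact hp2 ((Nat.prime_dvd_prime_iff_eq hp Nat.prime_two).1 h5)
    exact (((Prime.coprime_iff_not_dvd hpp).2 h3).pow_left).dvd_of_dvd_mul_right h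
  · right
    exact (((Prime.coprime_iff_not_dvd hpp).2 h2).pow_left).dvd_of_dvd_mul_left h

theorem pow_dvd_sub_or_add {p : ℕ} (hp : p.Prime) (j : ℕ) {t : ℤ}
    (h : ((p ^ (j + j) : ℕ) : ℤ) ∣ t ^ 2 - 4) : ((p ^ j : ℕ) : ℤ) ∣ t - 2 ∨ ((p ^ j : ℕ) : ℤ) ∣ t - (-2) := by
  have hpp : Prime (p : ℤ) := Nat.prime_iff_prime_int.1 hp
  have e : t ^ 2 - 4 = (t - 2) * (t - (-2)) := by ring
  rw [e] at h
  push_cast at h ⊢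
  rw [pow_dvd_iff_le_emultiplicity] at h ⊢
  rw [pow_dvd_iff_le_emultiplicity]
  rw [emultiplicity_mul hpp] at h
  by_contra! hlt
  obtain ⟨h1, h2⟩ := hlt
  lift emultiplicity (p : ℤ) (t - 2) to ℕ using h1.ne_top with x
  lift emultiplicity (p : ℤ) (t - (-2)) to ℕ using h2.ne_top with y
  norm_cast at h h1 h2
  omega

theorem prop_exists_le {T : ℝ} {β : Type*} (s : Finset β) (P : β → SL2Z → Prop) :
    prop T (fun γ => ∃ b ∈ s, P b γ) ≤ ∑ b ∈ s, prop T (P b) := by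
  unfold prop
  rw [← Finset.sum_div]
  have : (cnt T (fun γ => ∃ b ∈ s, P b γ) : ℝ) ≤ ∑ b ∈ s, (cnt T (P b) : ℝ) := by
    exact_mod_cast cnt_exists_le s P
  gcongr

theorem exists_pow_prop_trace_le {p : ℕ} (hp : p.Prime) {ε : ℝ} (hε : 0 < ε) :
    ∃ j : ℕ, ∀ᶠ T : ℝ in atTop, ∀ t : ℤ, prop T (fun γ => ((p ^ j : ℕ) : ℤ) ∣ trZ γ - t) ≤ ε := by
  obtain ⟨C, hC1, hC⟩ := exists_cnt_trace_le
  have hlim : Tendsto (fun j : ℕ => 64 * C * ((p ^ j : ℕ) : ℝ) ^ (-(3 / 4) : ℝ)) atTop (𝓝 (64 * C * 0)) := by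
    refine Tendsto.const_mul _ ?_
    exact (tendsto_rpow_neg_atTop (by norm_num : (0 : ℝ) < 3 / 4)).comp
      (tendsto_natCast_atTop_atTop.comp (tendsto_pow_atTop_atTop_of_one_lt hp.one_lt))
  rw [mul_zero] at hlim
  obtain ⟨j, hj⟩ := (hlim.eventually (gt_mem_nhds hε)).exists
  refine ⟨j, ?_⟩
  filter_upwards [eventually_ge_atTop (((p ^ j : ℕ) : ℝ) ^ 60), eventually_ge_atTop 4] with T h1 h2 t
  refine (prop_le_of_cnt_le h2 (B := C * ((p ^ j : ℕ) : ℝ) ^ (-(3 / 4) : ℝ)) ?_).trans ?_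
  · refine (hC p j t T hp h1).trans (le_of_eq (by ring))
  · rw [← mul_assoc]; exact hj.le

theorem eventually_prop_small_trace_le {ε : ℝ} (hε : 0 < ε) :
    ∀ᶠ T : ℝ in atTop, prop T (fun γ => ¬ 2 < |trZ γ|) ≤ ε := by
  obtain ⟨j, hj⟩ := exists_pow_prop_trace_le Nat.prime_two (show 0 < ε / 5 by positivity)
  filter_upwards [hj] with T hT
  calc prop T (fun γ => ¬ 2 < |trZ γ|) ≤
      prop T (fun γ => ∃ t ∈ Finset.Icc (-2 : ℤ) 2, ((2 ^ j : ℕ) : ℤ) ∣ trZ γ - t) := by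
        refine prop_mono fun γ hγ => ⟨trZ γ, ?_, by simp⟩
        rw [not_lt, abs_le] at hγ
        exact Finset.mem_Icc.2 hγ
    _ ≤ _ := prop_exists_le _ _
    _ ≤ ∑ t ∈ Finset.Icc (-2 : ℤ) 2, ε / 5 := Finset.sum_le_sum fun t _ => hT t
    _ = ε := by
        rw [Finset.sum_const, nsmul_eq_mul, show (Finset.Icc (-2 : ℤ) 2).card = 5 from rfl]
        push_cast; ring

theorem exists_pow_prop_disc_le {p : ℕ} (hp : p.Prime) {ε : ℝ} (hε : 0 < ε) :
    ∃ k : ℕ, ∀ᶠ T : ℝ in atTop, prop T (fun γ => ((p ^ k : ℕ) : ℤ) ∣ trZ γ ^ 2 - 4) ≤ ε := by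
  obtain ⟨j, hj⟩ := exists_pow_prop_trace_le hp (show 0 < ε / 2 by positivity)
  refine ⟨j + j, ?_⟩
  filter_upwards [hj] with T hT
  refine (prop_mono fun γ hγ => pow_dvd_sub_or_add hp j hγ).trans ((prop_or_le T _ _).trans ?_)
  linarith [hT 2, hT (-2)]

/-- The discriminant `Tr(γ)² - 4` is divisible by the square of a prime larger than `R`. -/
def tail (R : ℕ) (γ : SL2Z) : Prop :=
  2 < |trZ γ| ∧ ∃ p : ℕ, p.Prime ∧ R < p ∧ ((p ^ 2 : ℕ) : ℤ) ∣ trZ γ ^ 2 - 4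

theorem tail_prime_le {T : ℝ} {γ : SL2Z} (hγ : frobNorm γ ≤ T) (h : 2 < |trZ γ|) {p : ℕ}
    (hp : ((p ^ 2 : ℕ) : ℤ) ∣ trZ γ ^ 2 - 4) : p ≤ ⌊2 * T⌋₊ := by
  have h1 := abs_entry_le hγ 0 0
  have h2 := abs_entry_le hγ 1 1
  have hT : 0 ≤ T := (abs_nonneg _).trans h1
  have h3 : |(trZ γ : ℝ)| ≤ 2 * T := by
    unfold trZ
    push_cast
    linarith [abs_add_le (γ 0 0 : ℝ) (γ 1 1)]
  have hpos : 0 < trZ γ ^ 2 - 4 := by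
    rw [← sq_abs]; nlinarith
  have h4 : ((p ^ 2 : ℕ) : ℝ) ≤ (trZ γ : ℝ) ^ 2 - 4 := by exact_mod_cast Int.le_of_dvd hpos hp
  have h5 : (p : ℝ) ^ 2 ≤ (2 * T) ^ 2 := by
    push_cast at h4
    calc (p : ℝ) ^ 2 ≤ |(trZ γ : ℝ)| ^ 2 := by rw [sq_abs]; linarith
      _ ≤ _ := by gcongr
  exact Nat.le_floor (le_of_sq_le_sq h5 (by positivity))

theorem exists_prop_tail_le {ε : ℝ} (hε : 0 < ε) :
    ∃ R₀ : ℕ, ∀ R, R₀ ≤ R → ∀ᶠ T : ℝ in atTop, prop T (tail R) ≤ ε := by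
  classical
  obtain ⟨C, hC1, hC⟩ := exists_cnt_trace_le
  obtain ⟨C', hC1', hC'⟩ := exists_cnt_trace_eq_le (show (0 : ℝ) < 1 / 480 by norm_num)
  set f : ℕ → ℝ := fun p => (p : ℝ) ^ (-(3 / 2) : ℝ) with hf
  have hfs : Summable f := Real.summable_nat_rpow.2 (by norm_num)
  have hf0 : ∀ p, 0 ≤ f p := fun p => by positivity
  set Z := ∑' p, f p with hZ
  have hZ0 : 0 ≤ Z := tsum_nonneg hf0
  obtain ⟨s, hs⟩ := summable_iff_vanishing_norm.1 hfs (ε / (256 * C)) (by positivity)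
  refine ⟨max 2 (s.sup id), fun R hR => ?_⟩
  have hR2 : 2 ≤ R := (le_max_left _ _).trans hR
  have hlim : Tendsto (fun T : ℝ => 64 * (16 * C' * Z) * T ^ (-(1 / 480) : ℝ)) atTop (𝓝 (64 * (16 * C' * Z) * 0)) :=
    (tendsto_rpow_neg_atTop (by norm_num)).const_mul _
  rw [mul_zero] at hlim
  filter_upwards [hlim.eventually (gt_mem_nhds (half_pos hε)), eventually_ge_atTop 4] with T hT hT4
  have hT1 : 1 ≤ T := by linarith
  have hT0 : 0 < T := by linarith
  set F := (Finset.Icc (R + 1) ⌊2 * T⌋₊).filter (fun p : ℕ => p.Prime) with hF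
  have hFp : ∀ p ∈ F, R < p ∧ p.Prime := fun p hp => by
    rw [hF, Finset.mem_filter, Finset.mem_Icc] at hp; exact ⟨hp.1.1, hp.2⟩
  set F₁ := F.filter (fun p : ℕ => (p : ℝ) ^ 120 ≤ T) with hF₁
  set F₂ := F.filter (fun p : ℕ => ¬ (p : ℝ) ^ 120 ≤ T) with hF₂
  set σ : Finset ℤ := {2, -2} with hσ
  have hσ2 : ∀ x ∈ σ, |x| = 2 := by simp [hσ]
  have hσc : σ.card = 2 := by simp [hσ]
  have hcover : cnt T (tail R) ≤ cnt T (fun γ => ∃ x ∈ F₁ ×ˢ σ, ((x.1 ^ 2 : ℕ) : ℤ) ∣ trZ γ - x.2) +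
      cnt T (fun γ => ∃ x ∈ F₂ ×ˢ σ, 2 < |trZ γ| ∧ ((x.1 ^ 2 : ℕ) : ℤ) ∣ trZ γ - x.2) := by
    refine (cnt_mono ?_).trans (cnt_or_le T _ _)
    rintro γ hγ ⟨h2, p, hp, hpR, hd⟩
    have hpF : p ∈ F := by
      rw [hF, Finset.mem_filter, Finset.mem_Icc]
      exact ⟨⟨hpR, tail_prime_le hγ h2 hd⟩, hp⟩
    obtain ⟨x, hx, hdx⟩ : ∃ x ∈ σ, ((p ^ 2 : ℕ) : ℤ) ∣ trZ γ - x := by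
      rcases pow_dvd_sub_or_add_of_odd hp (by omega) 2 hd with h | h
      · exact ⟨2, by simp [hσ], h⟩
      · exact ⟨-2, by simp [hσ], h⟩
    by_cases hpT : (p : ℝ) ^ 120 ≤ T
    · exact Or.inl ⟨(p, x), Finset.mem_product.2 ⟨Finset.mem_filter.2 ⟨hpF, hpT⟩, hx⟩, hdx⟩
    · exact Or.inr ⟨(p, x), Finset.mem_product.2 ⟨Finset.mem_filter.2 ⟨hpF, hpT⟩, hx⟩, h2, hdx⟩
  have hfp : ∀ p : ℕ, ((p ^ 2 : ℕ) : ℝ) ^ (-(3 / 4) : ℝ) = f p := by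
    intro p
    rw [hf, Nat.cast_pow, ← Real.rpow_natCast, ← Real.rpow_mul (Nat.cast_nonneg _)]
    norm_num
  have hsum₁ : ∑ p ∈ F₁, f p ≤ ε / (256 * C) := by
    refine (le_abs_self _).trans (hs F₁ ?_).le
    rw [Finset.disjoint_left]
    intro p hp hps
    have h1 := (hFp p (Finset.mem_filter.1 hp).1).1
    have h2 : p ≤ s.sup id := Finset.le_sup (f := id) hps
    have h3 := (le_max_right 2 (s.sup id)).trans hR
    omega
  have hsum₂ : ∑ p ∈ F₂, f p ≤ Z := hfs.sum_le_tsum _ fun p _ => hf0 p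
  have b₁ : (cnt T (fun γ => ∃ x ∈ F₁ ×ˢ σ, ((x.1 ^ 2 : ℕ) : ℤ) ∣ trZ γ - x.2) : ℝ) ≤
      2 * C * T ^ 2 * (ε / (256 * C)) := by
    calc _ ≤ ∑ x ∈ F₁ ×ˢ σ, (cnt T (fun γ => ((x.1 ^ 2 : ℕ) : ℤ) ∣ trZ γ - x.2) : ℝ) := by
          exact_mod_cast cnt_exists_le (F₁ ×ˢ σ) (fun (x : ℕ × ℤ) γ => ((x.1 ^ 2 : ℕ) : ℤ) ∣ trZ γ - x.2)
      _ ≤ ∑ x ∈ F₁ ×ˢ σ, C * T ^ 2 * f x.1 := by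
          refine Finset.sum_le_sum fun x hx => ?_
          obtain ⟨h1, _⟩ := Finset.mem_product.1 hx
          obtain ⟨h2, h3⟩ := Finset.mem_filter.1 h1
          rw [← hfp]
          refine hC x.1 2 x.2 T (hFp _ h2).2 (le_trans (le_of_eq ?_) h3)
          push_cast; ring
      _ = 2 * C * T ^ 2 * ∑ p ∈ F₁, f p := by
          rw [Finset.sum_product, Finset.mul_sum]
          refine Finset.sum_congr rfl fun p _ => ?_
          simp only [Finset.sum_const, hσc, nsmul_eq_mul]; push_cast; ring
      _ ≤ _ := by gcongr
  have b₂ : (cnt T (fun γ => ∃ x ∈ F₂ ×ˢ σ, 2 < |trZ γ| ∧ ((x.1 ^ 2 : ℕ) : ℤ) ∣ trZ γ - x.2) : ℝ) ≤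
      16 * C' * T ^ 2 * T ^ (-(1 / 480) : ℝ) * Z := by
    calc _ ≤ ∑ x ∈ F₂ ×ˢ σ, (cnt T (fun γ => 2 < |trZ γ| ∧ ((x.1 ^ 2 : ℕ) : ℤ) ∣ trZ γ - x.2) : ℝ) := by
          exact_mod_cast cnt_exists_le (F₂ ×ˢ σ) (fun (x : ℕ × ℤ) γ => 2 < |trZ γ| ∧ ((x.1 ^ 2 : ℕ) : ℤ) ∣ trZ γ - x.2)
      _ ≤ ∑ x ∈ F₂ ×ˢ σ, 8 * C' * T ^ 2 * T ^ (-(1 / 480) : ℝ) * f x.1 := by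
          refine Finset.sum_le_sum fun x hx => ?_
          obtain ⟨h1, hx2⟩ := Finset.mem_product.1 hx
          obtain ⟨h2, h3⟩ := Finset.mem_filter.1 h1
          have hp0 := (hFp _ h2).2.pos
          have hpr : (0 : ℝ) < x.1 := by exact_mod_cast hp0
          refine (cnt_large_trace_le hT1 (pow_pos hp0 2) (hσ2 _ hx2) (by positivity) (fun t ht => hC' t T hT1 ht)).trans ?_
          have hpT : (x.1 : ℝ) ^ (-(1 / 2) : ℝ) ≤ T ^ (-(1 / 240) : ℝ) := by
            calc (x.1 : ℝ) ^ (-(1 / 2) : ℝ) = ((x.1 : ℝ) ^ 120) ^ (-(1 / 240) : ℝ) := by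
                  rw [← Real.rpow_natCast, ← Real.rpow_mul hpr.le]; norm_num
              _ ≤ _ := Real.rpow_le_rpow_of_nonpos hT0 (not_le.1 h3).le (by norm_num)
          have hinv : ((x.1 ^ 2 : ℕ) : ℝ)⁻¹ ≤ T ^ (-(1 / 240) : ℝ) * f x.1 := by
            calc ((x.1 ^ 2 : ℕ) : ℝ)⁻¹ = (x.1 : ℝ) ^ (-(1 / 2) : ℝ) * f x.1 := by
                  rw [hf, ← Real.rpow_add hpr, Nat.cast_pow, ← Real.rpow_natCast, ← Real.rpow_neg hpr.le]; norm_num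
              _ ≤ _ := by gcongr
          have hTT : T * T ^ (1 + 1 / 480 : ℝ) * T ^ (-(1 / 240) : ℝ) = T ^ 2 * T ^ (-(1 / 480) : ℝ) := by
            rw [← Real.rpow_one_add' hT0.le (by norm_num), ← Real.rpow_add hT0, ← Real.rpow_natCast T 2,
              ← Real.rpow_add hT0]
            norm_num
          calc _ = 8 * C' * (T * T ^ (1 + 1 / 480 : ℝ)) * ((x.1 ^ 2 : ℕ) : ℝ)⁻¹ := by rw [div_eq_mul_inv]; ring
            _ ≤ 8 * C' * (T * T ^ (1 + 1 / 480 : ℝ)) * (T ^ (-(1 / 240) : ℝ) * f x.1) := by gcongr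
            _ = _ := by linear_combination 8 * C' * f x.1 * hTT
      _ = 16 * C' * T ^ 2 * T ^ (-(1 / 480) : ℝ) * ∑ p ∈ F₂, f p := by
          rw [Finset.sum_product, Finset.mul_sum]
          refine Finset.sum_congr rfl fun p _ => ?_
          simp only [Finset.sum_const, hσc, nsmul_eq_mul]; push_cast; ring
      _ ≤ _ := by gcongr
  have hcover' : (cnt T (tail R) : ℝ) ≤ (ε / 128 + 16 * C' * Z * T ^ (-(1 / 480) : ℝ)) * T ^ 2 := by
    have h1 : (cnt T (tail R) : ℝ) ≤
        2 * C * T ^ 2 * (ε / (256 * C)) + 16 * C' * T ^ 2 * T ^ (-(1 / 480) : ℝ) * Z := by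
      refine (Nat.cast_le.2 hcover).trans ?_
      rw [Nat.cast_add]
      exact add_le_add b₁ b₂
    refine h1.trans (le_of_eq ?_)
    have hCC : C * (ε / (256 * C)) = ε / 256 := by field_simp
    linear_combination 2 * T ^ 2 * hCC
  refine (prop_le_of_cnt_le hT4 hcover').trans ?_
  linarith

theorem trZ_sq_sub_four (γ : SL2Z) :
    trZ γ ^ 2 - 4 = (γ 1 1 - γ 0 0) ^ 2 + 4 * (γ 0 1 * γ 1 0) := by
  have := SL2Z.det_eq γ
  unfold trZ
  linear_combination 4 * this

theorem dvd_uGamma_iff (γ : SL2Z) (x : ℕ) :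
    x ∣ uGamma γ ↔ (x : ℤ) ∣ γ 1 0 ∧ (x : ℤ) ∣ γ 1 1 - γ 0 0 ∧ (x : ℤ) ∣ γ 0 1 := by
  unfold uGamma
  rw [Int.dvd_gcd_iff, Int.dvd_coe_gcd_iff]

theorem trZ_sq_sub_four_pos {γ : SL2Z} (h : 2 < |trZ γ|) : 0 < trZ γ ^ 2 - 4 := by
  rw [← sq_abs]; nlinarith

theorem trZ_sq_sub_four_ne_sq {γ : SL2Z} (h : 2 < |trZ γ|) (w : ℤ) : trZ γ ^ 2 - 4 ≠ w ^ 2 := by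
  intro e
  rw [← sq_abs, ← sq_abs w] at e
  have hw := abs_nonneg w
  have h1 : |w| < |trZ γ| := by nlinarith
  have h2 : |trZ γ| ≤ |w| + 1 := by
    by_contra! h3
    nlinarith
  have h3 : |trZ γ| = |w| + 1 := by omega
  rw [h3] at e
  have : 2 * |w| = 3 := by linarith
  omega

/-- The conditions `u_γ = n` and `f_γ = m` tested only at the primes up to `y`. -/
def IsLocalUF (y n m : ℕ) (γ : SL2Z) : Prop :=
  ∃ Δ : ℤ, trZ γ ^ 2 - 4 = (n * m : ℤ) ^ 2 * Δ ∧ (Δ % 4 = 1 ∨ Δ % 16 = 8 ∨ Δ % 16 = 12) ∧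
    (∀ p : ℕ, p.Prime → p ≠ 2 → p ≤ y → ¬ (p : ℤ) ^ 2 ∣ Δ) ∧ n ∣ uGamma γ ∧
    ∀ p : ℕ, p.Prime → p ≤ y → ¬ p * n ∣ uGamma γ

theorem not_sq_dvd_of_squarefree {D : ℤ} (hD : Squarefree D) {p : ℕ} (hp : p.Prime) :
    ¬ (p : ℤ) ^ 2 ∣ D := fun h =>
  (Nat.prime_iff_prime_int.1 hp).not_isUnit (hD p (by rwa [← sq]))

theorem odd_sq_dvd_four_mul {p : ℕ} (hp : p.Prime) (hp2 : p ≠ 2) {D : ℤ} (h : (p : ℤ) ^ 2 ∣ 4 * D) :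
    (p : ℤ) ^ 2 ∣ D := by
  have h1 : IsCoprime ((p : ℤ) ^ 2) ((2 : ℤ) ^ 2) := by
    refine IsCoprime.pow ?_
    have : Nat.Coprime p 2 := (Nat.coprime_primes hp Nat.prime_two).2 hp2
    exact_mod_cast Nat.isCoprime_iff_coprime.2 this
  exact h1.dvd_of_dvd_mul_left (by norm_num; exact h)

theorem HasUF.isLocalUF {γ : SL2Z} {n m : ℕ} (hn : n ≠ 0) (h : HasUF γ n m) (y : ℕ) :
    IsLocalUF y n m γ := by
  obtain ⟨hu, mm, D, -, -, hD, he, hif⟩ := h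
  have hpn : ∀ p : ℕ, p.Prime → p ≤ y → ¬ p * n ∣ uGamma γ := by
    intro p hp _ hd
    rw [hu] at hd
    have := Nat.le_of_dvd (Nat.pos_of_ne_zero hn) hd
    have := hp.two_le
    have : 2 * n ≤ p * n := Nat.mul_le_mul_right _ hp.two_le
    omega
  have h2 := not_sq_dvd_of_squarefree hD Nat.prime_two
  split_ifs at hif with hD4
  · exact ⟨D, by rw [he, hif], Or.inl hD4, fun p hp _ _ => not_sq_dvd_of_squarefree hD hp,
      hu ▸ dvd_rfl, hpn⟩
  · refine ⟨4 * D, by rw [he, hif]; ring, Or.inr ?_, fun p hp hp2 _ hd =>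
      not_sq_dvd_of_squarefree hD hp (odd_sq_dvd_four_mul hp hp2 hd), hu ▸ dvd_rfl, hpn⟩
    norm_num at h2
    omega

theorem sq_dvd_of_dvd_uGamma {γ : SL2Z} {x : ℕ} (h : x ∣ uGamma γ) :
    ((x ^ 2 : ℕ) : ℤ) ∣ trZ γ ^ 2 - 4 := by
  obtain ⟨⟨c, hc⟩, ⟨d, hd⟩, ⟨b, hb⟩⟩ := (dvd_uGamma_iff γ x).1 h
  rw [trZ_sq_sub_four, hc, hd, hb]
  exact ⟨d ^ 2 + 4 * (b * c), by push_cast; ring⟩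

theorem IsLocalUF.hasUF {γ : SL2Z} {y n m : ℕ} (hn : n ≠ 0) (hm : m ≠ 0)
    (h : IsLocalUF y n m γ) (ht : 2 < |trZ γ|) (htail : ¬ tail y γ) : HasUF γ n m := by
  obtain ⟨Δ, he, h16, hsq, hnu, hpu⟩ := h
  have hbig : ∀ p : ℕ, p.Prime → y < p → ¬ ((p ^ 2 : ℕ) : ℤ) ∣ trZ γ ^ 2 - 4 := fun p hp hpy h =>
    htail ⟨ht, p, hp, hpy, h⟩
  have hnm : (0 : ℤ) < n * m := by positivity
  have hu : uGamma γ = n := by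
    obtain ⟨k, hk⟩ := hnu
    by_contra hne
    obtain ⟨p, hp, hpk⟩ := Nat.exists_prime_and_dvd (n := k) (by rintro rfl; exact hne (by simpa using hk))
    have hd : p * n ∣ uGamma γ := by
      rw [hk, mul_comm]; exact mul_dvd_mul_left _ hpk
    rcases le_or_gt p y with hpy | hpy
    · exact hpu p hp hpy hd
    · exact hbig p hp hpy (sq_dvd_of_dvd_uGamma ((dvd_mul_right _ _).trans hd))
  have hodd : ∀ p : ℕ, p.Prime → p ≠ 2 → ¬ (p : ℤ) ^ 2 ∣ Δ := by
    intro p hp hp2 hd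
    rcases le_or_gt p y with hpy | hpy
    · exact hsq p hp hp2 hpy hd
    · refine hbig p hp hpy ?_
      rw [he]; push_cast
      exact hd.mul_left _
  have hΔ : 0 < Δ := by
    have := trZ_sq_sub_four_pos ht
    rw [he] at this
    exact pos_of_mul_pos_right this (by positivity)
  have hΔ1 : Δ ≠ 1 := by
    rintro rfl
    exact trZ_sq_sub_four_ne_sq ht (n * m) (by rw [he]; ring)
  have sqf : ∀ D : ℤ, (∀ p : ℕ, p.Prime → ¬ (p : ℤ) ^ 2 ∣ D) → Squarefree D := by
    intro D hD
    rw [← Int.squarefree_natAbs, Nat.squarefree_iff_prime_squarefree]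
    intro p hp hd
    refine hD p hp ?_
    rw [sq, ← Int.natCast_mul, Int.natCast_dvd]
    exact hd
  by_cases h4 : Δ % 4 = 1
  · refine ⟨hu, n * m, Δ, hnm, by omega, sqf Δ fun p hp hd => ?_, he, by rw [if_pos h4]⟩
    rcases eq_or_ne p 2 with rfl | hp2
    · norm_num at hd; omega
    · exact hodd p hp hp2 hd
  · obtain ⟨D, rfl⟩ : (4 : ℤ) ∣ Δ := by omega
    refine ⟨hu, 2 * n * m, D, by nlinarith, by omega, sqf D fun p hp hd => ?_, by rw [he]; ring, ?_⟩
    · rcases eq_or_ne p 2 with rfl | hp2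
      · norm_num at hd; omega
      · exact hodd p hp hp2 (hd.mul_left _)
    · rw [if_neg (by omega)]

theorem exists_hasUF {γ : SL2Z} (ht : 2 < |trZ γ|) : ∃ n m : ℕ, n ≠ 0 ∧ m ≠ 0 ∧ HasUF γ n m := by
  have hpos := trZ_sq_sub_four_pos ht
  obtain ⟨⟨c, hc⟩, ⟨d, hd⟩, ⟨b, hb⟩⟩ := (dvd_uGamma_iff γ (uGamma γ)).1 dvd_rfl
  set u := uGamma γ with hu
  have he : trZ γ ^ 2 - 4 = (u : ℤ) ^ 2 * (d ^ 2 + 4 * (b * c)) := by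
    rw [trZ_sq_sub_four, hc, hd, hb]; ring
  have hepos : 0 < d ^ 2 + 4 * (b * c) := by
    rw [he] at hpos
    exact pos_of_mul_pos_right hpos (by positivity)
  have hu0 : u ≠ 0 := by
    rintro h0
    rw [he, h0] at hpos
    simp at hpos
  obtain ⟨D, w, hwD, hsq⟩ := Nat.sq_mul_squarefree (d ^ 2 + 4 * (b * c)).toNat
  have hwDz : (w : ℤ) ^ 2 * D = d ^ 2 + 4 * (b * c) := by
    rw [← Int.toNat_of_nonneg hepos.le, ← hwD]; push_cast; ring
  have hw0 : w ≠ 0 := by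
    rintro rfl
    simp at hwDz; omega
  have hD0 : D ≠ 0 := hsq.ne_zero
  have hD1 : D ≠ 1 := by
    rintro rfl
    exact trZ_sq_sub_four_ne_sq ht (u * w) (by rw [he, ← hwDz]; push_cast; ring)
  have hDs : Squarefree (D : ℤ) := Int.squarefree_natCast.2 hsq
  have h2 := not_sq_dvd_of_squarefree hDs Nat.prime_two
  norm_num at h2
  by_cases h4 : (D : ℤ) % 4 = 1
  · exact ⟨u, w, hu0, hw0, hu.symm, u * w, D,
      by exact_mod_cast Nat.one_le_iff_ne_zero.2 (mul_ne_zero hu0 hw0), by omega, hDs,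
      by rw [he, ← hwDz]; ring, by rw [if_pos h4]⟩
  · have hwe : Even w := by
      by_contra hwo
      rw [Nat.not_even_iff_odd] at hwo
      have hw4 : (w : ℤ) ^ 2 % 4 = 1 := Int.sq_mod_four_eq_one_of_odd (by exact_mod_cast hwo)
      have h5 : (d ^ 2 + 4 * (b * c)) % 4 = (D : ℤ) % 4 := by
        rw [← hwDz, Int.mul_emod, hw4]; omega
      have h6 : d ^ 2 % 4 = 0 ∨ d ^ 2 % 4 = 1 := by
        rcases Int.even_or_odd d with ⟨x, rfl⟩ | hdo
        · left; ring_nf; omega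
        · right; exact Int.sq_mod_four_eq_one_of_odd hdo
      omega
    obtain ⟨v, rfl⟩ := hwe
    refine ⟨u, v, hu0, by omega, hu.symm, 2 * u * v, D, ?_, by omega, hDs,
      by rw [he, ← hwDz]; push_cast; ring, by rw [if_neg h4]⟩
    have hv0 : v ≠ 0 := by omega
    exact_mod_cast Nat.one_le_iff_ne_zero.2 (mul_ne_zero (mul_ne_zero two_ne_zero hu0) hv0)

theorem HasUF.sq_dvd {γ : SL2Z} {n m : ℕ} (hn : n ≠ 0) (h : HasUF γ n m) :
    (((n * m) ^ 2 : ℕ) : ℤ) ∣ trZ γ ^ 2 - 4 := by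
  obtain ⟨Δ, he, -⟩ := h.isLocalUF hn 0
  exact ⟨Δ, by rw [he]; push_cast; ring⟩

theorem sq_mul_squarefree_unique {a b C D : ℤ} (ha : 1 ≤ a) (hb : 1 ≤ b) (hC : Squarefree C)
    (hD : Squarefree D) (h : a ^ 2 * C = b ^ 2 * D) : a = b ∧ C = D := by
  have key : ∀ {a b C D : ℤ}, IsCoprime a b → Squarefree C → a ^ 2 * C = b ^ 2 * D → IsUnit b := by
    intro a b C D hab hC h
    have : b ^ 2 ∣ C := (hab.symm.pow (m := 2) (n := 2)).dvd_of_dvd_mul_left ⟨D, h⟩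
    exact hC b (by rwa [← sq])
  obtain ⟨a', b', hg, ha', hb'⟩ := Int.exists_gcd_one (m := a) (n := b)
    (Int.gcd_pos_of_ne_zero_left _ (by omega))
  set g := (Int.gcd a b : ℤ) with hgdef
  have hg0 : 0 < g := by
    rw [hgdef]; exact_mod_cast Int.gcd_pos_of_ne_zero_left _ (by omega)
  have hco : IsCoprime a' b' := Int.isCoprime_iff_gcd_eq_one.2 hg
  have h' : a' ^ 2 * C = b' ^ 2 * D := by
    rw [ha', hb'] at h
    refine mul_left_cancel₀ (pow_pos hg0 2).ne' ?_
    linear_combination h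
  have ha1 : a' = 1 := by
    rcases Int.isUnit_iff.1 (key hco.symm hD h'.symm) with h | h
    · exact h
    · rw [h] at ha'; omega
  have hb1 : b' = 1 := by
    rcases Int.isUnit_iff.1 (key hco hC h') with h | h
    · exact h
    · rw [h] at hb'; omega
  subst ha1 hb1
  exact ⟨by rw [ha', hb'], by linarith⟩

theorem HasUF.unique {γ : SL2Z} {n m n' m' : ℕ} (hn : n ≠ 0) (h : HasUF γ n m)
    (h' : HasUF γ n' m') : n = n' ∧ m = m' := by
  obtain ⟨hu, mm, D, h1, -, hD, he, hif⟩ := h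
  obtain ⟨hu', mm', D', h1', -, hD', he', hif'⟩ := h'
  have hnn : n = n' := by rw [← hu, hu']
  subst hnn
  obtain ⟨rfl, rfl⟩ := sq_mul_squarefree_unique h1 h1' hD hD' (by rw [← he, he'])
  have hn' : (n : ℤ) ≠ 0 := by exact_mod_cast hn
  refine ⟨rfl, ?_⟩
  split_ifs at hif hif' with h4
  · exact_mod_cast mul_left_cancel₀ hn' (hif.symm.trans hif')
  · exact_mod_cast mul_left_cancel₀ (mul_ne_zero two_ne_zero hn') (hif.symm.trans hif')

/-- A modulus determining `IsLocalUF y n m`. -/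
def localMod (y n m : ℕ) : ℕ := 16 * (n * m) ^ 2 * (y.factorial) ^ 2

theorem localMod_ne_zero {n m : ℕ} (y : ℕ) (hn : n ≠ 0) (hm : m ≠ 0) : localMod y n m ≠ 0 := by
  unfold localMod
  have := Nat.factorial_ne_zero y
  positivity

theorem redMod_eq_trZ_dvd {q : ℕ} {γ g : SL2Z} (h : redMod q γ = redMod q g) :
    (q : ℤ) ∣ (trZ γ ^ 2 - 4) - (trZ g ^ 2 - 4) := by
  obtain ⟨h1, -, -, h4⟩ := (redMod_eq_iff).1 h
  have h5 : (q : ℤ) ∣ trZ γ - trZ g := by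
    rw [show trZ γ - trZ g = (γ 0 0 - g 0 0) + (γ 1 1 - g 1 1) by unfold trZ; ring]
    exact dvd_add h1 h4
  rw [show (trZ γ ^ 2 - 4) - (trZ g ^ 2 - 4) = (trZ γ - trZ g) * (trZ γ + trZ g) by ring]
  exact h5.mul_right _

theorem redMod_eq_dvd_uGamma {q x : ℕ} {γ g : SL2Z} (h : redMod q γ = redMod q g) (hx : x ∣ q) :
    x ∣ uGamma γ ↔ x ∣ uGamma g := by
  have hx' : (x : ℤ) ∣ q := Int.natCast_dvd_natCast.2 hx
  obtain ⟨h1, h2, h3, h4⟩ := (redMod_eq_iff).1 h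
  have h5 : (q : ℤ) ∣ (γ 1 1 - γ 0 0) - (g 1 1 - g 0 0) := by
    rw [show (γ 1 1 - γ 0 0) - (g 1 1 - g 0 0) = (γ 1 1 - g 1 1) - (γ 0 0 - g 0 0) by ring]
    exact dvd_sub h4 h1
  rw [dvd_uGamma_iff, dvd_uGamma_iff, dvd_iff_dvd_of_dvd_sub (hx'.trans h3),
    dvd_iff_dvd_of_dvd_sub (hx'.trans h2), dvd_iff_dvd_of_dvd_sub (hx'.trans h5)]

theorem modInvariant_isLocalUF {n m : ℕ} (y : ℕ) (hn : n ≠ 0) (hm : m ≠ 0) :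
    ModInvariant (localMod y n m) (IsLocalUF y n m) := by
  rintro γ γ' h ⟨Δ, he, h16, hsq, hnu, hpu⟩
  obtain ⟨j, hj⟩ := redMod_eq_trZ_dvd h
  have hnm : (n * m : ℤ) ≠ 0 := by positivity
  have hfac : ∀ p : ℕ, p.Prime → p ≤ y → p ∣ y.factorial := fun p hp hpy =>
    Nat.dvd_factorial hp.pos hpy
  have hnq : n ∣ localMod y n m := ⟨16 * n * m ^ 2 * y.factorial ^ 2, by unfold localMod; ring⟩
  refine ⟨Δ - 16 * (y.factorial : ℤ) ^ 2 * j, ?_, ?_, ?_, ?_, ?_⟩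
  · have : ((localMod y n m : ℕ) : ℤ) = 16 * (n * m) ^ 2 * (y.factorial : ℤ) ^ 2 := by
      unfold localMod; push_cast; ring
    rw [this] at hj
    linear_combination he - hj
  · rw [mul_assoc]
    omega
  · intro p hp hp2 hpy hd
    refine hsq p hp hp2 hpy ?_
    have h1 : (p : ℤ) ^ 2 ∣ 16 * (y.factorial : ℤ) ^ 2 * j := by
      have : (p : ℤ) ∣ y.factorial := Int.natCast_dvd_natCast.2 (hfac p hp hpy)
      exact ((pow_dvd_pow_of_dvd this 2).mul_left _).mul_right _
    simpa using dvd_add hd h1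
  · exact (redMod_eq_dvd_uGamma h hnq).1 hnu
  · intro p hp hpy hd
    refine hpu p hp hpy ((redMod_eq_dvd_uGamma h ?_).2 hd)
    obtain ⟨k, hk⟩ := hfac p hp hpy
    exact ⟨16 * n * m ^ 2 * k * y.factorial, by unfold localMod; rw [sq y.factorial]; nth_rewrite 1 [hk]; ring⟩

theorem exists_signed_odd_primorial (y : ℕ) (r : ℤ) (hr : r = 1 ∨ r = 3) :
    ∃ s : ℤ, s % 4 = r ∧ ∀ p : ℕ, p.Prime → p ≠ 2 → p ≤ y → (p : ℤ) ∣ s ∧ ¬ (p : ℤ) ^ 2 ∣ s := by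
  set S := (Finset.Icc 3 y).filter (fun p : ℕ => p.Prime) with hS
  set P : ℤ := ∏ p ∈ S, (p : ℤ) with hP
  have hPp : ∀ p : ℕ, p.Prime → p ≠ 2 → p ≤ y → (p : ℤ) ∣ P ∧ ¬ (p : ℤ) ^ 2 ∣ P := by
    intro p hp hp2 hpy
    have hpS : p ∈ S := by
      have := hp.two_le
      simp only [hS, Finset.mem_filter, Finset.mem_Icc]
      exact ⟨⟨by omega, hpy⟩, hp⟩
    refine ⟨Finset.dvd_prod_of_mem _ hpS, fun hd => ?_⟩
    rw [hP, ← Finset.mul_prod_erase S _ hpS, sq] at hd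
    have hp0 : (p : ℤ) ≠ 0 := by exact_mod_cast hp.ne_zero
    have h1 := (mul_dvd_mul_iff_left hp0).1 hd
    obtain ⟨x, hx, hdx⟩ := ((Nat.prime_iff_prime_int.1 hp).dvd_finsetProd_iff _).1 h1
    have h2 := Finset.mem_erase.1 hx
    have h3 := (Finset.mem_filter.1 h2.2).2
    exact h2.1 ((Nat.prime_dvd_prime_iff_eq hp h3).1 (Int.natCast_dvd_natCast.1 hdx)).symm
  have hodd : P % 2 = 1 := by
    rw [← Int.odd_iff, ← Int.not_even_iff_odd, even_iff_two_dvd]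
    intro h
    obtain ⟨x, hx, hdx⟩ := ((Nat.prime_iff_prime_int.1 Nat.prime_two).dvd_finsetProd_iff _).1 h
    have h2 := Finset.mem_filter.1 hx
    have h3 := (Nat.prime_dvd_prime_iff_eq Nat.prime_two h2.2).1 (Int.natCast_dvd_natCast.1 hdx)
    have := (Finset.mem_Icc.1 h2.1).1
    omega
  by_cases h : P % 4 = r
  · exact ⟨P, h, hPp⟩
  · refine ⟨-P, by omega, fun p hp hp2 hpy => ?_⟩
    rw [dvd_neg, dvd_neg]
    exact hPp p hp hp2 hpy

theorem exists_isLocalUF {n m : ℕ} (y : ℕ) (hn : n ≠ 0) (hm : m ≠ 0) :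
    ∃ g : SL2Z, IsLocalUF y n m g := by
  obtain ⟨s, Δ, δ, hsp, hs, hΔ, hpar, hΔ4⟩ : ∃ s Δ δ : ℤ,
      (∀ p : ℕ, p.Prime → p ≠ 2 → p ≤ y → (p : ℤ) ∣ s ∧ ¬ (p : ℤ) ^ 2 ∣ s) ∧
      Δ = s * ((n * m : ℤ) ^ 2 * s + 4) ∧ (Δ % 4 = 1 ∨ Δ % 16 = 8 ∨ Δ % 16 = 12) ∧
      (2 : ℤ) ∣ 2 + (n * m : ℤ) ^ 2 * s - n * δ ∧ (4 : ℤ) ∣ Δ * m ^ 2 - δ ^ 2 := by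
    rcases Int.even_or_odd (n * m : ℤ) with ⟨l, hl⟩ | hk
    · rcases Int.even_or_odd l with ⟨r, hr⟩ | hlo
      · obtain ⟨s, hs4, hs⟩ := exists_signed_odd_primorial y 3 (by simp)
        have e : s * ((n * m : ℤ) ^ 2 * s + 4) = 16 * (s * r ^ 2 * s) + 4 * s := by
          rw [hl, hr]; ring
        refine ⟨s, _, 0, hs, rfl, Or.inr (Or.inr (by rw [e]; omega)), ?_, ?_⟩
        · rw [hl]; exact ⟨1 + 2 * l ^ 2 * s, by ring⟩
        · rw [e]; exact ⟨(4 * (s * r ^ 2 * s) + s) * m ^ 2, by ring⟩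
      · obtain ⟨s, hs4, hs⟩ := exists_signed_odd_primorial y 1 (by simp)
        obtain ⟨r, hr⟩ := hlo
        obtain ⟨z, hz⟩ : ∃ z, s = 4 * z + 1 := ⟨s / 4, by omega⟩
        have e : s * ((n * m : ℤ) ^ 2 * s + 4) =
            16 * ((4 * z ^ 2 + 3 * z) + s * s * (r ^ 2 + r)) + 8 := by
          rw [hl, hr, hz]; ring
        refine ⟨s, _, 0, hs, rfl, Or.inr (Or.inl (by rw [e]; omega)), ?_, ?_⟩
        · rw [hl]; exact ⟨1 + 2 * l ^ 2 * s, by ring⟩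
        · rw [e]; exact ⟨(4 * ((4 * z ^ 2 + 3 * z) + s * s * (r ^ 2 + r)) + 2) * m ^ 2, by ring⟩
    · obtain ⟨s, hs4, hs⟩ := exists_signed_odd_primorial y 1 (by simp)
      obtain ⟨⟨a, ha⟩, ⟨b, hb⟩⟩ := Int.odd_mul.1 hk
      obtain ⟨z, hz⟩ : ∃ z, s = 2 * z + 1 := ⟨s / 2, by omega⟩
      obtain ⟨r, hr⟩ := hk
      obtain ⟨x, hx⟩ : ∃ x, s * ((n * m : ℤ) ^ 2 * s + 4) = 4 * x + 1 :=
        ⟨s + (r ^ 2 + r) * s * s + (z ^ 2 + z), by rw [hr, hz]; ring⟩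
      refine ⟨s, _, 1, hs, rfl, Or.inl (by rw [hx]; omega), ?_, ?_⟩
      · rw [hr, ha, hz]
        exact ⟨1 + (2 * r ^ 2 + 2 * r) * (2 * z + 1) + z - a, by ring⟩
      · rw [hx, hb]
        exact ⟨x * (2 * b + 1) ^ 2 + (b ^ 2 + b), by ring⟩
  obtain ⟨a, ha⟩ := hpar
  obtain ⟨b, hb⟩ := hΔ4
  have hdet : a * (a + n * δ) - n * b * n = 1 := by
    have h1 : 4 * (a * (a + n * δ) - n * b * n) = 4 := by
      rw [hs] at hb
      linear_combination (-(2 + (n * m : ℤ) ^ 2 * s + n * δ) - 2 * a) * ha + (n : ℤ) ^ 2 * hb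
    linarith
  have htr : trZ (SL2Z.mk a (n * b) n (a + n * δ) (by linarith)) = 2 + (n * m : ℤ) ^ 2 * s := by
    simp only [trZ, SL2Z.mk_00, SL2Z.mk_11]
    linarith
  refine ⟨SL2Z.mk a (n * b) n (a + n * δ) (by linarith), Δ, ?_, hΔ, ?_, ?_, ?_⟩
  · rw [htr, hs]; ring
  · intro p hp hp2 hpy hd
    obtain ⟨h1, h2⟩ := hsp p hp hp2 hpy
    refine h2 ?_
    have hpp := Nat.prime_iff_prime_int.1 hp
    have h3 : ¬ (p : ℤ) ∣ (n * m : ℤ) ^ 2 * s + 4 := by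
      intro h3
      have h4 : (p : ℤ) ∣ 2 ^ 2 := by
        have := dvd_sub h3 (h1.mul_left ((n * m : ℤ) ^ 2))
        simpa using this
      have h5 := Int.natCast_dvd_natCast.1 (by exact_mod_cast hpp.dvd_of_dvd_pow h4 : (p : ℤ) ∣ ((2 : ℕ) : ℤ))
      exact hp2 ((Nat.prime_dvd_prime_iff_eq hp Nat.prime_two).1 h5)
    rw [hs] at hd
    exact (((Prime.coprime_iff_not_dvd hpp).2 h3).pow_left).dvd_of_dvd_mul_right hd
  · rw [dvd_uGamma_iff]
    simp
  · intro p hp _ hd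
    have h1 := ((dvd_uGamma_iff _ _).1 hd).1
    rw [SL2Z.mk_10] at h1
    have h2 := Nat.le_of_dvd (Nat.pos_of_ne_zero hn) (Int.natCast_dvd_natCast.1 h1)
    have : 2 * n ≤ p * n := Nat.mul_le_mul_right _ hp.two_le
    omega

theorem exists_tendsto_of_approx {f : ℝ → ℝ}
    (h : ∀ ε > 0, ∃ g : ℝ → ℝ, (∃ L, Tendsto g atTop (𝓝 L)) ∧ ∀ᶠ T in atTop, |f T - g T| ≤ ε) :
    ∃ L, Tendsto f atTop (𝓝 L) := by
  have hc : Cauchy (map f atTop) := by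
    rw [Metric.cauchy_iff]
    refine ⟨inferInstance, fun ε hε => ?_⟩
    obtain ⟨g, ⟨L, hL⟩, hfg⟩ := h (ε / 5) (by positivity)
    have hgL := hL.eventually (Metric.ball_mem_nhds L (show 0 < ε / 5 by positivity))
    refine ⟨Metric.ball L (ε / 2), ?_, fun x hx y hy => ?_⟩
    · rw [mem_map]
      filter_upwards [hfg, hgL] with T h1 h2
      rw [Real.dist_eq] at h2
      rw [Set.mem_preimage, Metric.mem_ball, Real.dist_eq]
      linarith [abs_sub_le (f T) (g T) L]
    · linarith [dist_triangle_right x y L, Metric.mem_ball.1 hx, Metric.mem_ball.1 hy]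
  exact cauchy_iff_exists_le_nhds.1 hc

/-- `γ` is hyperbolic with `u_γ = n` and `f_γ = m`. -/
def hypUF (n m : ℕ) (γ : SL2Z) : Prop := 2 < |trZ γ| ∧ HasUF γ n m

theorem abs_prop_hypUF_sub_le {n m : ℕ} (hn : n ≠ 0) (hm : m ≠ 0) (y : ℕ) (T : ℝ) :
    |prop T (hypUF n m) - prop T (IsLocalUF y n m)| ≤
      prop T (tail y) + prop T (fun γ => ¬ 2 < |trZ γ|) := by
  have h1 : prop T (hypUF n m) ≤ prop T (IsLocalUF y n m) := prop_mono fun γ h => h.2.isLocalUF hn y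
  have h2 : prop T (IsLocalUF y n m) ≤
      prop T (hypUF n m) + (prop T (tail y) + prop T (fun γ => ¬ 2 < |trZ γ|)) := by
    refine (prop_mono (Q := fun γ => hypUF n m γ ∨ (tail y γ ∨ ¬ 2 < |trZ γ|)) fun γ h => ?_).trans
      ((prop_or_le T _ _).trans (add_le_add le_rfl (prop_or_le T _ _)))
    by_cases ht : 2 < |trZ γ|
    · by_cases hy : tail y γ
      · exact Or.inr (Or.inl hy)
      · exact Or.inl ⟨ht, h.hasUF hn hm ht hy⟩
    · exact Or.inr (Or.inr ht)
  rw [abs_le]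
  have := prop_nonneg T (tail y)
  have := prop_nonneg T (fun γ => ¬ 2 < |trZ γ|)
  constructor <;> linarith

theorem exists_tendsto_prop_hypUF {n m : ℕ} (hn : n ≠ 0) (hm : m ≠ 0) :
    ∃ L, Tendsto (fun T => prop T (hypUF n m)) atTop (𝓝 L) := by
  refine exists_tendsto_of_approx fun ε hε => ?_
  obtain ⟨R, hR⟩ := exists_prop_tail_le (half_pos hε)
  obtain ⟨L, hL⟩ := (modInvariant_isLocalUF R hn hm).exists_tendsto (localMod_ne_zero R hn hm)
  refine ⟨fun T => prop T (IsLocalUF R n m), ⟨L, by simpa using hL 1⟩, ?_⟩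
  filter_upwards [hR R le_rfl, eventually_prop_small_trace_le (half_pos hε)] with T h1 h2
  linarith [abs_prop_hypUF_sub_le hn hm R T]

/-- The discriminant `Tr(γ)² - 4` has no square factor `p²` with `p` prime, `y < p ≤ Y`. -/
def SqfreeBetween (y Y : ℕ) (γ : SL2Z) : Prop :=
  ∀ p : ℕ, p.Prime → y < p → p ≤ Y → ¬ ((p ^ 2 : ℕ) : ℤ) ∣ trZ γ ^ 2 - 4

/-- The product of the `p²` with `p` prime, `y < p ≤ Y`. -/
def betweenMod (y Y : ℕ) : ℕ := ∏ p ∈ (Finset.Icc (y + 1) Y).filter Nat.Prime, p ^ 2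

theorem betweenMod_ne_zero (y Y : ℕ) : betweenMod y Y ≠ 0 :=
  Finset.prod_ne_zero_iff.2 fun _ hp => pow_ne_zero _ (Finset.mem_filter.1 hp).2.ne_zero

theorem modInvariant_sqfreeBetween (y Y : ℕ) : ModInvariant (betweenMod y Y) (SqfreeBetween y Y) := by
  intro γ γ' h hγ p hp hy hY hd
  refine hγ p hp hy hY ?_
  have h1 : p ^ 2 ∣ betweenMod y Y :=
    Finset.dvd_prod_of_mem _ (Finset.mem_filter.2 ⟨Finset.mem_Icc.2 ⟨hy, hY⟩, hp⟩)
  exact (dvd_iff_dvd_of_dvd_sub ((Int.natCast_dvd_natCast.2 h1).trans (redMod_eq_trZ_dvd h))).2 hd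

theorem coprime_localMod_betweenMod {y n m : ℕ} (Y : ℕ) (hn : n ≠ 0) (hm : m ≠ 0) (h2 : 2 ≤ y)
    (hy : n * m ≤ y) : (localMod y n m).Coprime (betweenMod y Y) := by
  refine Nat.Coprime.prod_right fun p hp => Nat.Coprime.pow_right 2 ?_
  obtain ⟨h1, hp⟩ := Finset.mem_filter.1 hp
  have hpy : y < p := (Finset.mem_Icc.1 h1).1
  refine ((Nat.Prime.coprime_iff_not_dvd hp).2 fun h => ?_).symm
  unfold localMod at h
  rcases hp.dvd_mul.1 h with h | h
  · rcases hp.dvd_mul.1 h with h | h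
    · have : p ∣ 2 := hp.dvd_of_dvd_pow (show p ∣ 2 ^ 4 by exact h)
      have := Nat.le_of_dvd two_pos this
      omega
    · have := Nat.le_of_dvd (Nat.pos_of_ne_zero (mul_ne_zero hn hm)) (hp.dvd_of_dvd_pow h)
      omega
  · have := (hp.dvd_factorial).1 (hp.dvd_of_dvd_pow h)
    omega

theorem pos_of_tendsto_prop_hypUF {n m : ℕ} (hn : n ≠ 0) (hm : m ≠ 0) {L : ℝ}
    (hL : Tendsto (fun T => prop T (hypUF n m)) atTop (𝓝 L)) : 0 < L := by
  obtain ⟨R₀, hR₀⟩ := exists_prop_tail_le (show (0 : ℝ) < 1 / 4 by norm_num)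
  set y := max R₀ (max 2 (n * m)) with hy
  have hyR : R₀ ≤ y := le_max_left _ _
  have hy2 : 2 ≤ y := (le_max_left _ _).trans (le_max_right _ _)
  have hynm : n * m ≤ y := (le_max_right _ _).trans (le_max_right _ _)
  set M := localMod y n m with hM
  have hM0 : M ≠ 0 := localMod_ne_zero y hn hm
  set k : ℝ := (numClasses M : ℝ) with hk
  have hk0 : 0 < k := Nat.cast_pos.2 (numClasses_pos M hM0)
  obtain ⟨g, hg⟩ := exists_isLocalUF y hn hm
  obtain ⟨R₁, hR₁⟩ := exists_prop_tail_le (show (0 : ℝ) < 1 / (8 * k) by positivity)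
  set Y := max R₁ y with hY
  have hYy : y ≤ Y := le_max_right _ _
  obtain ⟨β, hβ⟩ := (modInvariant_sqfreeBetween y Y).exists_tendsto (betweenMod_ne_zero y Y)
  replace hβ : Tendsto (fun T => prop T (SqfreeBetween y Y)) atTop (𝓝 β) := by simpa using hβ 1
  have hβ2 : 1 / 2 ≤ β := by
    refine ge_of_tendsto hβ ?_
    filter_upwards [hR₀ y hyR, eventually_prop_small_trace_le (show (0 : ℝ) < 1 / 4 by norm_num),
      eventually_ge_atTop 4] with T h1 h2 h4
    have h3 : prop T (fun _ => True) ≤ prop T (SqfreeBetween y Y) +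
        (prop T (tail y) + prop T (fun γ => ¬ 2 < |trZ γ|)) := by
      refine (prop_mono (Q := fun γ => SqfreeBetween y Y γ ∨ (tail y γ ∨ ¬ 2 < |trZ γ|)) fun γ _ => ?_).trans
        ((prop_or_le T _ _).trans (add_le_add le_rfl (prop_or_le T _ _)))
      by_cases ht : 2 < |trZ γ|
      · by_cases hty : tail y γ
        · exact Or.inr (Or.inl hty)
        · exact Or.inl fun p hp hyp _ hd => hty ⟨ht, p, hp, hyp, hd⟩
      · exact Or.inr (Or.inr ht)
    rw [prop_true h4] at h3
    linarith
  have hmain := tendsto_prop_class_and hM0 (betweenMod_ne_zero y Y)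
    (coprime_localMod_betweenMod Y hn hm hy2 hynm) g (modInvariant_sqfreeBetween y Y) hβ
  have hle : β / k ≤ L + (1 / (8 * k) + 1 / (8 * k)) := by
    refine le_of_tendsto_of_tendsto hmain (hL.add_const _) ?_
    filter_upwards [hR₁ Y (le_max_left _ _),
      eventually_prop_small_trace_le (show (0 : ℝ) < 1 / (8 * k) by positivity)] with T h1 h2
    refine (prop_mono (Q := fun γ => hypUF n m γ ∨ (tail Y γ ∨ ¬ 2 < |trZ γ|)) fun γ hγ => ?_).trans
      ((prop_or_le T _ _).trans (add_le_add le_rfl ((prop_or_le T _ _).trans (add_le_add h1 h2))))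
    by_cases ht : 2 < |trZ γ|
    · by_cases htY : tail Y γ
      · exact Or.inr (Or.inl htY)
      · refine Or.inl ⟨ht, IsLocalUF.hasUF hn hm (modInvariant_isLocalUF y hn hm g γ hγ.1.symm hg) ht ?_⟩
        rintro ⟨-, p, hp, hyp, hd⟩
        rcases le_or_gt p Y with hpY | hpY
        · exact hγ.2 p hp hyp hpY hd
        · exact htY ⟨ht, p, hp, hpY, hd⟩
    · exact Or.inr (Or.inr ht)
  have h1 : 1 / 2 / k ≤ β / k := by gcongr
  have h2 : 1 / 2 / k = 1 / (8 * k) + 1 / (8 * k) + 1 / (4 * k) := by field_simp; norm_num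
  have h3 : 0 < 1 / (4 * k) := by positivity
  linarith

theorem sum_prop_le_of_disjoint {T : ℝ} {β : Type*} [DecidableEq β] (s : Finset β)
    (P : β → SL2Z → Prop) (hP : ∀ b ∈ s, ∀ b' ∈ s, ∀ γ, P b γ → P b' γ → b = b') :
    ∑ b ∈ s, prop T (P b) ≤ prop T (fun γ => ∃ b ∈ s, P b γ) := by
  induction s using Finset.induction_on with
  | empty => simpa using prop_nonneg T _
  | insert a s ha ih =>
    rw [Finset.sum_insert ha, ← prop_and_add T (fun γ => ∃ b ∈ insert a s, P b γ) (P a)]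
    refine add_le_add (prop_mono fun γ h => ⟨⟨a, Finset.mem_insert_self _ _, h⟩, h⟩) ?_
    refine (ih fun b hb b' hb' => hP b (Finset.mem_insert_of_mem hb) b' (Finset.mem_insert_of_mem hb')).trans
      (prop_mono ?_)
    rintro γ ⟨b, hb, h⟩
    refine ⟨⟨b, Finset.mem_insert_of_mem hb, h⟩, fun h' => ha ?_⟩
    rw [hP a (Finset.mem_insert_self _ _) b (Finset.mem_insert_of_mem hb) γ h' h]
    exact hb

theorem le_prod_pow_of_not_dvd {y a : ℕ} (ha : a ≠ 0) {k : ℕ → ℕ}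
    (hy : ∀ p, p.Prime → p ∣ a → p ≤ y) (hk : ∀ p, p.Prime → p ∣ a → ¬ p ^ k p ∣ a) :
    a ≤ ∏ p ∈ Finset.Icc 1 y, p ^ k p := by
  calc a = ∏ p ∈ a.primeFactors, p ^ a.factorization p := (Nat.prod_factorization_pow_eq_self ha).symm
    _ ≤ ∏ p ∈ a.primeFactors, p ^ k p := by
      refine Finset.prod_le_prod' fun p hp => ?_
      have hpp := Nat.prime_of_mem_primeFactors hp
      refine Nat.pow_le_pow_right hpp.pos ?_
      by_contra! h
      exact hk p hpp (Nat.dvd_of_mem_primeFactors hp) ((hpp.pow_dvd_iff_le_factorization ha).2 h.le)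
    _ ≤ ∏ p ∈ Finset.Icc 1 y, p ^ k p := by
      refine Finset.prod_le_prod_of_subset_of_one_le' (fun p hp => ?_) fun p hp _ =>
        Nat.one_le_pow _ _ (Finset.mem_Icc.1 hp).1
      have hpp := Nat.prime_of_mem_primeFactors hp
      exact Finset.mem_Icc.2 ⟨hpp.pos, hy p hpp (Nat.dvd_of_mem_primeFactors hp)⟩

theorem exists_prop_hypUF_ge {ε : ℝ} (hε : 0 < ε) :
    ∃ K : ℕ, ∀ᶠ T : ℝ in atTop,
      1 - ε ≤ prop T (fun γ => ∃ x ∈ Finset.range K ×ˢ Finset.range K, hypUF (x.1 + 1) (x.2 + 1) γ) := by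
  obtain ⟨y, hy⟩ := exists_prop_tail_le (show 0 < ε / 3 by positivity)
  have hex : ∀ p : ℕ, ∃ k : ℕ, p.Prime →
      ∀ᶠ T : ℝ in atTop, prop T (fun γ => ((p ^ k : ℕ) : ℤ) ∣ trZ γ ^ 2 - 4) ≤ ε / 3 / (y + 1) := by
    intro p
    by_cases hp : p.Prime
    · obtain ⟨k, hk⟩ := exists_pow_prop_disc_le hp (show 0 < ε / 3 / (y + 1) by positivity)
      exact ⟨k, fun _ => hk⟩
    · exact ⟨0, fun h => absurd h hp⟩
  choose k hk using hex
  set S := (Finset.Icc 1 y).filter Nat.Prime with hS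
  have hScard : (S.card : ℝ) ≤ y + 1 := by
    have : S.card ≤ y := (Finset.card_filter_le _ _).trans (by simp)
    have : (S.card : ℝ) ≤ y := by exact_mod_cast this
    linarith
  refine ⟨∏ p ∈ Finset.Icc 1 y, p ^ k p, ?_⟩
  set K := ∏ p ∈ Finset.Icc 1 y, p ^ k p with hK
  have hall : ∀ᶠ T : ℝ in atTop, ∀ p ∈ S,
      prop T (fun γ => ((p ^ k p : ℕ) : ℤ) ∣ trZ γ ^ 2 - 4) ≤ ε / 3 / (y + 1) :=
    (Finset.eventually_all S).2 fun p hp => hk p (Finset.mem_filter.1 hp).2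
  filter_upwards [hy y le_rfl, eventually_prop_small_trace_le (show 0 < ε / 3 by positivity), hall,
    eventually_ge_atTop 4] with T h1 h2 h3 h4
  have hcov : prop T (fun _ => True) ≤
      prop T (fun γ => ∃ x ∈ Finset.range K ×ˢ Finset.range K, hypUF (x.1 + 1) (x.2 + 1) γ) +
        (prop T (tail y) + (prop T (fun γ => ¬ 2 < |trZ γ|) +
          prop T (fun γ => ∃ p ∈ S, ((p ^ k p : ℕ) : ℤ) ∣ trZ γ ^ 2 - 4))) := by
    refine le_trans (prop_mono (Q := fun γ =>
      (∃ x ∈ Finset.range K ×ˢ Finset.range K, hypUF (x.1 + 1) (x.2 + 1) γ) ∨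
        (tail y γ ∨ (¬ 2 < |trZ γ| ∨ ∃ p ∈ S, ((p ^ k p : ℕ) : ℤ) ∣ trZ γ ^ 2 - 4))) fun γ _ => ?_)
      ((prop_or_le T _ _).trans (add_le_add le_rfl ((prop_or_le T _ _).trans
        (add_le_add le_rfl (prop_or_le T _ _)))))
    by_contra! hno
    obtain ⟨hnoE, hnt, ht, hnp⟩ := hno
    obtain ⟨n, m, hn, hm, h⟩ := exists_hasUF ht
    have hd := h.sq_dvd hn
    have hsmall : ∀ p : ℕ, p.Prime → p ∣ n * m → p ≤ y := by
      intro p hp hpd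
      by_contra! hpy
      exact hnt ⟨ht, p, hp, hpy, (Int.natCast_dvd_natCast.2 (pow_dvd_pow_of_dvd hpd 2)).trans hd⟩
    have hle : n * m ≤ K := by
      refine le_prod_pow_of_not_dvd (mul_ne_zero hn hm) hsmall fun p hp hpa hpd => ?_
      refine hnp p (Finset.mem_filter.2 ⟨Finset.mem_Icc.2 ⟨hp.pos, hsmall p hp hpa⟩, hp⟩) ?_
      exact (Int.natCast_dvd_natCast.2 (hpd.trans (dvd_pow_self _ two_ne_zero))).trans hd
    obtain ⟨n, rfl⟩ := Nat.exists_eq_succ_of_ne_zero hn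
    obtain ⟨m, rfl⟩ := Nat.exists_eq_succ_of_ne_zero hm
    refine hnoE (n, m) ?_ ⟨ht, h⟩
    rw [Finset.mem_product, Finset.mem_range, Finset.mem_range]
    simp only [Nat.succ_eq_add_one] at hle
    constructor <;> nlinarith
  rw [prop_true h4] at hcov
  have h5 : prop T (fun γ => ∃ p ∈ S, ((p ^ k p : ℕ) : ℤ) ∣ trZ γ ^ 2 - 4) ≤ ε / 3 := by
    refine (prop_exists_le S _).trans ((Finset.sum_le_sum h3).trans ?_)
    rw [Finset.sum_const, nsmul_eq_mul]
    calc (S.card : ℝ) * (ε / 3 / (y + 1)) ≤ (y + 1) * (ε / 3 / (y + 1)) := by gcongr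
      _ = ε / 3 := by field_simp
  linarith

/-- There are positive reals `q_{n,m}` (`n,m ≥ 1`) summing to `1` such that for all
`n, m ≥ 1`, the proportion of `γ ∈ Γ_T` which are hyperbolic with `u_γ = n`, `f_γ = m`
converges to `q_{n,m}` as `T → ∞`. -/
theorem statement7 :
    ∃ q : ℕ → ℕ → ℝ,
      (∀ n m : ℕ, 1 ≤ n → 1 ≤ m → 0 < q n m) ∧
      (∑' n : ℕ, ∑' m : ℕ, q (n + 1) (m + 1)) = 1 ∧
      ∀ n m : ℕ, 1 ≤ n → 1 ≤ m →
        Tendsto (fun T : ℝ =>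
            (Nat.card {γ : SL2Z // frobNorm γ ≤ T ∧ 2 < |trZ γ| ∧ HasUF γ n m} : ℝ) /
              (Nat.card {γ : SL2Z // frobNorm γ ≤ T} : ℝ))
          atTop (𝓝 (q n m)) := by
  have hex : ∀ n m : ℕ, ∃ L : ℝ, 1 ≤ n → 1 ≤ m → Tendsto (fun T => prop T (hypUF n m)) atTop (𝓝 L) := by
    intro n m
    by_cases h : 1 ≤ n ∧ 1 ≤ m
    · obtain ⟨L, hL⟩ := exists_tendsto_prop_hypUF (n := n) (m := m) (by omega) (by omega)
      exact ⟨L, fun _ _ => hL⟩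
    · exact ⟨0, fun h1 h2 => absurd ⟨h1, h2⟩ h⟩
  choose q hq using hex
  have hpos : ∀ n m : ℕ, 1 ≤ n → 1 ≤ m → 0 < q n m := fun n m hn hm =>
    pos_of_tendsto_prop_hypUF (by omega) (by omega) (hq n m hn hm)
  refine ⟨q, hpos, ?_, fun n m hn hm => ?_⟩
  · have hlim : ∀ s : Finset (ℕ × ℕ), Tendsto (fun T => ∑ x ∈ s, prop T (hypUF (x.1 + 1) (x.2 + 1))) atTop
        (𝓝 (∑ x ∈ s, q (x.1 + 1) (x.2 + 1))) := fun s =>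
      tendsto_finsetSum s fun x _ => hq _ _ (by omega) (by omega)
    have hsum : HasSum (fun x : ℕ × ℕ => q (x.1 + 1) (x.2 + 1)) 1 := by
      refine hasSum_of_isLUB_of_nonneg _ (fun x => (hpos _ _ (by omega) (by omega)).le) ⟨?_, ?_⟩
      · rintro _ ⟨s, rfl⟩
        refine le_of_tendsto' (hlim s) fun T => ?_
        refine (sum_prop_le_of_disjoint s (fun x => hypUF (x.1 + 1) (x.2 + 1)) ?_).trans (prop_le_one T _)
        rintro ⟨a, b⟩ - ⟨a', b'⟩ - γ h h'
        obtain ⟨h1, h2⟩ := h.2.unique (by omega) h'.2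
        simp only [Prod.mk.injEq]
        omega
      · intro u hu
        refine le_of_forall_pos_le_add fun ε hε => ?_
        obtain ⟨K, hK⟩ := exists_prop_hypUF_ge hε
        have h1 : 1 - ε ≤ ∑ x ∈ Finset.range K ×ˢ Finset.range K, q (x.1 + 1) (x.2 + 1) := by
          refine ge_of_tendsto (hlim _) ?_
          filter_upwards [hK] with T hT
          exact hT.trans (prop_exists_le _ _)
        have h2 := hu ⟨Finset.range K ×ˢ Finset.range K, rfl⟩
        dsimp only at h2
        linarith
    rw [← hsum.summable.tsum_prod, hsum.tsum_eq]
  · refine (hq n m hn hm).congr fun T => ?_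
    have h1 := natCard_eq_cnt T (fun _ => True)
    simp only [and_true] at h1
    unfold prop
    rw [h1, natCard_eq_cnt T (fun γ => 2 < |trZ γ| ∧ HasUF γ n m)]
    rfl
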